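/- Suppose f : ℍ → ℂ is harmonic and bounded. Then there exist coefficients a₀ ∈ ℂ and aₙ, bₙ ∈ ℂ (n ∈ ℤ \ {0}) with |aₙ|, |bₙ| = O(log³(2 + |n|)) as |n| → +∞, such that f(τ) = a₀ + Σ_{n>0} (aₙ e^{iπnτ} + bₙ e^{−iπn/τ}) + Σ_{n<0} (aₙ e^{iπn·conj(τ)} + bₙ e^{−iπn/conj(τ)}) for all τ ∈ ℍ, the series converging absolutely and uniformly on compact subsets of ℍ; moreover, the coefficients are uniquely determined by f. -/

import Mathlib

open Filter

noncomputable section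

/-- A function `h : ℂ → ℂ` is harmonic on the upper half-plane `ℍ` if, writing
`τ = x + iy`, it is twice continuously differentiable as a function of `(x, y)` there
and satisfies `∂²h/∂x² + ∂²h/∂y² = 0` on `ℍ`. -/
def HarmonicOnH (h : ℂ → ℂ) : Prop :=
  ContDiffOn ℝ 2 (fun p : ℝ × ℝ => h ((p.1 : ℂ) + (p.2 : ℂ) * Complex.I))
      {p : ℝ × ℝ | 0 < p.2} ∧
  ∀ τ : ℂ, 0 < τ.im →
    deriv (fun x : ℝ => deriv (fun x' : ℝ => h ((x' : ℂ) + (τ.im : ℂ) * Complex.I)) x) τ.re +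
      deriv (fun y : ℝ => deriv (fun y' : ℝ => h ((τ.re : ℂ) + (y' : ℂ) * Complex.I)) y) τ.im = 0

/-- The `n`-th term of the harmonic hyperbolic Fourier series with coefficients
`a b : ℤ → ℂ` at a point `τ` of the upper half-plane: for `n > 0` the term
`aₙ e^{iπnτ} + bₙ e^{-iπn/τ}`, for `n < 0` the term
`aₙ e^{iπn·conj τ} + bₙ e^{-iπn/conj τ}`, and the constant `a₀` for `n = 0`. -/
def hfsTerm (a b : ℤ → ℂ) (τ : ℂ) (n : ℤ) : ℂ :=
  if 0 < n then
    a n * Complex.exp (Complex.I * (Real.pi : ℂ) * (n : ℂ) * τ)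
      + b n * Complex.exp (-(Complex.I * (Real.pi : ℂ) * (n : ℂ)) / τ)
  else if n < 0 then
    a n * Complex.exp (Complex.I * (Real.pi : ℂ) * (n : ℂ) * (starRingEnd ℂ τ))
      + b n * Complex.exp (-(Complex.I * (Real.pi : ℂ) * (n : ℂ)) / (starRingEnd ℂ τ))
  else a 0

/-- The harmonic hyperbolic Fourier series with coefficients `a b : ℤ → ℂ` represents
`f` on the upper half-plane: it converges pointwise to `f`, converges absolutely, and
converges uniformly on every compact subset of the upper half-plane. -/
def HHFSExpansion (a b : ℤ → ℂ) (f : ℂ → ℂ) : Prop :=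
  (∀ τ : ℂ, 0 < τ.im → HasSum (fun n : ℤ => hfsTerm a b τ n) (f τ)) ∧
  (∀ τ : ℂ, 0 < τ.im → Summable (fun n : ℤ => ‖hfsTerm a b τ n‖)) ∧
  (∀ K : Set ℂ, K ⊆ {τ : ℂ | 0 < τ.im} → IsCompact K →
    TendstoUniformlyOn (fun (s : Finset ℤ) (τ : ℂ) => ∑ n ∈ s, hfsTerm a b τ n) f atTop K)

/-- Coefficient growth `O(log³(2+|n|))` as `|n| → ∞`. -/
def CubeLogGrowth (a b : ℤ → ℂ) : Prop :=
  ∃ C N : ℝ, ∀ n : ℤ, N ≤ |(n : ℝ)| →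
    ‖a n‖ ≤ C * Real.log (2 + |(n : ℝ)|) ^ 3 ∧
    ‖b n‖ ≤ C * Real.log (2 + |(n : ℝ)|) ^ 3

section

open Complex ModularGroup CongruenceSubgroup
open UpperHalfPlane hiding I
open scoped Topology MatrixGroups ModularForm Manifold

theorem levelOne_weight_four_eq_zero {Y : ℂ → ℂ} (hd : ∀ τ : ℂ, 0 < τ.im → DifferentiableAt ℂ Y τ)
    (hT : ∀ τ : ℂ, 0 < τ.im → Y (τ + 1) = Y τ)
    (hS : ∀ τ : ℂ, 0 < τ.im → Y (-1 / τ) = τ ^ 4 * Y τ)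
    (h0 : Tendsto Y (comap Complex.im atTop) (𝓝 0)) {τ : ℂ} (hτ : 0 < τ.im) : Y τ = 0 := by
  have hS' : (fun z : ℍ => Y z) ∣[(4 : ℤ)] S = fun z : ℍ => Y z := by
    ext z
    rw [ModularForm.SL_slash_apply]
    have : ((S • z : ℍ) : ℂ) = -1 / z := by
      rw [UpperHalfPlane.modular_S_smul]
      simp [neg_div, inv_neg]
    rw [this, hS z z.2, denom_S]
    have := z.ne_zero
    field_simp
  have hT' : (fun z : ℍ => Y z) ∣[(4 : ℤ)] T = fun z : ℍ => Y z := by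
    ext z
    rw [ModularForm.SL_slash_apply]
    have : ((T • z : ℍ) : ℂ) = z + 1 := by
      rw [UpperHalfPlane.modular_T_smul]
      simp [add_comm]
    rw [this, hT z z.2, ModularGroup.denom_apply]
    simp [T]
  let F : CuspForm 𝒮ℒ 4 :=
    { toFun := fun z => Y z
      slash_action_eq' := by
        rintro A ⟨A, rfl⟩
        exact SlashInvariantForm.slash_action_generators_SL2Z hS' hT' A
      holo' := by
        rw [UpperHalfPlane.mdifferentiable_iff]
        refine DifferentiableOn.congr (f := Y) (fun z hz ↦ (hd z hz).differentiableWithinAt)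
          fun z hz ↦ ?_
        simp [ofComplex_apply_of_im_pos hz]
      zero_at_cusps' := by
        intro c hc
        rw [Subgroup.IsArithmetic.isCusp_iff_isCusp_SL2Z] at hc
        rw [OnePoint.isZeroAt_iff_forall_SL2Z hc]
        intro γ _
        change IsZeroAtImInfty ((fun z : ℍ => Y z) ∣[(4 : ℤ)] γ)
        rw [SlashInvariantForm.slash_action_generators_SL2Z hS' hT']
        exact h0.comp (tendsto_comap_iff.2 tendsto_comap) }
  have hF : F = 0 := rank_zero_iff_forall_zero.mp
    (CuspForm.rank_eq_zero_of_weight_lt_twelve (by norm_num)) F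
  exact congrFun (congrArg (fun G : CuspForm 𝒮ℒ 4 => (G : ℍ → ℂ)) hF) ⟨τ, hτ⟩

/-- Induction over `SL₂(ℤ)`-orbits in the upper half-plane. -/
theorem modular_induction {P : ℂ → Prop}
    (hfd : ∀ τ : ℂ, 1 / 2 ≤ τ.im → P τ)
    (hT : ∀ τ : ℂ, 0 < τ.im → (P (τ + 1) ↔ P τ))
    (hS : ∀ τ : ℂ, 0 < τ.im → (P (-1 / τ) ↔ P τ)) {τ : ℂ} (hτ : 0 < τ.im) : P τ := by
  have key : ∀ γ : SL(2, ℤ), ∀ z : ℍ, P (γ • z : ℍ) ↔ P z := by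
    intro γ
    have hγ : γ ∈ Subgroup.closure ({S, T} : Set SL(2, ℤ)) := by
      rw [SpecialLinearGroup.SL2Z_generators]; trivial
    induction hγ using Subgroup.closure_induction with
    | mem x hx =>
      intro z
      rcases hx with rfl | rfl
      · rw [← hS z z.2, UpperHalfPlane.modular_S_smul]
        simp [neg_div, inv_neg]
      · rw [← hT z z.2, UpperHalfPlane.modular_T_smul]
        simp [add_comm]
    | one => intro z; simp
    | mul x y _ _ hx hy => intro z; rw [mul_smul, hx, hy]
    | inv x _ hx => intro z; rw [← hx (x⁻¹ • z), smul_inv_smul]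
  obtain ⟨γ, hγ, -⟩ := exists_one_half_le_im_smul_and_norm_denom_le ⟨τ, hτ⟩
  exact (key γ ⟨τ, hτ⟩).1 (hfd _ hγ)

theorem im_neg_one_div {τ : ℂ} (hτ : 0 < τ.im) : 0 < (-1 / τ).im := by
  rw [neg_div, neg_im, one_div, inv_im, neg_div, neg_neg]
  exact div_pos hτ (normSq_pos.2 (fun h => by simp [h] at hτ))

theorem im_neg_one_div_eq (τ : ℂ) : (-1 / τ).im = τ.im / normSq τ := by
  rw [neg_div, neg_im, one_div, inv_im, neg_div, neg_neg]

theorem ne_zero_of_im_pos {τ : ℂ} (hτ : 0 < τ.im) : τ ≠ 0 := fun h => by simp [h] at hτ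

/-- The fourth power of the theta constant `θ₂`. -/
def thX2 (τ : ℂ) : ℂ := exp (Real.pi * I * τ) * jacobiTheta₂ (τ / 2) τ ^ 4

/-- The fourth power of the theta constant `θ₃`. -/
def thX3 (τ : ℂ) : ℂ := jacobiTheta₂ 0 τ ^ 4

/-- The fourth power of the theta constant `θ₄`. -/
def thX4 (τ : ℂ) : ℂ := jacobiTheta₂ (1 / 2) τ ^ 4

theorem jacobiTheta₂_half_eq (τ : ℂ) : jacobiTheta₂ (1 / 2) τ = jacobiTheta₂ 0 (τ + 1) := by
  refine tsum_congr fun n => ?_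
  simp only [jacobiTheta₂_term]
  have : exp (Real.pi * I * (n ^ 2 - n)) = 1 := by
    obtain ⟨k, hk⟩ := Int.even_mul_pred_self n
    rw [exp_eq_one_iff]
    refine ⟨k, ?_⟩
    have : (n : ℂ) ^ 2 - n = 2 * k := by
      have h2 : n ^ 2 - n = 2 * k := by linear_combination hk
      exact_mod_cast h2
    rw [this]; ring
  symm
  rw [show 2 * Real.pi * I * n * 0 + Real.pi * I * n ^ 2 * (τ + 1) =
    Real.pi * I * (n ^ 2 - n) + (2 * Real.pi * I * n * (1 / 2) + Real.pi * I * n ^ 2 * τ) by ring,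
    Complex.exp_add, this, one_mul]

theorem thX3_add_one (τ : ℂ) : thX3 (τ + 1) = thX4 τ := by
  rw [thX3, thX4, jacobiTheta₂_half_eq]

theorem thX4_add_one (τ : ℂ) : thX4 (τ + 1) = thX3 τ := by
  rw [thX3, thX4, jacobiTheta₂_half_eq, show τ + 1 + 1 = τ + 2 by ring, jacobiTheta₂_add_right]

theorem thX2_add_one (τ : ℂ) : thX2 (τ + 1) = -thX2 τ := by
  have : jacobiTheta₂ ((τ + 1) / 2) (τ + 1) = jacobiTheta₂ (τ / 2) τ := by
    refine tsum_congr fun n => ?_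
    simp only [jacobiTheta₂_term]
    have : exp (Real.pi * I * (n ^ 2 + n)) = 1 := by
      obtain ⟨k, hk⟩ := Int.even_mul_succ_self n
      rw [exp_eq_one_iff]
      refine ⟨k, ?_⟩
      have : (n : ℂ) ^ 2 + n = 2 * k := by
        have h2 : n ^ 2 + n = 2 * k := by linear_combination hk
        exact_mod_cast h2
      rw [this]; ring
    conv_rhs => rw [← mul_one (exp _), ← this, ← Complex.exp_add]
    congr 1; ring
  rw [thX2, thX2, this, mul_add, mul_one, Complex.exp_add, Complex.exp_pi_mul_I]
  ring

theorem sqrt_factor_pow (τ : ℂ) : ((-I * τ) ^ (1 / 2 : ℂ)) ^ 4 = -τ ^ 2 := by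
  have h : ((-I * τ) ^ (1 / 2 : ℂ)) ^ 2 = -I * τ := by
    rw [one_div]; exact_mod_cast Complex.cpow_nat_inv_pow (-I * τ) (n := 2) (by norm_num)
  rw [show (4 : ℕ) = 2 * 2 by norm_num, pow_mul, h, mul_pow, neg_sq, I_sq]; ring

theorem thX3_S {τ : ℂ} (hτ : 0 < τ.im) : thX3 (-1 / τ) = -τ ^ 2 * thX3 τ := by
  have h := jacobiTheta₂_functional_equation 0 τ
  have h0 := ne_zero_of_im_pos hτ
  have h2 := sqrt_factor_pow τ
  rw [thX3, thX3, h, mul_pow, mul_pow, div_pow, h2]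
  simp; field_simp

theorem thX4_S {τ : ℂ} (hτ : 0 < τ.im) : thX4 (-1 / τ) = -τ ^ 2 * thX2 τ := by
  have h := jacobiTheta₂_functional_equation (τ / 2) τ
  have h0 := ne_zero_of_im_pos hτ
  have h2 := sqrt_factor_pow τ
  rw [thX4, thX2, h, mul_pow, mul_pow, div_pow, h2, ← Complex.exp_nat_mul,
    show τ / 2 / τ = 1 / 2 by field_simp,
    show ((4 : ℕ) : ℂ) * (-Real.pi * I * (τ / 2) ^ 2 / τ) = -(Real.pi * I * τ) by
      push_cast; field_simp; ring, Complex.exp_neg]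
  have := Complex.exp_ne_zero (Real.pi * I * τ)
  field_simp

theorem thX2_S {τ : ℂ} (hτ : 0 < τ.im) : thX2 (-1 / τ) = -τ ^ 2 * thX4 τ := by
  have h := thX4_S (im_neg_one_div hτ)
  have h0 := ne_zero_of_im_pos hτ
  rw [show -1 / (-1 / τ) = τ by field_simp] at h
  rw [h]; field_simp

theorem differentiableAt_thX3 {τ : ℂ} (hτ : 0 < τ.im) : DifferentiableAt ℂ thX3 τ :=
  (differentiableAt_jacobiTheta₂_snd 0 hτ).pow 4

theorem differentiableAt_thX4 {τ : ℂ} (hτ : 0 < τ.im) : DifferentiableAt ℂ thX4 τ :=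
  (differentiableAt_jacobiTheta₂_snd (1 / 2) hτ).pow 4

theorem differentiableAt_thX2 {τ : ℂ} (hτ : 0 < τ.im) : DifferentiableAt ℂ thX2 τ := by
  have h : DifferentiableAt ℂ (fun t : ℂ => jacobiTheta₂ (t / 2) t) τ := by
    have := (hasFDerivAt_jacobiTheta₂ (τ / 2) hτ).differentiableAt
    exact DifferentiableAt.comp (g := fun p : ℂ × ℂ => jacobiTheta₂ p.1 p.2)
      (f := fun t : ℂ => (t / 2, t)) τ this (by fun_prop)
  exact DifferentiableAt.mul (by fun_prop) (h.pow 4)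


theorem exp_neg_pi_lt {v : ℝ} (hv : 3 / 8 ≤ v) : Real.exp (-Real.pi * v) < 0.3126 := by
  have h1 : Real.exp (-Real.pi * v) ≤ Real.exp (-(1 + 0.1775)) := by
    apply Real.exp_le_exp.2
    have := Real.pi_gt_d2
    nlinarith
  have h2 : Real.exp (-(1 + 0.1775)) = (Real.exp 1 * Real.exp 0.1775)⁻¹ := by
    rw [Real.exp_neg, Real.exp_add]
  have h3 := Real.exp_one_gt_d9
  have h4 := Real.add_one_le_exp (0.1775 : ℝ)
  have h5 : (3.2 : ℝ) < Real.exp 1 * Real.exp 0.1775 := by nlinarith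
  rw [h2] at h1
  have h6 : (Real.exp 1 * Real.exp 0.1775)⁻¹ < (3.2 : ℝ)⁻¹ := by gcongr
  have h7 : (3.2 : ℝ)⁻¹ < 0.3126 := by norm_num
  linarith

theorem norm_theta3_sub_one_lt {τ : ℂ} (hτ : 3 / 8 ≤ τ.im) : ‖jacobiTheta₂ 0 τ - 1‖ < 0.92 := by
  have h := norm_jacobiTheta_sub_one_le (τ := τ) (by linarith)
  have h1 := exp_neg_pi_lt hτ
  rw [jacobiTheta_eq_jacobiTheta₂] at h
  refine h.trans_lt ?_
  rw [div_mul_eq_mul_div, div_lt_iff₀ (by linarith)]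
  linarith

theorem norm_theta2_sub_two_le {τ : ℂ} (hτ : 3 / 8 ≤ τ.im) :
    ‖jacobiTheta₂ (τ / 2) τ - 2‖ ≤ 1 := by
  set r := Real.exp (-Real.pi * τ.im) with hr
  have h1 : r < 0.3126 := exp_neg_pi_lt hτ
  have hr0 : 0 < r := Real.exp_pos _
  have hs := (hasSum_jacobiTheta₂_term (τ / 2) (by linarith : 0 < τ.im)).nat_add_neg_add_one
  have ht : ∀ n : ℤ, jacobiTheta₂_term n (τ / 2) τ = exp (Real.pi * I * (n * (n + 1)) * τ) := by
    intro n; rw [jacobiTheta₂_term]; congr 1; ring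
  have ht2 : ∀ n : ℕ, jacobiTheta₂_term n (τ / 2) τ + jacobiTheta₂_term (-((n : ℤ) + 1)) (τ / 2) τ
      = 2 * exp (Real.pi * I * (n * (n + 1)) * τ) := by
    intro n; rw [ht, ht, two_mul]; congr 3; push_cast; ring
  simp_rw [ht2] at hs
  rw [← hasSum_nat_add_iff' 1] at hs
  simp only [Finset.range_one, Finset.sum_singleton, Nat.cast_zero, zero_mul, mul_zero,
    Complex.exp_zero, mul_one] at hs
  have hg : HasSum (fun n : ℕ => 2 * r ^ 2 * r ^ n) (2 * r ^ 2 * (1 - r)⁻¹) :=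
    (hasSum_geometric_of_lt_one hr0.le (by linarith)).mul_left _
  have hb : ∀ n : ℕ, ‖2 * exp (Real.pi * I * (((n + 1 : ℕ) : ℂ) * (((n + 1 : ℕ) : ℂ) + 1)) * τ)‖
      ≤ 2 * r ^ 2 * r ^ n := by
    intro n
    rw [norm_mul, Complex.norm_exp, mul_assoc (2 : ℝ), ← pow_add, hr, ← Real.exp_nat_mul]
    have h2 : (Real.pi * I * (((n + 1 : ℕ) : ℂ) * (((n + 1 : ℕ) : ℂ) + 1)) * τ).re
        = -Real.pi * τ.im * ((n + 1) * (n + 2)) := by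
      have : Real.pi * I * (((n + 1 : ℕ) : ℂ) * (((n + 1 : ℕ) : ℂ) + 1)) * τ
        = ((Real.pi * ((n + 1) * (n + 2)) : ℝ) : ℂ) * (I * τ) := by push_cast; ring
      rw [this, Complex.re_ofReal_mul]; simp; ring
    rw [h2]
    simp only [Complex.norm_ofNat]
    gcongr 2 * Real.exp ?_
    have : 0 < Real.pi * τ.im := by have := Real.pi_pos; positivity
    push_cast
    have hn : (0 : ℝ) ≤ n := n.cast_nonneg
    nlinarith [mul_nonneg this.le hn, mul_nonneg (mul_nonneg this.le hn) hn]
  have h3 : ‖jacobiTheta₂ (τ / 2) τ - 2‖ ≤ 2 * r ^ 2 * (1 - r)⁻¹ := by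
    rw [← hs.tsum_eq, ← hg.tsum_eq]
    exact tsum_of_norm_bounded hg hb |>.trans_eq hg.tsum_eq.symm
  refine h3.trans ?_
  rw [← div_eq_mul_inv, div_le_one (by linarith)]
  nlinarith

theorem norm_thX2_bounds {τ : ℂ} (hτ : 3 / 8 ≤ τ.im) :
    Real.exp (-Real.pi * τ.im) ≤ ‖thX2 τ‖ ∧ ‖thX2 τ‖ ≤ 81 * Real.exp (-Real.pi * τ.im) := by
  have h := norm_theta2_sub_two_le hτ
  have h1 : ‖jacobiTheta₂ (τ / 2) τ‖ ≤ 3 := by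
    have := norm_le_norm_add_norm_sub' (jacobiTheta₂ (τ / 2) τ) 2
    simp only [Complex.norm_ofNat] at this; linarith
  have h2 : 1 ≤ ‖jacobiTheta₂ (τ / 2) τ‖ := by
    have := norm_le_norm_add_norm_sub (jacobiTheta₂ (τ / 2) τ) 2
    simp only [Complex.norm_ofNat] at this; linarith
  have h3 : ‖thX2 τ‖ = Real.exp (-Real.pi * τ.im) * ‖jacobiTheta₂ (τ / 2) τ‖ ^ 4 := by
    rw [thX2, norm_mul, Complex.norm_exp, norm_pow]
    congr 2
    rw [mul_assoc, Complex.re_ofReal_mul]; simp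
  rw [h3]
  have h4 := Real.exp_pos (-Real.pi * τ.im)
  have h5 : 1 ≤ ‖jacobiTheta₂ (τ / 2) τ‖ ^ 4 := one_le_pow₀ h2
  have h6 : ‖jacobiTheta₂ (τ / 2) τ‖ ^ 4 ≤ 3 ^ 4 := by gcongr
  constructor <;> nlinarith

theorem norm_thX3_bounds {τ : ℂ} (hτ : 3 / 8 ≤ τ.im) :
    0.08 ^ 4 ≤ ‖thX3 τ‖ ∧ ‖thX3 τ‖ ≤ 16 := by
  have h := norm_theta3_sub_one_lt hτ
  have h1 : ‖jacobiTheta₂ 0 τ‖ ≤ 2 := by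
    have := norm_le_norm_add_norm_sub' (jacobiTheta₂ 0 τ) 1
    simp only [norm_one] at this; linarith
  have h2 : 0.08 ≤ ‖jacobiTheta₂ 0 τ‖ := by
    have := norm_le_norm_add_norm_sub (jacobiTheta₂ 0 τ) 1
    simp only [norm_one] at this; linarith
  rw [thX3, norm_pow]
  constructor
  · gcongr
  · calc _ ≤ (2 : ℝ) ^ 4 := by gcongr
      _ = 16 := by norm_num

theorem norm_thX4_bounds {τ : ℂ} (hτ : 3 / 8 ≤ τ.im) :
    0.08 ^ 4 ≤ ‖thX4 τ‖ ∧ ‖thX4 τ‖ ≤ 16 := by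
  rw [← thX3_add_one]
  exact norm_thX3_bounds (by simpa using hτ)

theorem thX_ne_zero {τ : ℂ} (hτ : 0 < τ.im) : thX2 τ * thX3 τ * thX4 τ ≠ 0 := by
  refine modular_induction (P := fun τ => thX2 τ * thX3 τ * thX4 τ ≠ 0) ?_ ?_ ?_ hτ
  · intro τ hτ
    have hτ' : 3 / 8 ≤ τ.im := by linarith
    have h2 := (norm_thX2_bounds hτ').1
    have h3 := (norm_thX3_bounds hτ').1
    have h4 := (norm_thX4_bounds hτ').1
    have := Real.exp_pos (-Real.pi * τ.im)
    refine mul_ne_zero (mul_ne_zero ?_ ?_) ?_ <;> rw [← norm_pos_iff]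
    · linarith
    · exact lt_of_lt_of_le (by norm_num) h3
    · exact lt_of_lt_of_le (by norm_num) h4
  · intro τ _
    rw [thX2_add_one, thX3_add_one, thX4_add_one]
    simp; tauto
  · intro τ hτ
    rw [thX2_S hτ, thX3_S hτ, thX4_S hτ]
    have := ne_zero_of_im_pos hτ
    simp [this]; tauto

theorem thX2_ne_zero {τ : ℂ} (hτ : 0 < τ.im) : thX2 τ ≠ 0 := fun h => thX_ne_zero hτ (by simp [h])
theorem thX3_ne_zero {τ : ℂ} (hτ : 0 < τ.im) : thX3 τ ≠ 0 := fun h => thX_ne_zero hτ (by simp [h])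
theorem thX4_ne_zero {τ : ℂ} (hτ : 0 < τ.im) : thX4 τ ≠ 0 := fun h => thX_ne_zero hτ (by simp [h])

theorem tendsto_theta3 : Tendsto (jacobiTheta₂ 0) (comap Complex.im atTop) (𝓝 1) := by
  rw [tendsto_iff_norm_sub_tendsto_zero]
  have hexp : Tendsto (fun τ : ℂ => Real.exp (-Real.pi * τ.im)) (comap Complex.im atTop) (𝓝 0) :=
    Real.tendsto_exp_atBot.comp
      ((tendsto_comap).const_mul_atTop_of_neg (neg_neg_of_pos Real.pi_pos))
  have h2 := hexp.const_mul (4 : ℝ)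
  rw [mul_zero] at h2
  refine squeeze_zero' (Eventually.of_forall fun _ => norm_nonneg _) ?_ h2
  filter_upwards [preimage_mem_comap (Ici_mem_atTop (3 / 8))] with τ hτ
  have hτ' : 3 / 8 ≤ τ.im := hτ
  have h := norm_jacobiTheta_sub_one_le (τ := τ) (by linarith)
  rw [jacobiTheta_eq_jacobiTheta₂] at h
  refine h.trans ?_
  have h1 := exp_neg_pi_lt hτ'
  gcongr
  rw [div_le_iff₀ (by linarith)]
  linarith

/-- The Jacobi identity. -/
theorem jacobi_identity {τ : ℂ} (hτ : 0 < τ.im) : thX3 τ = thX2 τ + thX4 τ := by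
  suffices h : (thX3 τ - thX2 τ - thX4 τ) ^ 2 = 0 by
    have := pow_eq_zero_iff (two_ne_zero) |>.1 h
    linear_combination this
  refine levelOne_weight_four_eq_zero (Y := fun τ => (thX3 τ - thX2 τ - thX4 τ) ^ 2)
    ?_ ?_ ?_ ?_ hτ
  · intro τ hτ
    exact (((differentiableAt_thX3 hτ).sub (differentiableAt_thX2 hτ)).sub
      (differentiableAt_thX4 hτ)).pow 2
  · intro τ _
    simp only [thX2_add_one, thX3_add_one, thX4_add_one]; ring
  · intro τ hτ
    simp only [thX2_S hτ, thX3_S hτ, thX4_S hτ]; ring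
  · have h3 : Tendsto thX3 (comap Complex.im atTop) (𝓝 1) := by
      rw [← one_pow 4]; exact tendsto_theta3.pow 4
    have h4 : Tendsto thX4 (comap Complex.im atTop) (𝓝 1) := by
      have : Tendsto (fun τ : ℂ => τ + 1) (comap Complex.im atTop) (comap Complex.im atTop) := by
        rw [tendsto_comap_iff]
        refine tendsto_comap.congr fun τ => by simp
      refine (h3.comp this).congr fun τ => thX3_add_one τ
    have h2 : Tendsto thX2 (comap Complex.im atTop) (𝓝 0) := by
      have hexp : Tendsto (fun τ : ℂ => Real.exp (-Real.pi * τ.im)) (comap Complex.im atTop)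
          (𝓝 0) := Real.tendsto_exp_atBot.comp
            ((tendsto_comap).const_mul_atTop_of_neg (neg_neg_of_pos Real.pi_pos))
      have h2 := hexp.const_mul (81 : ℝ)
      rw [mul_zero] at h2
      refine squeeze_zero_norm' ?_ h2
      filter_upwards [preimage_mem_comap (Ici_mem_atTop (3 / 8))] with τ hτ
      exact (norm_thX2_bounds hτ).2
    simpa using ((h3.sub h2).sub h4).pow 2

/-- The modular lambda function. -/
def lam (τ : ℂ) : ℂ := thX2 τ / thX3 τ

theorem differentiableAt_lam {τ : ℂ} (hτ : 0 < τ.im) : DifferentiableAt ℂ lam τ :=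
  (differentiableAt_thX2 hτ).div (differentiableAt_thX3 hτ) (thX3_ne_zero hτ)

theorem lam_ne_zero {τ : ℂ} (hτ : 0 < τ.im) : lam τ ≠ 0 :=
  div_ne_zero (thX2_ne_zero hτ) (thX3_ne_zero hτ)

theorem one_sub_lam {τ : ℂ} (hτ : 0 < τ.im) : 1 - lam τ = thX4 τ / thX3 τ := by
  have := thX3_ne_zero hτ
  have := jacobi_identity hτ
  rw [lam]; field_simp; linear_combination this

theorem one_sub_lam_ne_zero {τ : ℂ} (hτ : 0 < τ.im) : 1 - lam τ ≠ 0 := by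
  rw [one_sub_lam hτ]; exact div_ne_zero (thX4_ne_zero hτ) (thX3_ne_zero hτ)

theorem lam_S {τ : ℂ} (hτ : 0 < τ.im) : lam (-1 / τ) = 1 - lam τ := by
  rw [one_sub_lam hτ, lam, thX2_S hτ, thX3_S hτ]
  have := ne_zero_of_im_pos hτ
  have := thX3_ne_zero hτ
  field_simp

theorem lam_add_one {τ : ℂ} (hτ : 0 < τ.im) : lam (τ + 1) = -(lam τ / (1 - lam τ)) := by
  rw [one_sub_lam hτ, lam, lam, thX2_add_one, thX3_add_one]
  have := thX4_ne_zero hτ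
  have := thX3_ne_zero hτ
  field_simp

theorem lam_add_two (τ : ℂ) : lam (τ + 2) = lam τ := by
  rw [show τ + 2 = τ + 1 + 1 by ring, lam, lam, thX2_add_one, thX2_add_one, thX3_add_one,
    thX4_add_one, neg_neg]

theorem lam_one_sub_inv {w : ℂ} (hw : 0 < w.im) : lam (1 - 1 / w) = 1 - 1 / lam w := by
  have h := lam_add_one (im_neg_one_div hw)
  rw [lam_S hw] at h
  rw [show 1 - 1 / w = -1 / w + 1 by ring, h]
  have := lam_ne_zero hw
  field_simp; ring_nf; field_simp

theorem lam_neg_conj (τ : ℂ) : lam (-(starRingEnd ℂ τ)) = starRingEnd ℂ (lam τ) := by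
  have h3 : thX3 (-(starRingEnd ℂ τ)) = starRingEnd ℂ (thX3 τ) := by
    rw [thX3, thX3, map_pow, jacobiTheta₂_conj, map_zero]
  have h2 : thX2 (-(starRingEnd ℂ τ)) = starRingEnd ℂ (thX2 τ) := by
    rw [thX2, thX2, map_mul, map_pow, jacobiTheta₂_conj, ← Complex.exp_conj]
    congr 2
    · simp
    · rw [map_div₀, ← jacobiTheta₂_neg_left]
      congr 1
      simp [neg_div, Complex.conj_ofNat]
  rw [lam, lam, h2, h3, map_div₀]

theorem exists_norm_lam_bounds : ∃ c C : ℝ, 0 < c ∧ 0 < C ∧ ∀ τ : ℂ, 3 / 8 ≤ τ.im →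
    c * Real.exp (-Real.pi * τ.im) ≤ ‖lam τ‖ ∧ ‖lam τ‖ ≤ C * Real.exp (-Real.pi * τ.im) := by
  refine ⟨1 / 16, 81 / 0.08 ^ 4, by norm_num, by norm_num, fun τ hτ => ?_⟩
  have h2 := norm_thX2_bounds hτ
  have h3 := norm_thX3_bounds hτ
  have h0 : (0 : ℝ) < 0.08 ^ 4 := by norm_num
  have h4 := Real.exp_pos (-Real.pi * τ.im)
  rw [lam, norm_div]
  constructor
  · rw [le_div_iff₀ (by linarith)]
    nlinarith
  · rw [div_le_iff₀ (by linarith)]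
    calc _ ≤ _ := h2.2
      _ = 81 / 0.08 ^ 4 * Real.exp (-Real.pi * τ.im) * 0.08 ^ 4 := by ring
      _ ≤ _ := by gcongr; exact h3.1

/-- On the imaginary axis `lam` takes values in `(0, 1)`. -/
theorem lam_imag_axis {y : ℝ} (hy : 0 < y) :
    ∃ r : ℝ, 0 < r ∧ r < 1 ∧ lam (y * I) = r := by
  have hτ : 0 < ((y : ℂ) * I).im := by simpa using hy
  have hc : -(starRingEnd ℂ) ((y : ℂ) * I) = y * I := by simp
  have real_of : ∀ z : ℂ, jacobiTheta₂ (starRingEnd ℂ z) (y * I) = jacobiTheta₂ z (y * I) →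
      ∃ t : ℝ, jacobiTheta₂ z (y * I) = t := by
    intro z hz
    have h := jacobiTheta₂_conj z (y * I)
    rw [hc, hz] at h
    exact ⟨_, (Complex.conj_eq_iff_re.1 h).symm⟩
  obtain ⟨t2, h2⟩ := real_of ((y : ℂ) * I / 2) (by
    rw [← jacobiTheta₂_neg_left]; congr 1; simp [Complex.conj_ofNat, neg_div])
  obtain ⟨t3, h3⟩ := real_of 0 (by simp)
  obtain ⟨t4, h4⟩ := real_of (1 / 2) (by congr 1; simp [Complex.conj_ofNat])
  have e2 : thX2 (y * I) = ((Real.exp (-Real.pi * y) * t2 ^ 4 : ℝ) : ℂ) := by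
    rw [thX2, h2]; push_cast; congr 2
    linear_combination Real.pi * y * I_sq
  have e3 : thX3 (y * I) = ((t3 ^ 4 : ℝ) : ℂ) := by rw [thX3, h3]; push_cast; rfl
  have e4 : thX4 (y * I) = ((t4 ^ 4 : ℝ) : ℂ) := by rw [thX4, h4]; push_cast; rfl
  have pos : ∀ t : ℝ, t ^ 4 ≠ 0 → 0 < t ^ 4 := fun t ht =>
    lt_of_le_of_ne (by positivity) (Ne.symm ht)
  have p3 : 0 < t3 ^ 4 := pos _ fun h => thX3_ne_zero hτ (by rw [e3, h]; simp)
  have p4 : 0 < t4 ^ 4 := pos _ fun h => thX4_ne_zero hτ (by rw [e4, h]; simp)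
  have p2 : 0 < t2 ^ 4 := pos _ fun h => thX2_ne_zero hτ (by rw [e2, h]; simp)
  have p2' : 0 < Real.exp (-Real.pi * y) * t2 ^ 4 := mul_pos (Real.exp_pos _) p2
  have hj := jacobi_identity hτ
  rw [e2, e3, e4] at hj
  have hj' : t3 ^ 4 = Real.exp (-Real.pi * y) * t2 ^ 4 + t4 ^ 4 := by exact_mod_cast hj
  refine ⟨Real.exp (-Real.pi * y) * t2 ^ 4 / t3 ^ 4, by positivity, ?_, ?_⟩
  · rw [div_lt_one p3]; linarith
  · rw [lam, e2, e3]; push_cast; rfl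

end

section

open Complex
open scoped Topology

/-- The open upper half-plane as a subset of `ℂ`. -/
def uhp : Set ℂ := {z | 0 < z.im}

theorem mem_uhp {z : ℂ} : z ∈ uhp ↔ 0 < z.im := Iff.rfl

theorem isOpen_uhp : IsOpen uhp := isOpen_lt continuous_const Complex.continuous_im

theorem convex_uhp : Convex ℝ uhp := convex_halfSpace_im_gt 0

theorem isPreconnected_uhp : IsPreconnected uhp := convex_uhp.isPreconnected

theorem analyticOnNhd_of_differentiableAt {f : ℂ → ℂ}
    (hf : ∀ τ : ℂ, 0 < τ.im → DifferentiableAt ℂ f τ) : AnalyticOnNhd ℂ f uhp :=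
  DifferentiableOn.analyticOnNhd (fun z hz => (hf z hz).differentiableWithinAt) isOpen_uhp

/-- The closed fundamental domain `|Re z| ≤ 1 ≤ |z|`. -/
def fdD : Set ℂ := {z | 0 < z.im ∧ |z.re| ≤ 1 ∧ 1 ≤ ‖z‖}

theorem lam_re_of_norm_eq_one {z : ℂ} (hz : 0 < z.im) (h1 : ‖z‖ = 1) : (lam z).re = 1 / 2 := by
  have h2 : -(starRingEnd ℂ z) = -1 / z := by
    have h3 : z * starRingEnd ℂ z = 1 := by rw [Complex.mul_conj']; simp [h1]
    rw [eq_div_iff (ne_zero_of_im_pos hz)]; linear_combination -h3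
  have h3 := lam_neg_conj z
  rw [h2, lam_S hz] at h3
  have := congrArg Complex.re h3
  simp at this; linarith

theorem lam_one_add {t : ℝ} (ht : 0 < t) : ∃ s : ℝ, 0 < s ∧ lam (1 + t * I) = -s := by
  obtain ⟨r, h0, h1, hr⟩ := lam_imag_axis ht
  refine ⟨r / (1 - r), by apply div_pos <;> linarith, ?_⟩
  rw [add_comm, lam_add_one (by simpa using ht), hr]; push_cast; rfl

theorem lam_neg_one_add (t : ℝ) : lam (-1 + t * I) = lam (1 + t * I) := by
  rw [← lam_add_two]; ring_nf

theorem norm_sub_one_sq_le {z : ℂ} (hz : z ∈ fdD) (h0 : 0 ≤ z.re) :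
    ‖z - 1‖ ^ 2 ≤ z.im ^ 2 + z.im ^ 4 := by
  obtain ⟨h1, h2, h3⟩ := hz
  have e1 : ‖z - 1‖ ^ 2 = (z.re - 1) ^ 2 + z.im ^ 2 := by
    rw [← Complex.normSq_eq_norm_sq, Complex.normSq_apply]; simp; ring
  have e2 : 1 ≤ z.re ^ 2 + z.im ^ 2 := by
    have : ‖z‖ ^ 2 = z.re ^ 2 + z.im ^ 2 := by
      rw [← Complex.normSq_eq_norm_sq, Complex.normSq_apply]; ring
    nlinarith [norm_nonneg z]
  have h4 : z.re ≤ 1 := (abs_le.1 h2).2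
  have h5 : 1 - z.re ≤ z.im ^ 2 := by nlinarith
  rw [e1]
  nlinarith

/-- The coordinate at the cusp `1`. -/
theorem exists_cusp_coord {z : ℂ} (hz : 0 < z.im) :
    1 - 1 / (-1 / (z - 1)) = z ∧ (-1 / (z - 1)).im = z.im / ‖z - 1‖ ^ 2 := by
  have h1 : z - 1 ≠ 0 := ne_zero_of_im_pos (by simpa using hz)
  refine ⟨by field_simp; ring, ?_⟩
  rw [im_neg_one_div_eq, Complex.normSq_eq_norm_sq]; simp

/-- The function `λ / (1 - λ)`. -/
def kap (z : ℂ) : ℂ := lam z / (1 - lam z)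

theorem differentiableAt_kap {τ : ℂ} (hτ : 0 < τ.im) : DifferentiableAt ℂ kap τ :=
  (differentiableAt_lam hτ).div ((differentiableAt_const _).sub (differentiableAt_lam hτ))
    (one_sub_lam_ne_zero hτ)

theorem norm_kap_neg_conj (z : ℂ) : ‖kap (-(starRingEnd ℂ z))‖ = ‖kap z‖ := by
  rw [kap, kap, lam_neg_conj, ← Complex.norm_conj (lam z / (1 - lam z))]
  simp

theorem kap_one_sub_inv {w : ℂ} (hw : 0 < w.im) : kap (1 - 1 / w) = lam w - 1 := by
  rw [kap, lam_one_sub_inv hw]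
  have := lam_ne_zero hw
  field_simp; simp

theorem norm_kap_lt_one_iff {z : ℂ} (hz : 0 < z.im) : ‖kap z‖ < 1 ↔ (lam z).re < 1 / 2 := by
  rw [kap, norm_div, div_lt_one (norm_pos_iff.2 (one_sub_lam_ne_zero hz)), ← sq_lt_sq₀
    (norm_nonneg _) (norm_nonneg _), ← Complex.normSq_eq_norm_sq, ← Complex.normSq_eq_norm_sq,
    Complex.normSq_apply, Complex.normSq_apply]
  simp only [sub_re, one_re, sub_im, one_im]
  constructor <;> intro h <;> nlinarith

theorem norm_kap_le_one_iff {z : ℂ} (hz : 0 < z.im) : ‖kap z‖ ≤ 1 ↔ (lam z).re ≤ 1 / 2 := by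
  rw [kap, norm_div, div_le_one (norm_pos_iff.2 (one_sub_lam_ne_zero hz)), ← sq_le_sq₀
    (norm_nonneg _) (norm_nonneg _), ← Complex.normSq_eq_norm_sq, ← Complex.normSq_eq_norm_sq,
    Complex.normSq_apply, Complex.normSq_apply]
  simp only [sub_re, one_re, sub_im, one_im]
  constructor <;> intro h <;> nlinarith

theorem norm_kap_lt_one_of_abs_re_eq {z : ℂ} (hz : 0 < z.im) (h : |z.re| = 1) : ‖kap z‖ < 1 := by
  rw [norm_kap_lt_one_iff hz]
  obtain ⟨s, hs, h1⟩ := lam_one_add hz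
  have : lam z = -s := by
    rcases eq_or_eq_neg_of_abs_eq h with h | h
    · rw [← h1]; congr 1; apply Complex.ext <;> simp [h]
    · rw [← h1, ← lam_neg_one_add]; congr 1; apply Complex.ext <;> simp [h]
  rw [this]; simp; linarith

/-- `|κ|` is close to at most one in `D` close to the cusps. -/
theorem norm_kap_le_of_im_le {c C : ℝ} (hC : 0 < C)
    (hb : ∀ τ : ℂ, 3 / 8 ≤ τ.im →
      c * Real.exp (-Real.pi * τ.im) ≤ ‖lam τ‖ ∧ ‖lam τ‖ ≤ C * Real.exp (-Real.pi * τ.im))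
    {z : ℂ} (hz : z ∈ fdD) (hy : z.im ≤ 1) : ‖kap z‖ ≤ 1 + C * Real.exp (-1 / z.im) := by
  wlog h0 : 0 ≤ z.re generalizing z
  · have := this (z := -(starRingEnd ℂ z)) (by simpa [fdD] using hz) (by simpa using hy)
      (by simp; linarith)
    rw [norm_kap_neg_conj] at this
    simpa using this
  have h1 := norm_sub_one_sq_le hz h0
  have h2 := hz.1
  obtain ⟨e1, e2⟩ := exists_cusp_coord hz.1
  set w := -1 / (z - 1) with hw
  have hpos : 0 < ‖z - 1‖ := norm_pos_iff.2 (ne_zero_of_im_pos (by simpa using h2))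
  have h3 : 1 / (2 * z.im) ≤ w.im := by
    rw [e2, div_le_div_iff₀ (by positivity) (by positivity)]
    nlinarith [pow_pos h2 2, pow_pos h2 3, pow_pos h2 4, mul_nonneg (pow_pos h2 2).le (sub_nonneg.2 hy)]
  have h4 : 1 / 2 ≤ w.im := le_trans (by rw [div_le_div_iff₀ (by norm_num) (by positivity)]; linarith) h3
  rw [← e1, kap_one_sub_inv (by linarith)]
  calc ‖lam w - 1‖ ≤ ‖lam w‖ + ‖(1 : ℂ)‖ := norm_sub_le _ _
    _ ≤ C * Real.exp (-Real.pi * w.im) + 1 := by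
      rw [norm_one]; gcongr; exact (hb w (by linarith)).2
    _ ≤ C * Real.exp (-1 / z.im) + 1 := by
      gcongr
      have hpi := Real.pi_gt_three
      have : 1 / z.im ≤ Real.pi * w.im := by
        calc 1 / z.im = 2 * (1 / (2 * z.im)) := by field_simp
          _ ≤ Real.pi * w.im := by gcongr; linarith
      rw [neg_div]; linarith
    _ = _ := by rw [e1]; ring

theorem norm_kap_le_one {z : ℂ} (hz : z ∈ fdD) : ‖kap z‖ ≤ 1 := by
  obtain ⟨c, C, hc, hC, hb⟩ := exists_norm_lam_bounds
  refine le_of_forall_pos_le_add fun δ hδ => ?_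
  have hlim : Tendsto (fun ε : ℝ => C * Real.exp (-1 / ε)) (𝓝[>] 0) (𝓝 0) := by
    have h1 : Tendsto (fun ε : ℝ => -1 / ε) (𝓝[>] 0) atBot := by
      simp only [neg_div, one_div]
      exact tendsto_neg_atTop_atBot.comp tendsto_inv_nhdsGT_zero
    simpa using (Real.tendsto_exp_atBot.comp h1).const_mul C
  have near : ∀ r : ℝ, 0 < r → ∀ᶠ ε in 𝓝[>] (0 : ℝ), ε < r := fun r hr =>
    nhdsWithin_le_nhds (Iio_mem_nhds hr)
  have near0 : ∀ᶠ ε in 𝓝[>] (0 : ℝ), 0 < ε := self_mem_nhdsWithin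
  obtain ⟨ε, hε, hε0, hε1, hεz⟩ := ((hlim.eventually_lt_const hδ).and
    (near0.and ((near 1 one_pos).and (near z.im hz.1)))).exists
  have hlim2 : Tendsto (fun Y : ℝ => C * Real.exp (-Real.pi * Y)) atTop (𝓝 0) := by
    have h1 : Tendsto (fun Y : ℝ => -Real.pi * Y) atTop atBot :=
      tendsto_id.const_mul_atTop_of_neg (neg_neg_of_pos Real.pi_pos)
    simpa using (Real.tendsto_exp_atBot.comp h1).const_mul C
  obtain ⟨Y, hY1, hY2, hY3⟩ := ((hlim2.eventually_lt_const (show (0 : ℝ) < 1 / 2 by norm_num)).and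
    ((eventually_gt_atTop (1 : ℝ)).and (eventually_gt_atTop z.im))).exists
  let K : Set ℂ := {z | |z.re| ≤ 1 ∧ 1 ≤ ‖z‖ ∧ ε ≤ z.im ∧ z.im ≤ Y}
  let U : Set ℂ := {z | |z.re| < 1 ∧ 1 < ‖z‖ ∧ ε < z.im ∧ z.im < Y}
  have hKD : K ⊆ fdD := fun z hz => ⟨by linarith [hz.2.2.1], hz.1, hz.2.1⟩
  have hre : Continuous fun z : ℂ => |z.re| := by fun_prop
  have hn : Continuous fun z : ℂ => ‖z‖ := continuous_norm
  have hKc : IsClosed K := (isClosed_le hre continuous_const).inter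
    ((isClosed_le continuous_const hn).inter ((isClosed_le continuous_const
      continuous_im).inter (isClosed_le continuous_im continuous_const)))
  have hUo : IsOpen U := (isOpen_lt hre continuous_const).inter
    ((isOpen_lt continuous_const hn).inter ((isOpen_lt continuous_const
      continuous_im).inter (isOpen_lt continuous_im continuous_const)))
  have hUK : closure U ⊆ K := closure_minimal
    (fun z hz => ⟨hz.1.le, hz.2.1.le, hz.2.2.1.le, hz.2.2.2.le⟩) hKc
  have hbd : ∀ z ∈ K \ U, ‖kap z‖ ≤ 1 + δ := by
    rintro z ⟨hzK, hzU⟩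
    have hzD := hKD hzK
    have him := hzD.1
    by_cases c1 : |z.re| = 1
    · linarith [norm_kap_lt_one_of_abs_re_eq him c1]
    by_cases c2 : ‖z‖ = 1
    · have := (norm_kap_le_one_iff him).2 (lam_re_of_norm_eq_one him c2).le
      linarith
    by_cases c3 : z.im = ε
    · have := norm_kap_le_of_im_le hC hb hzD (by linarith)
      rw [c3] at this; linarith
    have c4 : z.im = Y := by
      by_contra c4
      exact hzU ⟨lt_of_le_of_ne hzK.1 c1, lt_of_le_of_ne hzK.2.1 (Ne.symm c2),
        lt_of_le_of_ne hzK.2.2.1 (Ne.symm c3), lt_of_le_of_ne hzK.2.2.2 c4⟩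
    have h5 := (hb z (by linarith)).2
    rw [c4] at h5
    have := (norm_kap_le_one_iff him).2 (by
      have := (abs_le.1 (Complex.abs_re_le_norm (lam z))).2; linarith)
    linarith
  have hzK : z ∈ K := ⟨hz.2.1, hz.2.2, hεz.le, hY3.le⟩
  by_cases hzU : z ∈ U
  · refine Complex.norm_le_of_forall_mem_frontier_norm_le (U := U) ?_ ?_ ?_ (subset_closure hzU)
    · refine (Metric.isBounded_closedBall (x := (0 : ℂ)) (r := 1 + Y)).subset fun z hz => ?_
      rw [mem_closedBall_zero_iff]
      refine (Complex.norm_le_abs_re_add_abs_im z).trans ?_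
      have := hz.2.2.1
      rw [abs_of_pos (a := z.im) (by linarith)]
      linarith [hz.1, hz.2.2.2]
    · exact DifferentiableOn.diffContOnCl fun z hz =>
        (differentiableAt_kap (hKD (hUK hz)).1).differentiableWithinAt
    · intro z hz
      exact hbd z ⟨hUK hz.1, fun h => hz.2 (by rwa [hUo.interior_eq])⟩
  · exact hbd z ⟨hzK, hzU⟩

theorem lam_re_le_half {z : ℂ} (hz : z ∈ fdD) : (lam z).re ≤ 1 / 2 :=
  (norm_kap_le_one_iff hz.1).1 (norm_kap_le_one hz)

/-- The cusp function of a holomorphic function of period two on the upper half-plane which is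
bounded near the cusp. -/
theorem differentiableOn_cuspFunction_two {f : ℂ → ℂ} (hper : ∀ z, f (z + 2) = f z)
    (hd : ∀ z : ℂ, 0 < z.im → DifferentiableAt ℂ f z) {Y M : ℝ}
    (hb : ∀ z : ℂ, Y ≤ z.im → ‖f z‖ ≤ M) :
    DifferentiableOn ℂ (Function.Periodic.cuspFunction 2 f) (Metric.ball 0 1) := by
  have hP : Function.Periodic f ((2 : ℝ) : ℂ) := fun z => by simpa using hper z
  intro q hq
  refine DifferentiableAt.differentiableWithinAt ?_
  by_cases h0 : q = 0
  · subst h0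
    refine Function.Periodic.differentiableAt_cuspFunction_zero two_pos hP ?_ ?_
    · filter_upwards [preimage_mem_comap (Ioi_mem_atTop 0)] with z hz using hd z hz
    · refine Asymptotics.IsBigO.of_bound M ?_
      filter_upwards [preimage_mem_comap (Ici_mem_atTop Y)] with z hz
      simpa using hb z hz
  · rw [← Function.Periodic.qParam_right_inv two_ne_zero h0]
    refine Function.Periodic.differentiableAt_cuspFunction two_ne_zero hP (hd _ ?_)
    rw [Function.Periodic.im_invQParam]
    have h1 : Real.log ‖q‖ < 0 := Real.log_neg (norm_pos_iff.2 h0) (by simpa using hq)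
    have := Real.pi_pos
    exact mul_pos_of_neg_of_neg (div_neg_of_neg_of_pos (by norm_num) (by positivity)) h1

theorem norm_qParam_two (z : ℂ) :
    ‖Function.Periodic.qParam 2 z‖ = Real.exp (-Real.pi * z.im) := by
  rw [Function.Periodic.norm_qParam]; congr 1; ring

theorem qParam_two_inj {w w' : ℂ} (h : |w.re - w'.re| < 2)
    (h1 : Function.Periodic.qParam 2 w = Function.Periodic.qParam 2 w') : w = w' := by
  rw [Function.Periodic.qParam, Function.Periodic.qParam, Complex.exp_eq_exp_iff_exists_int] at h1
  obtain ⟨n, hn⟩ := h1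
  have hpi : (Real.pi : ℂ) ≠ 0 := by exact_mod_cast Real.pi_ne_zero
  have h2 : w = w' + 2 * n := by
    have : (Real.pi * I) * w = (Real.pi * I) * (w' + 2 * n) := by
      push_cast at hn; linear_combination hn
    exact mul_left_cancel₀ (mul_ne_zero hpi I_ne_zero) this
  have h3 : |(2 * n : ℝ)| < 2 := by rw [h2] at h; simpa using h
  have h4 : n = 0 := by
    rw [abs_mul, abs_two] at h3
    have : |(n : ℝ)| < 1 := by linarith
    have : |n| < 1 := by exact_mod_cast this
    exact Int.abs_lt_one_iff.1 this
  rw [h2, h4]; simp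

theorem exists_lam_inj : ∃ Y : ℝ, 1 ≤ Y ∧
    (∀ w w' : ℂ, Y ≤ w.im → Y ≤ w'.im → |w.re - w'.re| < 2 → lam w = lam w' → w = w') ∧
    ∀ w : ℂ, Y ≤ w.im → deriv lam w ≠ 0 := by
  obtain ⟨c, C, hc, hC, hb⟩ := exists_norm_lam_bounds
  set g := Function.Periodic.cuspFunction 2 lam with hg
  have hP : Function.Periodic lam ((2 : ℝ) : ℂ) := fun z => by simpa using lam_add_two z
  have heq : ∀ z, g (Function.Periodic.qParam 2 z) = lam z :=
    Function.Periodic.eq_cuspFunction two_ne_zero hP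
  have hgd : DifferentiableOn ℂ g (Metric.ball 0 1) := by
    refine differentiableOn_cuspFunction_two (Y := 1) (M := C) lam_add_two
      (fun z hz => differentiableAt_lam hz) fun z hz => ((hb z (by linarith)).2).trans ?_
    have : Real.exp (-Real.pi * z.im) ≤ 1 := Real.exp_le_one_iff.2 (by
      nlinarith [Real.pi_pos])
    nlinarith
  have hga : AnalyticAt ℂ g 0 := hgd.analyticAt (Metric.ball_mem_nhds 0 one_pos)
  have hlow : ∀ᶠ q in 𝓝[≠] (0 : ℂ), c * ‖q‖ ≤ ‖g q‖ ∧ ‖g q‖ ≤ C * ‖q‖ := by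
    filter_upwards [self_mem_nhdsWithin, (Function.Periodic.invQParam_tendsto two_pos).eventually
      (preimage_mem_comap (Ici_mem_atTop 1))] with q hq hq2
    have h1 : 1 ≤ (Function.Periodic.invQParam 2 q).im := hq2
    have h2 := hb _ (show 3 / 8 ≤ (Function.Periodic.invQParam 2 q).im by linarith)
    rw [← norm_qParam_two, ← heq, Function.Periodic.qParam_right_inv two_ne_zero hq] at h2
    exact h2
  have hg0 : g 0 = 0 := by
    have h1 : Tendsto (fun q => ‖g q‖) (𝓝[≠] (0 : ℂ)) (𝓝 ‖g 0‖) :=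
      (hga.continuousAt.norm.tendsto).mono_left nhdsWithin_le_nhds
    have h2 : Tendsto (fun q : ℂ => C * ‖q‖) (𝓝[≠] (0 : ℂ)) (𝓝 (C * ‖(0 : ℂ)‖)) :=
      ((continuous_const.mul continuous_norm).tendsto 0).mono_left nhdsWithin_le_nhds
    have := le_of_tendsto_of_tendsto h1 h2 (hlow.mono fun q h => h.2)
    simpa using this
  have hd0 : deriv g 0 ≠ 0 := by
    intro h0
    have h1 := hga.differentiableAt.hasDerivAt
    rw [h0, hasDerivAt_iff_isLittleO] at h1
    have h2 := (h1.bound (show 0 < c / 2 by positivity))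
    obtain ⟨q, ⟨h3, h4⟩, h5⟩ := ((hlow.and (h2.filter_mono nhdsWithin_le_nhds)).and
      self_mem_nhdsWithin).exists
    simp [hg0] at h4
    have : 0 < ‖q‖ := norm_pos_iff.2 h5
    nlinarith [h3.1]
  have hstrict : HasStrictDerivAt g (deriv g 0) 0 := hga.hasStrictDerivAt
  obtain ⟨U, hU, hUinj⟩ : ∃ U ∈ 𝓝 (0 : ℂ), Set.InjOn g U :=
    ⟨_, ((hstrict.hasStrictFDerivAt_equiv hd0).toOpenPartialHomeomorph g).open_source.mem_nhds
      (hstrict.hasStrictFDerivAt_equiv hd0).mem_toOpenPartialHomeomorph_source,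
      ((hstrict.hasStrictFDerivAt_equiv hd0).toOpenPartialHomeomorph g).injOn⟩
  have hdne : ∀ᶠ q in 𝓝 (0 : ℂ), deriv g q ≠ 0 := hga.deriv.continuousAt.eventually_ne hd0
  obtain ⟨ε, hε, hεU⟩ := Metric.mem_nhds_iff.1 (Filter.inter_mem hU hdne)
  have hlim2 : Tendsto (fun Y : ℝ => Real.exp (-Real.pi * Y)) atTop (𝓝 0) :=
    Real.tendsto_exp_atBot.comp (tendsto_id.const_mul_atTop_of_neg (neg_neg_of_pos Real.pi_pos))
  obtain ⟨Y, hY, hY1⟩ := ((hlim2.eventually_lt_const (show 0 < min ε 1 by positivity)).and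
    (eventually_ge_atTop 1)).exists
  have hq : ∀ w : ℂ, Y ≤ w.im → ‖Function.Periodic.qParam 2 w‖ < min ε 1 := fun w hw => by
    rw [norm_qParam_two]
    exact lt_of_le_of_lt (Real.exp_le_exp.2 (by nlinarith [Real.pi_pos])) hY
  have hqU : ∀ w : ℂ, Y ≤ w.im → Function.Periodic.qParam 2 w ∈ U ∩ {q | deriv g q ≠ 0} :=
    fun w hw => hεU (by simpa using (hq w hw).trans_le (min_le_left _ _))
  refine ⟨Y, hY1, fun w w' hw hw' hre h => qParam_two_inj hre
    (hUinj (hqU w hw).1 (hqU w' hw').1 (by rw [heq, heq, h])), fun w hw => ?_⟩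
  have e1 : lam = g ∘ Function.Periodic.qParam 2 := funext fun z => (heq z).symm
  have hqd : HasDerivAt (Function.Periodic.qParam 2)
      (Function.Periodic.qParam 2 w * (2 * Real.pi * I / (2 : ℝ))) w := by
    simpa only [id_eq, mul_one] using! (((hasDerivAt_id w).const_mul _).div_const _).cexp
  have hgw : DifferentiableAt ℂ g (Function.Periodic.qParam 2 w) :=
    hgd.differentiableAt (Metric.isOpen_ball.mem_nhds
      (by simpa using (hq w hw).trans_le (min_le_right _ _)))
  have h1 := hgw.hasDerivAt.comp w hqd
  rw [← e1] at h1
  rw [h1.deriv]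
  refine mul_ne_zero (hqU w hw).2 (mul_ne_zero (Complex.exp_ne_zero _) ?_)
  have hpi : (Real.pi : ℂ) ≠ 0 := by exact_mod_cast Real.pi_ne_zero
  simp [hpi]

/-- The cusp coordinate on the part of `D` near the cusps `±1`. -/
theorem exists_cusp_coord_of_mem_fdD {z : ℂ} (hz : z ∈ fdD) (hy : z.im ≤ 1) :
    ∃ (s : ℂ) (w : ℂ), (s = 0 ∧ 0 ≤ z.re ∨ s = 2 ∧ z.re < 0) ∧ z + s = 1 - 1 / w ∧
      1 / (2 * z.im) ≤ w.im ∧ |w.re| ≤ 1 / 2 ∧ w.im = z.im / ‖z + s - 1‖ ^ 2 := by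
  have key : ∀ z' : ℂ, z'.im = z.im → 1 / (2 * z.im) ≤ z.im / ‖z' - 1‖ ^ 2 →
      2 * |z'.re - 1| ≤ ‖z' - 1‖ ^ 2 → ∃ w : ℂ, z' = 1 - 1 / w ∧
      1 / (2 * z.im) ≤ w.im ∧ |w.re| ≤ 1 / 2 ∧ w.im = z.im / ‖z' - 1‖ ^ 2 := by
    intro z' h1 h2 h3
    have h4 : 0 < z'.im := by rw [h1]; exact hz.1
    obtain ⟨e1, e2⟩ := exists_cusp_coord h4
    refine ⟨-1 / (z' - 1), e1.symm, by rwa [e2, h1], ?_, by rw [e2, h1]⟩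
    have h5 : 0 < ‖z' - 1‖ := norm_pos_iff.2 (ne_zero_of_im_pos (by simpa using h4))
    have h6 : (-1 / (z' - 1)).re = -(z'.re - 1) / ‖z' - 1‖ ^ 2 := by
      rw [div_re, Complex.normSq_eq_norm_sq]; simp
    rw [h6, abs_div, abs_neg, abs_of_pos (a := ‖z' - 1‖ ^ 2) (by positivity),
      div_le_iff₀ (by positivity)]
    linarith
  obtain ⟨h1, h2, h3⟩ := hz
  have hle : ∀ n : ℝ, 0 < n → n ≤ z.im ^ 2 + z.im ^ 4 → 1 / (2 * z.im) ≤ z.im / n := by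
    intro n hn h
    rw [div_le_div_iff₀ (by positivity) hn]
    have : z.im ^ 4 ≤ z.im ^ 2 := pow_le_pow_of_le_one h1.le hy (by norm_num)
    nlinarith
  have hsq : 1 ≤ z.re ^ 2 + z.im ^ 2 := by
    have : ‖z‖ ^ 2 = z.re ^ 2 + z.im ^ 2 := by
      rw [← Complex.normSq_eq_norm_sq, Complex.normSq_apply]; ring
    nlinarith [norm_nonneg z]
  rcases le_or_gt 0 z.re with h0 | h0
  · have h5 : 0 < ‖z - 1‖ := norm_pos_iff.2 (ne_zero_of_im_pos (by simpa using h1))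
    obtain ⟨w, hw⟩ := key z rfl (hle _ (by positivity) (norm_sub_one_sq_le ⟨h1, h2, h3⟩ h0)) (by
      rw [abs_of_nonpos (by linarith [(abs_le.1 h2).2]), ← Complex.normSq_eq_norm_sq,
        Complex.normSq_apply]
      simp; nlinarith)
    exact ⟨0, w, Or.inl ⟨rfl, h0⟩, by simpa using hw⟩
  · have h4 := norm_sub_one_sq_le (z := -(starRingEnd ℂ z)) (by simpa [fdD] using ⟨h1, h2, h3⟩)
      (by simp; linarith)
    have h6 : ‖-(starRingEnd ℂ z) - 1‖ = ‖z + 2 - 1‖ := by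
      rw [← Complex.norm_conj, ← norm_neg]; simp; ring_nf
    rw [h6] at h4
    have h5 : 0 < ‖z + 2 - 1‖ := norm_pos_iff.2 (ne_zero_of_im_pos (by simpa using h1))
    obtain ⟨w, hw⟩ := key (z + 2) (by simp) (hle (‖z + 2 - 1‖ ^ 2) (by positivity) (by simpa using h4)) (by
      rw [abs_of_nonneg (by simp; linarith [(abs_le.1 h2).1]), ← Complex.normSq_eq_norm_sq,
        Complex.normSq_apply]
      simp; nlinarith)
    exact ⟨2, w, Or.inr ⟨rfl, h0⟩, hw⟩

theorem lam_add_of_eq {z s : ℂ} (hs : s = 0 ∨ s = 2) : lam (z + s) = lam z := by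
  rcases hs with rfl | rfl
  · simp
  · exact lam_add_two z

theorem exists_arc_injective : ∃ ε : ℝ, 0 < ε ∧ ∀ τ : ℂ, ‖τ‖ = 1 → 0 < τ.im → τ.im < ε →
    0 < τ.re → (∀ z ∈ fdD, lam z = lam τ → z = τ) ∧ deriv lam τ ≠ 0 := by
  obtain ⟨c, C, hc, hC, hb⟩ := exists_norm_lam_bounds
  obtain ⟨Y, hY1, hYinj, hYd⟩ := exists_lam_inj
  have hlim : Tendsto (fun ε : ℝ => Real.exp (Real.pi * (1 / (2 * ε))) / C - 1) (𝓝[>] 0) atTop := by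
    have h1 : Tendsto (fun ε : ℝ => Real.pi * (1 / (2 * ε))) (𝓝[>] 0) atTop := by
      have : (fun ε : ℝ => Real.pi * (1 / (2 * ε))) = fun ε : ℝ => Real.pi / 2 * ε⁻¹ := by
        ext ε; field_simp
      rw [this]
      exact tendsto_inv_nhdsGT_zero.const_mul_atTop (by positivity)
    exact tendsto_atTop_add_const_right _ _ ((Real.tendsto_exp_atTop.comp h1).atTop_div_const hC)
  have near : ∀ r : ℝ, 0 < r → ∀ᶠ ε in 𝓝[>] (0 : ℝ), ε < r := fun r hr =>
    nhdsWithin_le_nhds (Iio_mem_nhds hr)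
  have near0 : ∀ᶠ ε in 𝓝[>] (0 : ℝ), 0 < ε := self_mem_nhdsWithin
  obtain ⟨ε, hε, hε0, hε1, hε2⟩ := ((hlim.eventually_gt_atTop
    (max C (1 + Real.exp (Real.pi * Y) / c))).and (near0.and
    ((near 1 one_pos).and (near (1 / (2 * Y)) (by positivity))))).exists
  refine ⟨ε, hε0, fun τ h1 him him2 hre => ?_⟩
  have hre1 : τ.re ≤ 1 := (le_abs_self _).trans (h1 ▸ Complex.abs_re_le_norm τ)
  have hτD : τ ∈ fdD := ⟨him, by rw [abs_of_pos hre]; exact hre1, h1.ge⟩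
  obtain ⟨s, w, hs, hw, hwi, hwr, -⟩ := exists_cusp_coord_of_mem_fdD hτD (by linarith)
  obtain ⟨rfl, -⟩ : s = 0 ∧ 0 ≤ τ.re := hs.resolve_right fun h => by linarith [h.2]
  rw [add_zero] at hw
  have hwε : 1 / (2 * ε) ≤ w.im := (by gcongr : 1 / (2 * ε) ≤ 1 / (2 * τ.im)).trans hwi
  have hwY : Y ≤ w.im := by
    refine le_trans ?_ hwε
    rw [lt_div_iff₀ (by positivity)] at hε2
    rw [le_div_iff₀ (by positivity)]; linarith
  have hw0 : 0 < w.im := by linarith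
  have hlarge : max C (1 + Real.exp (Real.pi * Y) / c) < ‖lam τ‖ := by
    refine hε.trans_le ?_
    rw [hw, lam_one_sub_inv hw0]
    have h2 : ‖1 / lam w‖ - ‖(1 : ℂ)‖ ≤ ‖1 - 1 / lam w‖ := by
      rw [norm_sub_rev]; exact norm_sub_norm_le _ _
    refine le_trans ?_ h2
    rw [norm_one, norm_div, norm_one]
    refine sub_le_sub_right ?_ 1
    rw [div_le_div_iff₀ hC (norm_pos_iff.2 (lam_ne_zero hw0)), one_mul]
    calc Real.exp (Real.pi * (1 / (2 * ε))) * ‖lam w‖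
        ≤ Real.exp (Real.pi * w.im) * (C * Real.exp (-Real.pi * w.im)) := by
          gcongr
          exact (hb w (by linarith)).2
      _ = C := by rw [mul_left_comm, ← Real.exp_add]; simp
  constructor
  · intro z hz hzτ
    rw [← hzτ] at hlarge
    have hzy : z.im < 1 := by
      by_contra hcon
      push Not at hcon
      have h2 := (hb z (by linarith)).2
      have : Real.exp (-Real.pi * z.im) ≤ 1 := Real.exp_le_one_iff.2 (by
        nlinarith [Real.pi_pos])
      have h3 := (le_max_left _ _).trans_lt hlarge
      nlinarith
    obtain ⟨s, w', hs', hw', hwi', hwr', -⟩ := exists_cusp_coord_of_mem_fdD hz hzy.le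
    have hz0 := hz.1
    have hwh : 1 / 2 ≤ w'.im := by
      refine le_trans ?_ hwi'
      rw [div_le_div_iff₀ (by norm_num) (by positivity)]; linarith
    have hls : lam (1 - 1 / w') = lam z := by
      rw [← hw', lam_add_of_eq (hs'.imp And.left And.left)]
    have hwY' : Y ≤ w'.im := by
      by_contra hcon
      push Not at hcon
      have h3 := (le_max_right _ _).trans_lt hlarge
      rw [← hls, lam_one_sub_inv (by linarith)] at h3
      have h4 : ‖1 - 1 / lam w'‖ ≤ 1 + Real.exp (Real.pi * Y) / c := by
        refine (norm_sub_le _ _).trans ?_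
        rw [norm_one, norm_div, norm_one]
        refine (add_le_add_iff_left 1).2 ?_
        rw [div_le_div_iff₀ (norm_pos_iff.2 (lam_ne_zero (by linarith))) hc, one_mul]
        calc c = Real.exp (Real.pi * w'.im) * (c * Real.exp (-Real.pi * w'.im)) := by
              rw [mul_left_comm, ← Real.exp_add]; simp
          _ ≤ Real.exp (Real.pi * Y) * ‖lam w'‖ := by
              gcongr
              exact (hb w' (by linarith)).1
      linarith
    have hww : w' = w := by
      refine hYinj _ _ hwY' hwY ?_ ?_
      · have := abs_sub w'.re w.re; linarith
      · rw [hw] at hzτ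
        rw [← hls, lam_one_sub_inv (by linarith), lam_one_sub_inv hw0] at hzτ
        have : 1 / lam w' = 1 / lam w := by linear_combination -hzτ
        rw [one_div, one_div] at this
        exact inv_injective this
    rw [hww, ← hw] at hw'
    rcases hs' with ⟨rfl, h⟩ | ⟨rfl, h⟩
    · simpa using hw'
    · exfalso
      have h5 : z.re + 2 = τ.re := by rw [← hw']; simp
      have h6 := (abs_le.1 hz.2.1).1
      have h7 : τ.re ^ 2 + τ.im ^ 2 = 1 := by
        have : ‖τ‖ ^ 2 = τ.re ^ 2 + τ.im ^ 2 := by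
          rw [← Complex.normSq_eq_norm_sq, Complex.normSq_apply]; ring
        rw [← this, h1]; norm_num
      nlinarith
  · have hτw : w = -1 / (τ - 1) := by
      rw [hw]
      have := ne_zero_of_im_pos hw0
      field_simp; ring
    intro h0
    have e1 : HasDerivAt (fun w => 1 - 1 / w) (1 / w ^ 2) w := by
      have := (hasDerivAt_inv (ne_zero_of_im_pos hw0)).const_sub 1
      simpa using! this
    have e2 : HasDerivAt (fun w => lam (1 - 1 / w)) (deriv lam τ * (1 / w ^ 2)) w := by
      have := (differentiableAt_lam him).hasDerivAt
      rw [hw] at this ⊢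
      exact this.comp w e1
    have e3 : HasDerivAt (fun w => 1 - 1 / lam w) (deriv lam w / lam w ^ 2) w := by
      have := ((differentiableAt_lam hw0).hasDerivAt.inv (lam_ne_zero hw0)).const_sub 1
      simpa [neg_div] using! this
    have e4 : (fun w => lam (1 - 1 / w)) =ᶠ[𝓝 w] fun w => 1 - 1 / lam w := by
      filter_upwards [isOpen_uhp.mem_nhds hw0] with v hv using lam_one_sub_inv hv
    have e5 := (e2.congr_of_eventuallyEq e4.symm).unique e3
    rw [h0, zero_mul, eq_comm, div_eq_zero_iff] at e5
    rcases e5 with h | h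
    · exact hYd w hwY h
    · exact lam_ne_zero hw0 (by simpa using h)

end

section

open Complex MeasureTheory
open scoped Topology

/-- A quantity comparable to the largest height of a point of `D` in the cusps. -/
def cuspV (z : ℂ) : ℝ := 1 + z.im / ‖z - 1‖ ^ 2 + z.im / ‖z + 1‖ ^ 2

theorem one_le_cuspV {z : ℂ} (hz : 0 < z.im) : 1 ≤ cuspV z := by
  have : 0 ≤ z.im / ‖z - 1‖ ^ 2 := by positivity
  have : 0 ≤ z.im / ‖z + 1‖ ^ 2 := by positivity
  rw [cuspV]; linarith

theorem differentiableAt_uhp_deriv {f : ℂ → ℂ} (hd : ∀ z : ℂ, 0 < z.im → DifferentiableAt ℂ f z)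
    {z : ℂ} (hz : 0 < z.im) : DifferentiableAt ℂ (deriv f) z :=
  (analyticOnNhd_of_differentiableAt hd z hz).deriv.differentiableAt

theorem norm_deriv_le_of_uhp {f : ℂ → ℂ} (hd : ∀ z : ℂ, 0 < z.im → DifferentiableAt ℂ f z)
    {z : ℂ} {r M : ℝ} (hr : 0 < r) (hrz : r < z.im)
    (hM : ∀ w : ℂ, ‖w - z‖ = r → ‖f w‖ ≤ M) : ‖deriv f z‖ ≤ M / r := by
  refine Complex.norm_deriv_le_of_forall_mem_sphere_norm_le hr ?_ fun w hw => hM w ?_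
  · refine DifferentiableOn.diffContOnCl fun w hw => (hd w ?_).differentiableWithinAt
    rw [closure_ball _ hr.ne', Metric.mem_closedBall, dist_eq_norm] at hw
    have := (abs_le.1 ((Complex.abs_im_le_norm (w - z)).trans hw)).1
    rw [sub_im] at this; linarith
  · simpa [dist_eq_norm] using hw

theorem exists_norm_deriv_lam_le : ∃ K : ℝ, 0 < K ∧ ∀ w : ℂ, 1 / 2 ≤ w.im →
    ‖deriv lam w‖ ≤ K * ‖lam w‖ := by
  obtain ⟨c, C, hc, hC, hb⟩ := exists_norm_lam_bounds
  refine ⟨C * Real.exp (Real.pi / 8) / c * 8, by positivity, fun w hw => ?_⟩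
  have h1 := norm_deriv_le_of_uhp (f := lam) (fun z hz => differentiableAt_lam hz) (z := w)
    (r := 1 / 8) (M := C * Real.exp (Real.pi / 8) * Real.exp (-Real.pi * w.im)) (by norm_num)
    (by linarith) (by
      intro u hu
      have := (abs_le.1 ((Complex.abs_im_le_norm (u - w)).trans hu.le)).1
      rw [sub_im] at this
      refine (hb u (by linarith)).2.trans ?_
      rw [mul_assoc, ← Real.exp_add]
      gcongr
      nlinarith [Real.pi_pos])
  refine h1.trans ?_
  have h2 := (hb w (by linarith)).1
  rw [div_eq_mul_inv, show ((1 / 8 : ℝ))⁻¹ = 8 by norm_num, mul_right_comm _ _ ‖lam w‖]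
  refine mul_le_mul_of_nonneg_right ?_ (by norm_num)
  rw [div_mul_eq_mul_div, le_div_iff₀ hc, mul_assoc _ _ c]
  gcongr
  linarith

theorem mul_exp_neg_le (x : ℝ) : x * Real.exp (-x) ≤ 1 := by
  rw [Real.exp_neg, mul_inv_le_iff₀ (Real.exp_pos _)]
  linarith [Real.add_one_le_exp x]

theorem deriv_lam_add_two (z : ℂ) : deriv lam (z + 2) = deriv lam z := by
  rw [← deriv_comp_add_const]
  simp_rw [lam_add_two]

theorem deriv_lam_one_sub_inv {w : ℂ} (hw : 0 < w.im) :
    deriv lam (1 - 1 / w) = w ^ 2 * (deriv lam w / lam w ^ 2) := by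
  have hw0 := ne_zero_of_im_pos hw
  have him : 0 < (1 - 1 / w).im := by
    have := im_neg_one_div hw
    rw [neg_div, neg_im] at this; simpa using this
  have e1 : HasDerivAt (fun w => 1 - 1 / w) (1 / w ^ 2) w := by
    have := (hasDerivAt_inv hw0).const_sub 1
    simpa using! this
  have e2 : HasDerivAt (fun w => lam (1 - 1 / w)) (deriv lam (1 - 1 / w) * (1 / w ^ 2)) w :=
    HasDerivAt.comp (h₂ := lam) w (differentiableAt_lam him).hasDerivAt e1
  have e3 : HasDerivAt (fun w => 1 - 1 / lam w) (deriv lam w / lam w ^ 2) w := by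
    have := ((differentiableAt_lam hw).hasDerivAt.inv (lam_ne_zero hw)).const_sub 1
    simpa [neg_div] using! this
  have e4 : (fun w => lam (1 - 1 / w)) =ᶠ[𝓝 w] fun w => 1 - 1 / lam w := by
    filter_upwards [isOpen_uhp.mem_nhds hw] with v hv using lam_one_sub_inv hv
  have e5 := (e2.congr_of_eventuallyEq e4.symm).unique e3
  rw [← e5]
  field_simp

/-- The basic estimates of `λ` and `λ'` on `D`. -/
theorem exists_lam_estimates : ∃ K : ℝ, 0 < K ∧ ∀ z ∈ fdD,
    z.im * ‖deriv lam z‖ ≤ K * cuspV z * (1 + ‖lam z‖) ∧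
    1 + ‖lam z‖ ≤ K * Real.exp (Real.pi * cuspV z) := by
  obtain ⟨c, C, hc, hC, hb⟩ := exists_norm_lam_bounds
  obtain ⟨K, hK, hd⟩ := exists_norm_deriv_lam_le
  refine ⟨max (K * C) K + (1 + C) + (2 + 1 / c), by positivity, fun z hz => ?_⟩
  have hz0 := hz.1
  have hV := one_le_cuspV hz.1
  set K' := max (K * C) K + (1 + C) + (2 + 1 / c) with hK'
  have hK1 : K * C ≤ K' := by
    have := le_max_left (K * C) K
    have : 0 < 1 / c := by positivity
    linarith
  have hK2 : K ≤ K' := by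
    have := le_max_right (K * C) K
    have : 0 < 1 / c := by positivity
    linarith
  have hK3 : 1 + C ≤ K' := by
    have : 0 < max (K * C) K := by positivity
    have : 0 < 1 / c := by positivity
    linarith
  have hK4 : 2 + 1 / c ≤ K' := by
    have : 0 < max (K * C) K := by positivity
    linarith
  have hexp : 1 ≤ Real.exp (Real.pi * cuspV z) := Real.one_le_exp (by positivity)
  rcases le_or_gt 1 z.im with hy | hy
  · have hl := (hb z (by linarith)).2
    have hle : Real.exp (-Real.pi * z.im) ≤ 1 := Real.exp_le_one_iff.2 (by
        nlinarith [Real.pi_pos])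
    constructor
    · have h1 : z.im * ‖deriv lam z‖ ≤ K * C := by
        calc z.im * ‖deriv lam z‖ ≤ z.im * (K * (C * Real.exp (-Real.pi * z.im))) := by
              gcongr
              exact (hd z (by linarith)).trans (by gcongr)
          _ ≤ z.im * (K * (C * Real.exp (-z.im))) := by
              gcongr; nlinarith [Real.pi_gt_three]
          _ = K * C * (z.im * Real.exp (-z.im)) := by ring
          _ ≤ K * C * 1 := by gcongr; exact mul_exp_neg_le _
          _ = _ := mul_one _
      calc _ ≤ K * C := h1
        _ ≤ K' * 1 * 1 := by linarith
        _ ≤ _ := by gcongr; linarith [norm_nonneg (lam z)]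
    · have h1 : 1 + ‖lam z‖ ≤ 1 + C := by nlinarith
      calc _ ≤ 1 + C := h1
        _ ≤ K' * 1 := by linarith
        _ ≤ _ := by gcongr
  · obtain ⟨s, w, hs, hzw, hwi, hwr, hwv⟩ := exists_cusp_coord_of_mem_fdD hz hy.le
    have hs' := hs.imp And.left And.left
    have hwh : 1 / 2 ≤ w.im := by
      refine le_trans ?_ hwi
      rw [div_le_div_iff₀ (by norm_num) (by positivity)]; linarith
    have hw0 : 0 < w.im := by linarith
    have hwne := ne_zero_of_im_pos hw0
    have hlne := lam_ne_zero hw0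
    have hvV : w.im ≤ cuspV z := by
      have h1 : 0 ≤ z.im / ‖z - 1‖ ^ 2 := by positivity
      have h2 : 0 ≤ z.im / ‖z + 1‖ ^ 2 := by positivity
      rw [hwv, cuspV]
      rcases hs' with rfl | rfl
      · rw [add_zero]; linarith
      · rw [show z + 2 - 1 = z + 1 by ring]; linarith
    have hlz : lam z = 1 - 1 / lam w := by
      rw [← lam_add_of_eq hs', hzw, lam_one_sub_inv hw0]
    have hinv : ‖1 / lam w‖ ≤ 1 + ‖lam z‖ := by
      rw [show 1 / lam w = 1 - lam z by rw [hlz]; ring]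
      exact (norm_sub_le _ _).trans (by simp)
    constructor
    · have h1 : deriv lam z = w ^ 2 * (deriv lam w / lam w ^ 2) := by
        rw [← deriv_lam_one_sub_inv hw0, ← hzw]
        rcases hs' with rfl | rfl
        · rw [add_zero]
        · rw [deriv_lam_add_two]
      have h2 : z.im * ‖w‖ ^ 2 = w.im := by
        rw [hwv, show z + s - 1 = -1 / w by rw [hzw]; ring, norm_div]
        simp
      calc z.im * ‖deriv lam z‖ = z.im * ‖w‖ ^ 2 * (‖deriv lam w‖ / ‖lam w‖ ^ 2) := by
            rw [h1, norm_mul, norm_pow, norm_div, norm_pow]; ring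
        _ ≤ w.im * (K * ‖lam w‖ / ‖lam w‖ ^ 2) := by
            rw [h2]; gcongr; exact hd w hwh
        _ = K * w.im * ‖1 / lam w‖ := by
            have := norm_pos_iff.2 hlne
            rw [norm_div, norm_one]; field_simp
        _ ≤ K' * cuspV z * (1 + ‖lam z‖) := by gcongr
    · have h3 : ‖1 / lam w‖ ≤ Real.exp (Real.pi * w.im) / c := by
        rw [norm_div, norm_one, div_le_div_iff₀ (norm_pos_iff.2 hlne) hc, one_mul]
        calc c = Real.exp (Real.pi * w.im) * (c * Real.exp (-Real.pi * w.im)) := by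
              rw [mul_left_comm, ← Real.exp_add]; simp
          _ ≤ Real.exp (Real.pi * w.im) * ‖lam w‖ := by
              gcongr
              exact (hb w (by linarith)).1
      have h4 : ‖lam z‖ ≤ 1 + Real.exp (Real.pi * w.im) / c := by
        rw [hlz]
        exact (norm_sub_le _ _).trans (by rw [norm_one]; gcongr)
      have h5 : Real.exp (Real.pi * w.im) ≤ Real.exp (Real.pi * cuspV z) := by gcongr
      calc 1 + ‖lam z‖ ≤ 2 * 1 + 1 / c * Real.exp (Real.pi * w.im) := by
            rw [one_div_mul_eq_div]; linarith
        _ ≤ 2 * Real.exp (Real.pi * cuspV z) + 1 / c * Real.exp (Real.pi * cuspV z) := by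
            gcongr
        _ = (2 + 1 / c) * Real.exp (Real.pi * cuspV z) := by ring
        _ ≤ _ := by gcongr

/-- The values of `λ` on the vertical line `Re z = 1`. -/
theorem exists_lam_one_add_bound : ∃ c : ℝ, 0 < c ∧ ∀ t : ℝ, 0 < t → ∃ s : ℝ, 0 < s ∧
    lam (1 + t * I) = -s ∧ (t ≤ 1 → c * Real.exp (Real.pi / t) ≤ 1 + s) := by
  obtain ⟨c, C, hc, hC, hb⟩ := exists_norm_lam_bounds
  refine ⟨1 / C, by positivity, fun t ht => ?_⟩
  obtain ⟨s, hs, h1⟩ := lam_one_add ht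
  refine ⟨s, hs, h1, fun ht1 => ?_⟩
  have htne : (t : ℂ) ≠ 0 := by exact_mod_cast ht.ne'
  set w : ℂ := (1 / t : ℝ) * I with hw
  have hwi : w.im = 1 / t := by simp [hw]
  have h1t : 1 ≤ 1 / t := by rw [le_div_iff₀ ht]; linarith
  have hw0 : 0 < w.im := by rw [hwi]; positivity
  have h2 : (1 + t * I : ℂ) = 1 - 1 / w := by
    rw [hw]; push_cast; field_simp; linear_combination (t : ℂ) * I_mul_I
  rw [h2, lam_one_sub_inv hw0] at h1
  have h3 : 1 / lam w = (1 + s : ℝ) := by push_cast; linear_combination -h1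
  have h4 : 1 / ‖lam w‖ = 1 + s := by
    have := congrArg norm h3
    rwa [norm_div, norm_one, Complex.norm_real, Real.norm_of_nonneg (by linarith)] at this
  rw [← h4, one_div_mul_eq_div, div_le_div_iff₀ hC (norm_pos_iff.2 (lam_ne_zero hw0)), one_mul]
  calc Real.exp (Real.pi / t) * ‖lam w‖
      ≤ Real.exp (Real.pi / t) * (C * Real.exp (-Real.pi * w.im)) := by
        gcongr
        exact (hb w (by rw [hwi]; linarith)).2
    _ = C := by
      rw [mul_left_comm, ← Real.exp_add, hwi, show Real.pi / t + -Real.pi * (1 / t) = 0 by ring]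
      simp

/-- Holomorphic functions on the upper half-plane bounded by `C / Im z`. -/
structure IsBloch (ψ : ℂ → ℂ) (C : ℝ) : Prop where
  diff : ∀ z : ℂ, 0 < z.im → DifferentiableAt ℂ ψ z
  bound : ∀ z : ℂ, 0 < z.im → ‖ψ z‖ ≤ C / z.im

/-- The weight two action of `z ↦ -1/z`. -/
def slashS (ψ : ℂ → ℂ) (z : ℂ) : ℂ := ψ (-1 / z) / z ^ 2

theorem differentiableAt_neg_one_div {z : ℂ} (hz : z ≠ 0) :
    DifferentiableAt ℂ (fun z : ℂ => -1 / z) z :=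
  (differentiableAt_const _).div differentiableAt_id hz

theorem slashS_slashS (ψ : ℂ → ℂ) {z : ℂ} (hz : z ≠ 0) : slashS (slashS ψ) z = ψ z := by
  rw [slashS, slashS, show -1 / (-1 / z) = z by field_simp]
  field_simp

theorem neg_one_div_neg_one_div {z : ℂ} (hz : z ≠ 0) : -1 / (-1 / z) = z := by
  field_simp

theorem IsBloch.slashS {ψ : ℂ → ℂ} {C : ℝ} (h : IsBloch ψ C) : IsBloch (slashS ψ) C where
  diff z hz := by
    have h0 := ne_zero_of_im_pos hz
    exact ((h.diff _ (im_neg_one_div hz)).comp z (differentiableAt_neg_one_div h0)).div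
      (by fun_prop) (pow_ne_zero 2 h0)
  bound z hz := by
    have h0 := ne_zero_of_im_pos hz
    have h1 : 0 < ‖z‖ := norm_pos_iff.2 h0
    rw [_root_.slashS, norm_div, norm_pow, div_le_iff₀ (by positivity)]
    refine (h.bound _ (im_neg_one_div hz)).trans (le_of_eq ?_)
    rw [im_neg_one_div_eq, Complex.normSq_eq_norm_sq]
    field_simp

theorem IsBloch.nonneg {ψ : ℂ → ℂ} {C : ℝ} (h : IsBloch ψ C) : 0 ≤ C := by
  have := h.bound I (by simp)
  simp at this
  exact (norm_nonneg _).trans this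

theorem IsBloch.norm_deriv_le {ψ : ℂ → ℂ} {C : ℝ} (h : IsBloch ψ C) {z : ℂ} (hz : 0 < z.im) :
    ‖deriv ψ z‖ ≤ 4 * C / z.im ^ 2 := by
  have h1 := norm_deriv_le_of_uhp h.diff (z := z) (r := z.im / 2) (M := C / (z.im / 2))
    (by positivity) (by linarith) (by
      intro w hw
      have := (abs_le.1 ((Complex.abs_im_le_norm (w - z)).trans hw.le)).1
      rw [sub_im] at this
      refine (h.bound w (by linarith)).trans ?_
      have := h.nonneg
      gcongr
      linarith)
  refine h1.trans (le_of_eq ?_)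
  field_simp; norm_num

/-- The difference of the values of `ψ` on the two vertical sides of `D`. -/
def sideDiff (ψ : ℂ → ℂ) (t : ℝ) : ℂ := ψ (-1 + t * I) - ψ (1 + t * I)

theorem IsBloch.norm_sideDiff_le {ψ : ℂ → ℂ} {C : ℝ} (h : IsBloch ψ C) {t : ℝ} (ht : 0 < t) :
    ‖sideDiff ψ t‖ ≤ 2 * C / t := by
  have h1 := h.bound (-1 + t * I) (by simpa using ht)
  have h2 := h.bound (1 + t * I) (by simpa using ht)
  simp only [add_im, neg_im, one_im, mul_im, ofReal_re, I_im, ofReal_im, I_re, mul_one, mul_zero,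
    add_zero, neg_zero, zero_add] at h1 h2
  refine (norm_sub_le _ _).trans ((add_le_add h1 h2).trans (le_of_eq (by ring)))

theorem IsBloch.norm_sideDiff_le' {ψ : ℂ → ℂ} {C : ℝ} (h : IsBloch ψ C) {t : ℝ} (ht : 0 < t) :
    ‖sideDiff ψ t‖ ≤ 8 * C / t ^ 2 := by
  have hconv : Convex ℝ {z : ℂ | t ≤ z.im} := convex_halfSpace_im_ge t
  have h1 := hconv.norm_image_sub_le_of_norm_deriv_le (𝕜 := ℂ) (f := ψ) (C := 4 * C / t ^ 2)
    (x := 1 + t * I) (y := -1 + t * I) (fun z hz => h.diff z (ht.trans_le hz))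
    (fun z hz => (h.norm_deriv_le (ht.trans_le hz)).trans (by
      have := h.nonneg
      have h2 : t ≤ z.im := hz
      gcongr)) (show t ≤ (1 + t * I : ℂ).im by simp) (show t ≤ (-1 + t * I : ℂ).im by simp)
  refine h1.trans (le_of_eq ?_)
  rw [show (-1 + t * I - (1 + t * I) : ℂ) = -2 by ring]
  simp; ring

theorem IsBloch.continuousOn_sideDiff {ψ : ℂ → ℂ} {C : ℝ} (h : IsBloch ψ C) :
    ContinuousOn (sideDiff ψ) (Set.Ioi 0) := by
  refine ContinuousOn.sub ?_ ?_ <;> intro t ht <;>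
    refine ContinuousAt.continuousWithinAt ?_
  · exact ContinuousAt.comp (g := ψ) (h.diff _ (by simpa using ht)).continuousAt (by fun_prop)
  · exact ContinuousAt.comp (g := ψ) (h.diff _ (by simpa using ht)).continuousAt (by fun_prop)

theorem continuousOn_lam_one_add : ContinuousOn (fun t : ℝ => lam (1 + t * I)) (Set.Ioi 0) := by
  intro t ht
  refine ContinuousAt.continuousWithinAt ?_
  exact ContinuousAt.comp (g := lam) (differentiableAt_lam (by simpa using ht)).continuousAt
    (by fun_prop)

/-- The integral defining the local solution, as a function of `L = λ(τ)`. -/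
def sideIntegral (ψ : ℂ → ℂ) (L : ℂ) : ℂ :=
  ∫ t in Set.Ioi (0 : ℝ), sideDiff ψ t / (lam (1 + t * I) - 1 + L)

theorem denom_ne_zero {t : ℝ} (ht : 0 < t) {L : ℂ} (hL : L.re < 1) :
    lam (1 + t * I) - 1 + L ≠ 0 := by
  obtain ⟨s, hs, h1⟩ := lam_one_add ht
  intro h
  rw [h1] at h
  have := congrArg Complex.re h
  simp at this
  linarith

theorem continuousOn_sideIntegrand {ψ : ℂ → ℂ} {C : ℝ} (h : IsBloch ψ C) {L : ℂ} (hL : L.re < 1) :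
    ContinuousOn (fun t : ℝ => sideDiff ψ t / (lam (1 + t * I) - 1 + L)) (Set.Ioi 0) :=
  h.continuousOn_sideDiff.div ((continuousOn_lam_one_add.sub continuousOn_const).add
    continuousOn_const) fun _ ht => denom_ne_zero ht hL

theorem exists_inv_denom_bound : ∃ K : ℝ, 0 < K ∧ ∀ t : ℝ, 0 < t → ∀ δ : ℝ, 0 < δ → δ ≤ 1 →
    ∀ L : ℂ, L.re ≤ 1 - δ → ‖lam (1 + t * I) - 1 + L‖⁻¹ ≤ K / δ * (t ⊓ 1) := by
  obtain ⟨c, hc, hb⟩ := exists_lam_one_add_bound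
  refine ⟨1 / c + 1, by positivity, fun t ht δ hδ hδ1 L hL => ?_⟩
  obtain ⟨s, hs, h1, h2⟩ := hb t ht
  have h3 : s + δ ≤ ‖lam (1 + t * I) - 1 + L‖ := by
    rw [h1]
    refine le_trans ?_ (Complex.abs_re_le_norm _)
    refine le_trans ?_ (neg_le_abs _)
    simp; linarith
  have h4 : δ * (1 + s) ≤ ‖lam (1 + t * I) - 1 + L‖ := by nlinarith
  have h5 : ‖lam (1 + t * I) - 1 + L‖⁻¹ ≤ (δ * (1 + s))⁻¹ := by gcongr
  refine h5.trans ?_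
  rw [mul_inv, div_eq_mul_inv, mul_comm (_ + _), mul_assoc]
  gcongr
  rcases le_total t 1 with h | h
  · rw [inf_eq_left.2 h]
    have h6 : c * (1 / t) ≤ 1 + s := by
      refine le_trans ?_ (h2 h)
      gcongr
      have := Real.add_one_le_exp (Real.pi / t)
      have h7 : 1 / t ≤ Real.pi / t := by
        gcongr; linarith [Real.pi_gt_three]
      linarith
    calc (1 + s)⁻¹ ≤ (c * (1 / t))⁻¹ := by gcongr
      _ = 1 / c * t := by field_simp
      _ ≤ _ := by gcongr; linarith
  · rw [inf_eq_right.2 h, mul_one]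
    have : (1 + s)⁻¹ ≤ 1 := inv_le_one_of_one_le₀ (by linarith)
    have : 0 < 1 / c := by positivity
    linarith

theorem integrable_two_inv (K : ℝ) :
    Integrable (fun t : ℝ => K * (1 + t ^ 2)⁻¹) (volume.restrict (Set.Ioi 0)) :=
  (integrable_inv_one_add_sq.const_mul K).integrableOn

theorem IsBloch.norm_sideDiff_mul_le {ψ : ℂ → ℂ} {C : ℝ} (h : IsBloch ψ C) {t : ℝ} (ht : 0 < t) :
    ‖sideDiff ψ t‖ * (t ⊓ 1) ≤ 16 * C * (1 + t ^ 2)⁻¹ := by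
  have hC := h.nonneg
  rw [← div_eq_mul_inv]
  rcases le_total t 1 with h1 | h1
  · rw [inf_eq_left.2 h1]
    calc ‖sideDiff ψ t‖ * t ≤ 2 * C / t * t := by gcongr; exact h.norm_sideDiff_le ht
      _ = 2 * C := by field_simp
      _ ≤ 16 * C / (1 + t ^ 2) := by
        rw [le_div_iff₀ (by positivity)]
        nlinarith [pow_le_one₀ ht.le h1 (n := 2)]
  · rw [inf_eq_right.2 h1, mul_one]
    refine (h.norm_sideDiff_le' ht).trans ?_
    rw [div_le_div_iff₀ (by positivity) (by positivity)]
    nlinarith [one_le_pow₀ h1 (n := 2)]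

theorem integrableOn_sideIntegrand {ψ : ℂ → ℂ} {C : ℝ} (h : IsBloch ψ C) {L : ℂ} (hL : L.re < 1) :
    IntegrableOn (fun t : ℝ => sideDiff ψ t / (lam (1 + t * I) - 1 + L)) (Set.Ioi 0) := by
  obtain ⟨K, hK, hb⟩ := exists_inv_denom_bound
  have hδ : 0 < min (1 - L.re) 1 := lt_min (by linarith) one_pos
  refine Integrable.mono' (integrable_two_inv (K / (min (1 - L.re) 1) * (16 * C)))
    ((continuousOn_sideIntegrand h hL).aestronglyMeasurable measurableSet_Ioi) ?_
  refine (ae_restrict_iff' measurableSet_Ioi).2 (Eventually.of_forall fun t ht => ?_)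
  have ht' : 0 < t := ht
  have h1 := hb t ht _ hδ (min_le_right _ _) L (by linarith [min_le_left (1 - L.re) 1])
  rw [norm_div, div_eq_mul_inv]
  calc _ ≤ ‖sideDiff ψ t‖ * (K / (min (1 - L.re) 1) * (t ⊓ 1)) := by gcongr
    _ = K / (min (1 - L.re) 1) * (‖sideDiff ψ t‖ * (t ⊓ 1)) := by ring
    _ ≤ K / (min (1 - L.re) 1) * (16 * C * (1 + t ^ 2)⁻¹) := 
      mul_le_mul_of_nonneg_left (h.norm_sideDiff_mul_le ht) (by positivity)
    _ = _ := by ring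

theorem differentiableAt_sideIntegral {ψ : ℂ → ℂ} {C : ℝ} (h : IsBloch ψ C) {L : ℂ}
    (hL : L.re < 1) : DifferentiableAt ℂ (sideIntegral ψ) L := by
  obtain ⟨K, hK, hb⟩ := exists_inv_denom_bound
  obtain ⟨δ, hδ0, hδ⟩ : ∃ δ, 0 < δ ∧ δ < min (1 - L.re) 1 :=
    exists_between (lt_min (by linarith) one_pos)
  have hδ1 : δ < 1 := hδ.trans_le (min_le_right _ _)
  have hδ2 : δ < 1 - L.re := hδ.trans_le (min_le_left _ _)
  have hs : {x : ℂ | x.re < 1 - δ} ∈ 𝓝 L :=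
    (isOpen_lt Complex.continuous_re continuous_const).mem_nhds (show L.re < 1 - δ by linarith)
  refine (hasDerivAt_integral_of_dominated_loc_of_deriv_le
    (F := fun x (t : ℝ) => sideDiff ψ t / (lam (1 + t * I) - 1 + x))
    (F' := fun x (t : ℝ) => -sideDiff ψ t / (lam (1 + t * I) - 1 + x) ^ 2)
    (bound := fun t => K / δ * (K / δ) * (16 * C) * (1 + t ^ 2)⁻¹)
    hs ?_ (integrableOn_sideIntegrand h hL) ?_ ?_ (integrable_two_inv _) ?_).2.differentiableAt
  · filter_upwards [hs] with x hx
    have hx : x.re < 1 - δ := hx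
    exact (continuousOn_sideIntegrand h (by linarith)).aestronglyMeasurable measurableSet_Ioi
  · refine ContinuousOn.aestronglyMeasurable ?_ measurableSet_Ioi
    exact h.continuousOn_sideDiff.neg.div (((continuousOn_lam_one_add.sub continuousOn_const).add
      continuousOn_const).pow 2) fun _ ht => pow_ne_zero 2 (denom_ne_zero ht hL)
  · refine (ae_restrict_iff' measurableSet_Ioi).2 (Eventually.of_forall fun t ht x hx => ?_)
    have hx : x.re < 1 - δ := hx
    have ht' : 0 < t := ht
    have h1 := hb t ht δ hδ0 hδ1.le x hx.le
    have h2 : ‖lam (1 + t * I) - 1 + x‖⁻¹ ≤ K / δ := h1.trans (by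
      have : t ⊓ 1 ≤ 1 := inf_le_right
      have h3 : 0 < K / δ := by positivity
      nlinarith)
    rw [norm_div, norm_neg, norm_pow, div_eq_mul_inv, ← inv_pow, sq]
    calc _ ≤ ‖sideDiff ψ t‖ * ((K / δ) * (K / δ * (t ⊓ 1))) := by gcongr
      _ = K / δ * (K / δ) * (‖sideDiff ψ t‖ * (t ⊓ 1)) := by ring
      _ ≤ K / δ * (K / δ) * (16 * C * (1 + t ^ 2)⁻¹) := 
        mul_le_mul_of_nonneg_left (h.norm_sideDiff_mul_le ht) (by positivity)
      _ = _ := by ring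
  · refine (ae_restrict_iff' measurableSet_Ioi).2 (Eventually.of_forall fun t ht x hx => ?_)
    have hx : x.re < 1 - δ := hx
    have h1 := ((hasDerivAt_id x).const_add (lam (1 + t * I) - 1)).inv
      (denom_ne_zero ht (show (id x).re < 1 by rw [id]; linarith))
    have h2 := h1.const_mul (sideDiff ψ t)
    simpa [div_eq_mul_inv, neg_mul, mul_neg] using! h2

/-- The size of the integral defining the local solution. -/
theorem exists_norm_sideIntegral_le : ∃ K : ℝ, 0 < K ∧ ∀ (ψ : ℂ → ℂ) (C : ℝ), IsBloch ψ C →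
    ∀ z ∈ fdD, (1 + ‖lam z‖) * ‖sideIntegral ψ (lam z)‖ ≤ K * C * (1 + Real.log (1 + cuspV z)) := by
  obtain ⟨c, hc, hb⟩ := exists_lam_one_add_bound
  obtain ⟨K, hK, hlam⟩ := exists_lam_estimates
  have hden : ∀ t s : ℝ, 0 < t → 0 < s → lam (1 + t * I) = -s → ∀ L : ℂ, L.re ≤ 1 / 2 →
      1 + s + ‖L‖ ≤ 5 * ‖lam (1 + t * I) - 1 + L‖ := by
    intro t s ht hs h1 L hL
    rw [h1]
    have h3 : s + 1 / 2 ≤ ‖-(s : ℂ) - 1 + L‖ := by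
      refine le_trans ?_ (Complex.abs_re_le_norm _)
      refine le_trans ?_ (neg_le_abs _)
      simp; linarith
    have h4 : ‖L‖ ≤ ‖-(s : ℂ) - 1 + L‖ + (s + 1) := by
      have : ‖((s + 1 : ℝ) : ℂ)‖ = s + 1 := by
        rw [Complex.norm_real, Real.norm_of_nonneg (by linarith)]
      rw [← this]
      refine le_trans (le_of_eq ?_) (norm_add_le _ _)
      congr 1; push_cast; ring
    linarith
  refine ⟨40 * (K / c + 1) + 80 * Real.pi, by positivity, fun ψ C h z hz => ?_⟩
  have hC := h.nonneg
  set V := cuspV z with hVdef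
  have hV : 1 ≤ V := one_le_cuspV hz.1
  have hL := lam_re_le_half hz
  set F := fun t : ℝ => (1 + ‖lam z‖ : ℂ) * (sideDiff ψ t / (lam (1 + t * I) - 1 + lam z)) with hF
  have hn : ‖(1 + ‖lam z‖ : ℂ)‖ = 1 + ‖lam z‖ := by
    rw [← ofReal_one, ← ofReal_add, Complex.norm_real, Real.norm_of_nonneg (by positivity)]
  have hFint : IntegrableOn F (Set.Ioi 0) :=
    (integrableOn_sideIntegrand h (by linarith)).const_mul _
  have e1 : (1 + ‖lam z‖) * ‖sideIntegral ψ (lam z)‖ = ‖∫ t in Set.Ioi (0 : ℝ), F t‖ := by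
    rw [hF, integral_const_mul, norm_mul, hn, sideIntegral]
  have e2 : ∫ t in Set.Ioi (0 : ℝ), F t = (∫ t in (0 : ℝ)..1, F t) + ∫ t in Set.Ioi (1 : ℝ), F t :=
    (intervalIntegral.integral_interval_add_Ioi hFint
      (hFint.mono_set (Set.Ioi_subset_Ioi zero_le_one))).symm
  have hbound : ∀ t : ℝ, 0 < t → ∃ s : ℝ, 0 < s ∧ (t ≤ 1 → c * Real.exp (Real.pi / t) ≤ 1 + s) ∧
      ‖F t‖ ≤ 5 * ‖sideDiff ψ t‖ * ((1 + ‖lam z‖) / (1 + s + ‖lam z‖)) := by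
    intro t ht
    obtain ⟨s, hs, h1, h2⟩ := hb t ht
    refine ⟨s, hs, h2, ?_⟩
    have h3 := hden t s ht hs h1 _ hL
    have hpos : 0 < 1 + s + ‖lam z‖ := by positivity
    rw [hF, norm_mul, hn, norm_div, mul_div_assoc', mul_div_assoc', div_le_div_iff₀ (by linarith) hpos]
    calc (1 + ‖lam z‖) * ‖sideDiff ψ t‖ * (1 + s + ‖lam z‖)
        ≤ (1 + ‖lam z‖) * ‖sideDiff ψ t‖ * (5 * ‖lam (1 + t * I) - 1 + lam z‖) := by gcongr
      _ = _ := by ring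
  have b1 : ∀ t : ℝ, t ∈ Set.Ioc (0 : ℝ) 1 → ‖F t‖ ≤ 40 * (K / c + 1) * C * (V / (1 + V * t)) := by
    rintro t ⟨ht, ht1⟩
    obtain ⟨s, hs, h2, h3⟩ := hbound t ht
    have h4 := h.norm_sideDiff_le ht
    have hq : (1 + ‖lam z‖) / (1 + s + ‖lam z‖) ≤ 1 := by
      rw [div_le_one (by positivity)]; linarith
    refine h3.trans ?_
    rcases le_or_gt (V * t) 1 with hVt | hVt
    · have h5 : (1 + ‖lam z‖) / (1 + s + ‖lam z‖) ≤ K / c * Real.exp (-(1 / t - V)) := by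
        rw [div_le_iff₀ (by positivity)]
        have h6 : K * Real.exp (Real.pi * V) ≤ K / c * Real.exp (-(1 / t - V)) * (1 + s) := by
          calc K * Real.exp (Real.pi * V) ≤ K * Real.exp (-(1 / t - V) + Real.pi / t) := by
                gcongr
                have h7 : V ≤ 1 / t := by rw [le_div_iff₀ ht]; exact hVt
                have : Real.pi / t = Real.pi * (1 / t) := by ring
                rw [this]
                nlinarith [Real.pi_gt_three]
            _ = K / c * Real.exp (-(1 / t - V)) * (c * Real.exp (Real.pi / t)) := by
                rw [Real.exp_add]; field_simp
            _ ≤ _ := by gcongr; exact h2 ht1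
        exact ((hlam z hz).2.trans h6).trans
          (mul_le_mul_of_nonneg_left (by linarith [norm_nonneg (lam z)]) (by positivity))
      have h8 : 1 / t * Real.exp (-(1 / t - V)) ≤ 2 * V := by
        have h9 := mul_exp_neg_le (1 / t - V)
        have h7 : V ≤ 1 / t := by rw [le_div_iff₀ ht]; exact hVt
        have h10 : Real.exp (-(1 / t - V)) ≤ 1 := Real.exp_le_one_iff.2 (by linarith)
        nlinarith
      calc 5 * ‖sideDiff ψ t‖ * ((1 + ‖lam z‖) / (1 + s + ‖lam z‖))
          ≤ 5 * (2 * C / t) * (K / c * Real.exp (-(1 / t - V))) := by gcongr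
        _ = 10 * C * (K / c) * (1 / t * Real.exp (-(1 / t - V))) := by ring
        _ ≤ 10 * C * (K / c) * (2 * V) := by gcongr
        _ = 40 * (K / c) * C * (V / 2) := by ring
        _ ≤ 40 * (K / c + 1) * C * (V / (1 + V * t)) := by
          have h11 : V / 2 ≤ V / (1 + V * t) := by gcongr; linarith
          have h12 : 40 * (K / c) * C ≤ 40 * (K / c + 1) * C := by gcongr; linarith
          exact mul_le_mul h12 h11 (by positivity) (by positivity)
    · calc 5 * ‖sideDiff ψ t‖ * ((1 + ‖lam z‖) / (1 + s + ‖lam z‖))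
          ≤ 5 * (2 * C / t) * 1 := by gcongr
        _ = 20 * 1 * C * (1 / (2 * t)) := by ring
        _ ≤ 40 * (K / c + 1) * C * (V / (1 + V * t)) := by
          have h11 : 1 / (2 * t) ≤ V / (1 + V * t) := by
            rw [div_le_div_iff₀ (by positivity) (by positivity)]; nlinarith
          have h13 : 0 < K / c := by positivity
          have h12 : 20 * 1 * C ≤ 40 * (K / c + 1) * C := by gcongr <;> linarith
          exact mul_le_mul h12 h11 (by positivity) (by positivity)
  have b2 : ∀ t : ℝ, t ∈ Set.Ioi (1 : ℝ) → ‖F t‖ ≤ 80 * C * (1 + t ^ 2)⁻¹ := by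
    intro t ht
    have ht1 : 1 < t := ht
    obtain ⟨s, hs, h2, h3⟩ := hbound t (by linarith)
    have hq : (1 + ‖lam z‖) / (1 + s + ‖lam z‖) ≤ 1 := by
      rw [div_le_one (by positivity)]; linarith
    have h4 := h.norm_sideDiff_mul_le (t := t) (by linarith)
    rw [inf_eq_right.2 ht1.le, mul_one] at h4
    calc _ ≤ _ := h3
      _ ≤ 5 * (16 * C * (1 + t ^ 2)⁻¹) * 1 := by gcongr
      _ = _ := by ring
  have hVt : ∀ t : ℝ, 0 ≤ t → 0 < 1 + V * t := fun t ht => by positivity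
  have i1 : ∫ t in (0 : ℝ)..1, 40 * (K / c + 1) * C * (V / (1 + V * t)) =
      40 * (K / c + 1) * C * Real.log (1 + V) := by
    rw [intervalIntegral.integral_const_mul]
    congr 1
    have := intervalIntegral.integral_eq_sub_of_hasDerivAt (a := 0) (b := 1)
      (f := fun t : ℝ => Real.log (1 + V * t)) (f' := fun t => V / (1 + V * t)) (fun t ht => by
        rw [Set.uIcc_of_le zero_le_one] at ht
        have := (((hasDerivAt_id t).const_mul V).const_add 1).log (hVt t ht.1).ne'
        simpa using! this) (ContinuousOn.intervalIntegrable (by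
        rw [Set.uIcc_of_le zero_le_one]
        exact continuousOn_const.div (by fun_prop) fun t ht => (hVt t ht.1).ne'))
    rw [this]; simp
  have n1 : ‖∫ t in (0 : ℝ)..1, F t‖ ≤ 40 * (K / c + 1) * C * Real.log (1 + V) := by
    rw [← i1]
    refine intervalIntegral.norm_integral_le_of_norm_le zero_le_one
      (Eventually.of_forall b1) (ContinuousOn.intervalIntegrable ?_)
    rw [Set.uIcc_of_le zero_le_one]
    exact continuousOn_const.mul (continuousOn_const.div (by fun_prop) fun t ht => (hVt t ht.1).ne')
  have n2 : ‖∫ t in Set.Ioi (1 : ℝ), F t‖ ≤ 80 * C * Real.pi := by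
    have h1 : ‖∫ t in Set.Ioi (1 : ℝ), F t‖ ≤ ∫ t in Set.Ioi (1 : ℝ), 80 * C * (1 + t ^ 2)⁻¹ :=
      MeasureTheory.norm_integral_le_of_norm_le
        (integrable_inv_one_add_sq.const_mul _).integrableOn
        ((ae_restrict_iff' measurableSet_Ioi).2 (Eventually.of_forall b2))
    refine h1.trans ?_
    rw [integral_const_mul, integral_Ioi_inv_one_add_sq]
    gcongr
    have : 0 < Real.arctan 1 := Real.arctan_pos.2 one_pos
    linarith [Real.pi_pos]
  rw [e1, e2]
  have hlog : 0 ≤ Real.log (1 + V) := Real.log_nonneg (by linarith)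
  calc _ ≤ 40 * (K / c + 1) * C * Real.log (1 + V) + 80 * C * Real.pi :=
        (norm_add_le _ _).trans (add_le_add n1 n2)
    _ ≤ 40 * (K / c + 1) * C * (1 + Real.log (1 + V)) + 80 * Real.pi * C * (1 + Real.log (1 + V)) := by
        have : 80 * C * Real.pi = 80 * Real.pi * C * 1 := by ring
        rw [this]
        gcongr <;> linarith
    _ = _ := by ring

/-- The local solution on `D`. -/
def locB (ψ : ℂ → ℂ) (z : ℂ) : ℂ := deriv lam z / (2 * Real.pi) * sideIntegral ψ (lam z)

theorem locB_add_two (ψ : ℂ → ℂ) (z : ℂ) : locB ψ (z + 2) = locB ψ z := by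
  rw [locB, locB, deriv_lam_add_two, lam_add_two]

theorem differentiableAt_locB {ψ : ℂ → ℂ} {C : ℝ} (h : IsBloch ψ C) {z : ℂ} (hz : 0 < z.im)
    (hL : (lam z).re < 1) : DifferentiableAt ℂ (locB ψ) z :=
  ((differentiableAt_uhp_deriv (fun _ hz => differentiableAt_lam hz) hz).div_const _).mul
    (DifferentiableAt.comp (g := sideIntegral ψ) z (differentiableAt_sideIntegral h hL)
      (differentiableAt_lam hz))

theorem exists_norm_locB_le : ∃ K : ℝ, 0 < K ∧ ∀ (ψ : ℂ → ℂ) (C : ℝ), IsBloch ψ C →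
    ∀ z ∈ fdD, z.im * ‖locB ψ z‖ ≤ K * C * cuspV z * (1 + Real.log (1 + cuspV z)) := by
  obtain ⟨K, hK, h1⟩ := exists_norm_sideIntegral_le
  obtain ⟨K', hK', h2⟩ := exists_lam_estimates
  refine ⟨K * K', by positivity, fun ψ C h z hz => ?_⟩
  have a1 := h1 ψ C h z hz
  have a2 := (h2 z hz).1
  have hV := one_le_cuspV hz.1
  have hpi : ‖(2 * Real.pi : ℂ)‖⁻¹ ≤ 1 := by
    refine inv_le_one_of_one_le₀ ?_
    rw [norm_mul, Complex.norm_real, Real.norm_of_nonneg Real.pi_pos.le]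
    simp; linarith [Real.pi_gt_three]
  have hz0 := hz.1
  calc z.im * ‖locB ψ z‖ = z.im * ‖deriv lam z‖ * ‖(2 * Real.pi : ℂ)‖⁻¹
        * ‖sideIntegral ψ (lam z)‖ := by
        rw [locB, norm_mul, norm_div]; ring
    _ ≤ (K' * cuspV z * (1 + ‖lam z‖)) * 1 * ‖sideIntegral ψ (lam z)‖ := by gcongr
    _ = K' * cuspV z * ((1 + ‖lam z‖) * ‖sideIntegral ψ (lam z)‖) := by ring
    _ ≤ K' * cuspV z * (K * C * (1 + Real.log (1 + cuspV z))) := by gcongr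
    _ = _ := by ring

theorem arc_add_mem_fdD {θ t : ℝ} (hθ : θ ∈ Set.Icc 0 Real.pi) (ht : 0 ≤ t)
    (h : 0 < t ∨ θ ∈ Set.Ioo 0 Real.pi) : exp (θ * I) + t * I ∈ fdD := by
  have hs : 0 ≤ Real.sin θ := Real.sin_nonneg_of_nonneg_of_le_pi hθ.1 hθ.2
  have him : (exp (θ * I) + t * I).im = Real.sin θ + t := by
    rw [add_im, exp_ofReal_mul_I_im]; simp
  have hre : (exp (θ * I) + t * I).re = Real.cos θ := by
    rw [add_re, exp_ofReal_mul_I_re]; simp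
  refine ⟨?_, ?_, ?_⟩
  · rw [him]
    rcases h with h | h
    · linarith
    · linarith [Real.sin_pos_of_mem_Ioo h]
  · rw [hre]; exact Real.abs_cos_le_one θ
  · rw [← one_le_sq_iff₀ (norm_nonneg _), ← Complex.normSq_eq_norm_sq, Complex.normSq_apply, hre, him]
    nlinarith [Real.sin_sq_add_cos_sq θ]

theorem hasDerivAt_arc (θ : ℝ) (c : ℂ) :
    HasDerivAt (fun θ : ℝ => exp (θ * I) + c) (I * exp (θ * I)) θ := by
  have h1 : HasDerivAt (fun θ : ℝ => (θ : ℂ) * I) I θ := by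
    simpa using (Complex.ofRealCLM.hasDerivAt (x := θ)).mul_const I
  simpa [mul_comm] using h1.cexp.add_const c

/-- The contour integral along the lower boundary of `D` in terms of the vertical sides. -/
theorem arc_integral_eq {U : Set ℂ} {R : ℂ → ℂ} (hU : IsOpen U) (hDU : fdD ⊆ U)
    (hR : DifferentiableOn ℂ R U) {K : ℝ} (hb : ∀ z ∈ fdD, ‖R z‖ ≤ K / (1 + z.im))
    (hintg : IntegrableOn (fun t : ℝ => R (-1 + t * I) - R (1 + t * I)) (Set.Ioi 0)) :
    ∫ θ in (0 : ℝ)..Real.pi, R (exp (θ * I)) * (I * exp (θ * I)) =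
      -I * ∫ t in Set.Ioi (0 : ℝ), (R (-1 + t * I) - R (1 + t * I)) := by
  have hpi := Real.pi_pos
  have hat : ∀ z ∈ fdD, DifferentiableAt ℂ R z := fun z hz => hR.differentiableAt (hU.mem_nhds (hDU hz))
  have hdat : ∀ z ∈ fdD, ContinuousAt (deriv R) z := fun z hz =>
    ((hR.deriv hU).differentiableAt (hU.mem_nhds (hDU hz))).continuousAt
  set J : ℝ → ℂ := fun t => ∫ θ in (0 : ℝ)..Real.pi, R (exp (θ * I) + t * I) * (I * exp (θ * I)) with hJ
  have hK : 0 ≤ K := by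
    have h1 := hb (exp ((Real.pi / 2 : ℝ) * I) + (0 : ℝ) * I) (arc_add_mem_fdD ⟨by positivity, by linarith⟩
      le_rfl (Or.inr ⟨by positivity, by linarith⟩))
    have h2 : 0 < 1 + (exp ((Real.pi / 2 : ℝ) * I) + (0 : ℝ) * I).im := by
      rw [add_im, exp_ofReal_mul_I_im]; simp
    have h3 := (norm_nonneg _).trans h1
    by_contra! h
    exact absurd h3 (not_le.2 (div_neg_of_neg_of_pos h h2))
  have hcont : ∀ t : ℝ, 0 < t → ContinuousOn
      (fun θ : ℝ => R (exp (θ * I) + t * I) * (I * exp (θ * I))) (Set.Icc 0 Real.pi) := by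
    intro t ht θ hθ
    refine ContinuousAt.continuousWithinAt ?_
    refine ContinuousAt.mul ?_ (by fun_prop)
    exact ContinuousAt.comp (g := R) (hat _ (arc_add_mem_fdD hθ ht.le (Or.inl ht))).continuousAt
      (by fun_prop)
  have hbd : ∀ t θ : ℝ, 0 ≤ t → θ ∈ Set.Icc 0 Real.pi → (0 < t ∨ θ ∈ Set.Ioo 0 Real.pi) →
      ‖R (exp (θ * I) + t * I) * (I * exp (θ * I))‖ ≤ K / (1 + t) := by
    intro t θ ht hθ h
    rw [norm_mul, norm_mul, norm_I, norm_exp_ofReal_mul_I, mul_one, mul_one]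
    refine (hb _ (arc_add_mem_fdD hθ ht h)).trans ?_
    rw [add_im, exp_ofReal_mul_I_im]
    have := Real.sin_nonneg_of_nonneg_of_le_pi hθ.1 hθ.2
    simp only [mul_im, ofReal_re, I_im, mul_one, ofReal_im, I_re, mul_zero, add_zero]
    gcongr
    linarith
  have hcwa : ContinuousWithinAt J (Set.Ici 0) 0 := by
    refine intervalIntegral.continuousWithinAt_of_dominated_interval (bound := fun _ => K) ?_ ?_
      intervalIntegrable_const ?_
    · filter_upwards [self_mem_nhdsWithin] with t ht
      rw [Set.uIoc_of_le hpi.le, ← MeasureTheory.Measure.restrict_congr_set Ioo_ae_eq_Ioc]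
      refine ContinuousOn.aestronglyMeasurable (fun θ hθ => ?_) measurableSet_Ioo
      refine ContinuousAt.continuousWithinAt (ContinuousAt.mul ?_ (by fun_prop))
      exact ContinuousAt.comp (g := R) (hat _ (arc_add_mem_fdD ⟨hθ.1.le, hθ.2.le⟩ ht
        (Or.inr hθ))).continuousAt (by fun_prop)
    · filter_upwards [self_mem_nhdsWithin] with t ht
      have : ∀ᵐ θ : ℝ, θ ≠ Real.pi := by simp [ae_iff]
      filter_upwards [this] with θ h1 h2
      rw [Set.uIoc_of_le hpi.le] at h2
      refine (hbd t θ ht ⟨h2.1.le, h2.2⟩ (Or.inr ⟨h2.1, lt_of_le_of_ne h2.2 h1⟩)).trans ?_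
      have ht : 0 ≤ t := ht
      exact div_le_self hK (by linarith)
    · have : ∀ᵐ θ : ℝ, θ ≠ Real.pi := by simp [ae_iff]
      filter_upwards [this] with θ h1 h2
      rw [Set.uIoc_of_le hpi.le] at h2
      refine ContinuousAt.continuousWithinAt (ContinuousAt.mul ?_ (by fun_prop))
      exact ContinuousAt.comp (g := R) (hat _ (arc_add_mem_fdD ⟨h2.1.le, h2.2⟩ le_rfl
        (Or.inr ⟨h2.1, lt_of_le_of_ne h2.2 h1⟩))).continuousAt (by fun_prop)
  have hderiv : ∀ t ∈ Set.Ioi (0 : ℝ),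
      HasDerivAt J (I * (R (-1 + t * I) - R (1 + t * I))) t := by
    intro t ht
    have ht : 0 < t := ht
    obtain ⟨M, hM⟩ := (isCompact_Icc.prod isCompact_Icc :
      IsCompact (Set.Icc 0 Real.pi ×ˢ Set.Icc (t / 2) (2 * t))).exists_bound_of_continuousOn
      (f := fun p : ℝ × ℝ => deriv R (exp (p.1 * I) + p.2 * I)) (by
        rintro ⟨θ, s⟩ ⟨hθ, hs⟩
        simp only [Set.mem_Icc] at hθ hs
        refine ContinuousAt.continuousWithinAt ?_
        exact ContinuousAt.comp (g := deriv R) (hdat _ (arc_add_mem_fdD hθ (by linarith)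
          (Or.inl (by linarith)))) (by fun_prop))
    have hs : Set.Ioo (t / 2) (2 * t) ∈ 𝓝 t := Ioo_mem_nhds (by linarith) (by linarith)
    have key := (intervalIntegral.hasDerivAt_integral_of_dominated_loc_of_deriv_le
      (F := fun (s : ℝ) (θ : ℝ) => R (exp (θ * I) + s * I) * (I * exp (θ * I)))
      (F' := fun (s : ℝ) (θ : ℝ) => deriv R (exp (θ * I) + s * I) * I * (I * exp (θ * I)))
      (a := 0) (b := Real.pi) (μ := volume) (bound := fun _ => M) hs ?_ ?_ ?_ ?_ ?_ ?_).2
    · refine key.congr_deriv ?_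
      have h1 := intervalIntegral.integral_eq_sub_of_hasDerivAt (a := 0) (b := Real.pi)
        (f := fun θ : ℝ => R (exp (θ * I) + t * I))
        (f' := fun θ : ℝ => deriv R (exp (θ * I) + t * I) * (I * exp (θ * I))) (fun θ hθ => by
          rw [Set.uIcc_of_le hpi.le] at hθ
          exact HasDerivAt.comp (h₂ := R) θ
            (hat _ (arc_add_mem_fdD hθ ht.le (Or.inl ht))).hasDerivAt (hasDerivAt_arc θ (t * I)))
          (ContinuousOn.intervalIntegrable (by
            rw [Set.uIcc_of_le hpi.le]
            intro θ hθ
            refine ContinuousAt.continuousWithinAt (ContinuousAt.mul ?_ (by fun_prop))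
            exact ContinuousAt.comp (g := deriv R) (hdat _ (arc_add_mem_fdD hθ ht.le
              (Or.inl ht))) (by fun_prop)))
      have h2 : ∫ θ in (0 : ℝ)..Real.pi, deriv R (exp (θ * I) + t * I) * I * (I * exp (θ * I)) =
          I * ∫ θ in (0 : ℝ)..Real.pi, deriv R (exp (θ * I) + t * I) * (I * exp (θ * I)) := by
        rw [← intervalIntegral.integral_const_mul]
        congr 1; ext θ; ring
      rw [h2, h1]
      simp [Complex.exp_pi_mul_I]
    · filter_upwards [Ioi_mem_nhds ht] with s hs
      rw [Set.uIoc_of_le hpi.le]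
      exact ((hcont s hs).mono Set.Ioc_subset_Icc_self).aestronglyMeasurable measurableSet_Ioc
    · exact ContinuousOn.intervalIntegrable (by rw [Set.uIcc_of_le hpi.le]; exact hcont t ht)
    · rw [Set.uIoc_of_le hpi.le]
      refine ContinuousOn.aestronglyMeasurable (fun θ hθ => ?_) measurableSet_Ioc
      refine ContinuousAt.continuousWithinAt (ContinuousAt.mul (ContinuousAt.mul ?_ (by fun_prop))
        (by fun_prop))
      exact ContinuousAt.comp (g := deriv R) (hdat _ (arc_add_mem_fdD ⟨hθ.1.le, hθ.2⟩ ht.le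
        (Or.inl ht))) (by fun_prop)
    · refine Eventually.of_forall fun θ hθ s hs => ?_
      rw [Set.uIoc_of_le hpi.le] at hθ
      rw [norm_mul, norm_mul, norm_mul, norm_I, norm_exp_ofReal_mul_I, mul_one, mul_one, mul_one]
      exact hM (θ, s) ⟨⟨hθ.1.le, hθ.2⟩, ⟨hs.1.le, hs.2.le⟩⟩
    · exact intervalIntegrable_const
    · refine Eventually.of_forall fun θ hθ s hs => ?_
      rw [Set.uIoc_of_le hpi.le] at hθ
      have hs0 : 0 < s := by linarith [hs.1]
      refine HasDerivAt.mul_const ?_ _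
      have h1 : HasDerivAt (fun s : ℝ => exp (θ * I) + (s : ℂ) * I) I s := by
        simpa using ((Complex.ofRealCLM.hasDerivAt (x := s)).mul_const I).const_add (exp (θ * I))
      exact HasDerivAt.comp (h₂ := R) s (hat _ (arc_add_mem_fdD ⟨hθ.1.le, hθ.2⟩ hs0.le
        (Or.inl hs0))).hasDerivAt h1
  have hlim : Tendsto J atTop (𝓝 0) := by
    have h1 : ∀ᶠ t : ℝ in atTop, ‖J t‖ ≤ K / (1 + t) * |Real.pi - 0| := by
      filter_upwards [eventually_gt_atTop 0] with t ht
      refine intervalIntegral.norm_integral_le_of_norm_le_const fun θ hθ => ?_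
      rw [Set.uIoc_of_le hpi.le] at hθ
      exact hbd t θ ht.le ⟨hθ.1.le, hθ.2⟩ (Or.inl ht)
    refine squeeze_zero_norm' h1 ?_
    have h2 : Tendsto (fun t : ℝ => K / (1 + t)) atTop (𝓝 0) :=
      tendsto_const_nhds.div_atTop (tendsto_atTop_add_const_left _ _ tendsto_id)
    simpa using h2.mul_const |Real.pi - 0|
  have hfin := integral_Ioi_of_hasDerivAt_of_tendsto hcwa hderiv (hintg.const_mul I) hlim
  rw [integral_const_mul] at hfin
  have h0 : J 0 = ∫ θ in (0 : ℝ)..Real.pi, R (exp (θ * I)) * (I * exp (θ * I)) := by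
    simp [hJ]
  rw [← h0]
  linear_combination hfin

/-- Removal of the pole of `φ λ'(τ) / (λ - λ(τ))` at `τ`. -/
theorem exists_regular_quotient {φ : ℂ → ℂ} (hφ : ∀ z : ℂ, 0 < z.im → DifferentiableAt ℂ φ z)
    {τ : ℂ} (hτ : 0 < τ.im) (hinj : ∀ z ∈ fdD, lam z = lam τ → z = τ) (hd : deriv lam τ ≠ 0) :
    ∃ (U : Set ℂ) (R : ℂ → ℂ), IsOpen U ∧ fdD ⊆ U ∧ DifferentiableOn ℂ R U ∧
      ∀ z ∈ fdD, z ≠ τ → R z = φ z * deriv lam τ / (lam z - lam τ) - φ τ / (z - τ) := by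
  set d := dslope lam τ with hdef
  have hτ' : τ ∈ uhp := hτ
  have hdd : DifferentiableOn ℂ d uhp := (Complex.differentiableOn_dslope
    (isOpen_uhp.mem_nhds hτ')).2 fun z hz => (differentiableAt_lam hz).differentiableWithinAt
  have hdτ : d τ = deriv lam τ := dslope_same _ _
  have hdne : ∀ z, z ≠ τ → d z = (lam z - lam τ) / (z - τ) := fun z hz => by
    rw [hdef, dslope_of_ne _ hz, slope_def_field]
  set U := uhp ∩ d ⁻¹' {0}ᶜ with hU
  have hUo : IsOpen U := hdd.continuousOn.isOpen_inter_preimage isOpen_uhp isOpen_compl_singleton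
  have hτU : τ ∈ U := ⟨hτ', by simpa [hdτ] using hd⟩
  set k := fun z => φ z * deriv lam τ / d z with hk
  have hkd : DifferentiableOn ℂ k U := by
    intro z hz
    refine ((((hφ z hz.1).mul_const _).differentiableWithinAt).div ?_ hz.2)
    exact (hdd z hz.1).mono Set.inter_subset_left
  have hkτ : k τ = φ τ := by rw [hk]; simp only [hdτ]; field_simp
  refine ⟨U, dslope k τ, hUo, fun z hz => ⟨hz.1, ?_⟩,
    (Complex.differentiableOn_dslope (hUo.mem_nhds hτU)).2 hkd, fun z hz hne => ?_⟩
  · rcases eq_or_ne z τ with rfl | hne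
    · exact hτU.2
    · have h1 : lam z - lam τ ≠ 0 := sub_ne_zero.2 fun h => hne (hinj z hz h)
      simpa [hdne z hne, h1] using sub_ne_zero.2 hne
  · have h1 : lam z - lam τ ≠ 0 := sub_ne_zero.2 fun h => hne (hinj z hz h)
    have h2 : z - τ ≠ 0 := sub_ne_zero.2 hne
    rw [dslope_of_ne _ hne, slope_def_field, hkτ, hk]
    simp only [hdne z hne]
    field_simp

theorem isCompact_fdD_inter (ε Y : ℝ) (hε : 0 < ε) : IsCompact (fdD ∩ {z | ε ≤ z.im ∧ z.im ≤ Y}) := by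
  have : fdD ∩ {z | ε ≤ z.im ∧ z.im ≤ Y} = {z : ℂ | |z.re| ≤ 1} ∩ {z | 1 ≤ ‖z‖} ∩ {z | ε ≤ z.im} ∩
      {z | z.im ≤ Y} := by
    ext z
    simp only [fdD, Set.mem_inter_iff, Set.mem_ofPred_eq]
    constructor
    · rintro ⟨⟨_, h1, h2⟩, h3, h4⟩; exact ⟨⟨⟨h1, h2⟩, h3⟩, h4⟩
    · rintro ⟨⟨⟨h1, h2⟩, h3⟩, h4⟩; exact ⟨⟨hε.trans_le h3, h1, h2⟩, h3, h4⟩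
  have hcl : IsClosed (fdD ∩ {z | ε ≤ z.im ∧ z.im ≤ Y}) := by
    rw [this]
    exact (((isClosed_le (by fun_prop) (by fun_prop)).inter
      (isClosed_le (by fun_prop) (by fun_prop))).inter
      (isClosed_le (by fun_prop) Complex.continuous_im)).inter
      (isClosed_le Complex.continuous_im (by fun_prop))
  refine Metric.isCompact_of_isClosed_isBounded hcl
    (isBounded_iff_forall_norm_le.2 ⟨1 + |Y|, fun z hz => ?_⟩)
  refine (Complex.norm_le_abs_re_add_abs_im z).trans ?_
  have h1 := hz.1.2.1
  have h2 : |z.im| ≤ |Y| := by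
    rw [abs_of_pos hz.1.1]; exact hz.2.2.trans (le_abs_self _)
  linarith

theorem exists_inv_le_norm_lam_sub (L : ℂ) : ∃ ε : ℝ, 0 < ε ∧ ε ≤ 1 ∧ ∀ z ∈ fdD, z.im ≤ ε →
    1 / z.im ≤ ‖lam z - L‖ := by
  obtain ⟨c, C, hc, hC, hb⟩ := exists_norm_lam_bounds
  refine ⟨1 / (2 * C * (2 + ‖L‖) + 1), by positivity, ?_, fun z hz hzi => ?_⟩
  · rw [div_le_one (by positivity)]
    have : 0 ≤ 2 * C * (2 + ‖L‖) := by positivity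
    linarith
  have hz0 := hz.1
  set u := 1 / z.im with hu
  have hu1 : 2 * C * (2 + ‖L‖) + 1 ≤ u := by
    rw [hu, le_one_div (by positivity) hz0]; exact hzi
  have hu0 : 1 ≤ u := by
    have : 0 ≤ 2 * C * (2 + ‖L‖) := by positivity
    linarith
  have hz1 : z.im ≤ 1 := by
    rw [hu, le_div_iff₀ hz0] at hu0; linarith
  obtain ⟨s, w, hs, hw, hwi, hwr, -⟩ := exists_cusp_coord_of_mem_fdD hz hz1
  have hlz : lam z = 1 - 1 / lam w := by
    have hw0 : 0 < w.im := lt_of_lt_of_le (by positivity) hwi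
    rw [← lam_one_sub_inv hw0, ← hw]
    rcases hs with ⟨rfl, -⟩ | ⟨rfl, -⟩
    · simp
    · rw [lam_add_two]
  have hwu : u / 2 ≤ w.im := by
    refine le_trans (le_of_eq ?_) hwi
    rw [hu]; field_simp
  have hw0 : 0 < w.im := by linarith
  have h1 := (hb w (by linarith)).2
  have h2 : Real.exp (-Real.pi * w.im) ≤ 2 * (1 / u ^ 2) := by
    have h3 : u ^ 2 / 2 ≤ Real.exp (Real.pi * w.im) := by
      have h4 : u ≤ Real.pi * w.im := by nlinarith [Real.pi_gt_three]
      have h5 := Real.quadratic_le_exp_of_nonneg (show 0 ≤ u by linarith)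
      have h6 := Real.exp_le_exp.2 h4
      nlinarith
    rw [show -Real.pi * w.im = -(Real.pi * w.im) by ring, Real.exp_neg]
    calc (Real.exp (Real.pi * w.im))⁻¹ ≤ (u ^ 2 / 2)⁻¹ := by gcongr
      _ = _ := by field_simp
  have h3 : ‖lam w‖ * u ^ 2 ≤ 2 * C := by
    have : ‖lam w‖ ≤ C * (2 * (1 / u ^ 2)) := h1.trans (by gcongr)
    calc ‖lam w‖ * u ^ 2 ≤ C * (2 * (1 / u ^ 2)) * u ^ 2 := by gcongr
      _ = 2 * C := by field_simp
  have h4 : ‖1 / lam w‖ ≤ ‖lam z - L‖ + (1 + ‖L‖) := by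
    have : 1 / lam w = -(lam z - L) + (1 - L) := by rw [hlz]; ring
    rw [this]
    refine (norm_add_le _ _).trans ?_
    rw [norm_neg]
    have := norm_sub_le (1 : ℂ) L
    rw [norm_one] at this
    linarith
  have h5 : u * (2 + ‖L‖) ≤ ‖1 / lam w‖ := by
    have h6 : 0 < ‖lam w‖ := norm_pos_iff.2 (lam_ne_zero hw0)
    rw [norm_div, norm_one, le_div_iff₀ h6]
    have h7 : 2 * C * (2 + ‖L‖) ≤ u := by linarith
    have h8 : ‖lam w‖ * u ^ 2 * (2 + ‖L‖) ≤ u :=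
      (mul_le_mul_of_nonneg_right h3 (by positivity)).trans h7
    have h9 : u * (u * (2 + ‖L‖) * ‖lam w‖) ≤ u * 1 := by linarith
    exact le_of_mul_le_mul_left h9 (by linarith)
  nlinarith [norm_nonneg L]

theorem exists_bound_of_regular_quotient {φ : ℂ → ℂ} {C : ℝ} (hφ : IsBloch φ C) {τ : ℂ}
    (hτ : 0 < τ.im) {U : Set ℂ} {R : ℂ → ℂ} (hDU : fdD ⊆ U) (hR : ContinuousOn R U)
    (heq : ∀ z ∈ fdD, z ≠ τ → R z = φ z * deriv lam τ / (lam z - lam τ) - φ τ / (z - τ)) :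
    ∃ K, ∀ z ∈ fdD, ‖R z‖ ≤ K / (1 + z.im) := by
  obtain ⟨ε₀, hε₀, hε₁, hsmall⟩ := exists_inv_le_norm_lam_sub (lam τ)
  obtain ⟨c, A, hc, hA, hb⟩ := exists_norm_lam_bounds
  have hC := hφ.nonneg
  set ε := min ε₀ (τ.im / 2) with hε
  have hεpos : 0 < ε := lt_min hε₀ (by linarith)
  have hL : 0 < ‖lam τ‖ := norm_pos_iff.2 (lam_ne_zero hτ)
  set Y := max (2 * τ.im + 1) (2 * A / ‖lam τ‖) with hY
  obtain ⟨M, hM⟩ := (isCompact_fdD_inter ε Y hεpos).exists_bound_of_continuousOn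
    (f := R) (hR.mono fun z hz => hDU hz.1)
  have hY1 : 2 * τ.im + 1 ≤ Y := le_max_left _ _
  set D := ‖deriv lam τ‖ with hDdef
  have hden : ∀ z : ℂ, |z.im - τ.im| ≤ ‖z - τ‖ := fun z => by
    simpa using Complex.abs_im_le_norm (z - τ)
  have hgen : ∀ z ∈ fdD, z ≠ τ → ‖R z‖ ≤ C / z.im * D / ‖lam z - lam τ‖ + ‖φ τ‖ / ‖z - τ‖ := by
    intro z hz hne
    rw [heq z hz hne]
    refine (norm_sub_le _ _).trans ?_
    rw [norm_div, norm_div, norm_mul]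
    gcongr
    exact hφ.bound z hz.1
  refine ⟨max (M * (1 + Y)) (max ((C * D + ‖φ τ‖ / (τ.im / 2)) * 2)
    ((C * D / (‖lam τ‖ / 2) + ‖φ τ‖ * 2) * 2)), fun z hz => ?_⟩
  have hz0 := hz.1
  rw [le_div_iff₀ (by linarith)]
  rcases lt_or_ge z.im ε with h1 | h1
  · have hz1 : z.im < ε₀ := h1.trans_le (min_le_left _ _)
    have hz2 : z.im < τ.im / 2 := h1.trans_le (min_le_right _ _)
    have hne : z ≠ τ := by rintro rfl; linarith
    refine le_trans ?_ ((le_max_left _ _).trans (le_max_right _ _))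
    have h2 := hsmall z hz hz1.le
    have h3 : 1 ≤ z.im * ‖lam z - lam τ‖ := by
      rw [div_le_iff₀ hz0] at h2; linarith
    have h4 : C / z.im * D / ‖lam z - lam τ‖ ≤ C * D := by
      rw [div_mul_eq_mul_div, div_div]
      exact div_le_self (by positivity) h3
    have h5 : ‖φ τ‖ / ‖z - τ‖ ≤ ‖φ τ‖ / (τ.im / 2) := by
      gcongr
      refine le_trans ?_ (hden z)
      rw [abs_sub_comm]
      refine le_trans ?_ (le_abs_self _)
      linarith
    have h6 := (hgen z hz hne).trans (add_le_add h4 h5)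
    exact mul_le_mul h6 (by linarith) (by linarith) ((norm_nonneg _).trans h6)
  rcases le_or_gt z.im Y with h2 | h2
  · refine le_trans ?_ (le_max_left _ _)
    have h3 := hM z ⟨hz, h1, h2⟩
    exact mul_le_mul h3 (by linarith) (by linarith) ((norm_nonneg _).trans h3)
  · refine le_trans ?_ ((le_max_right _ _).trans (le_max_right _ _))
    have hzY : 2 * τ.im + 1 < z.im := hY1.trans_lt h2
    have hne : z ≠ τ := by rintro rfl; linarith
    have hz2 : 2 * A / ‖lam τ‖ < z.im := (le_max_right _ _).trans_lt h2
    have h3 : ‖lam z‖ ≤ ‖lam τ‖ / 2 := by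
      refine (hb z (by linarith)).2.trans ?_
      have h4 : Real.exp (-Real.pi * z.im) ≤ 1 / z.im := by
        rw [show -Real.pi * z.im = -(Real.pi * z.im) by ring, Real.exp_neg, ← one_div]
        gcongr
        have := Real.add_one_le_exp (Real.pi * z.im)
        nlinarith [Real.pi_gt_three]
      calc A * Real.exp (-Real.pi * z.im) ≤ A * (1 / z.im) := by gcongr
        _ ≤ _ := by
          rw [div_lt_iff₀ hL] at hz2
          rw [mul_one_div, div_le_iff₀ hz0]
          linarith
    have h4 : ‖lam τ‖ / 2 ≤ ‖lam z - lam τ‖ := by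
      have := norm_sub_norm_le (lam τ) (lam z)
      rw [norm_sub_rev] at this
      linarith
    have h5 : z.im / 2 ≤ ‖z - τ‖ := by
      refine le_trans ?_ (hden z)
      refine le_trans ?_ (le_abs_self _)
      linarith
    have h6 : C / z.im * D / ‖lam z - lam τ‖ ≤ C / z.im * D / (‖lam τ‖ / 2) := by gcongr
    have h7 : ‖φ τ‖ / ‖z - τ‖ ≤ ‖φ τ‖ / (z.im / 2) := by gcongr
    have h8 := (hgen z hz hne).trans (add_le_add h6 h7)
    have h9 : C / z.im * D / (‖lam τ‖ / 2) + ‖φ τ‖ / (z.im / 2) =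
        (C * D / (‖lam τ‖ / 2) + ‖φ τ‖ * 2) / z.im := by field_simp
    rw [h9] at h8
    calc ‖R z‖ * (1 + z.im) ≤ (C * D / (‖lam τ‖ / 2) + ‖φ τ‖ * 2) / z.im * (2 * z.im) := by
          gcongr
          linarith
      _ = _ := by field_simp

theorem integral_shifted_poisson {c : ℝ} (hc : 0 < c) (b : ℝ) :
    IntegrableOn (fun t : ℝ => 2 * c / (c ^ 2 + (t - b) ^ 2)) (Set.Ioi 0) ∧
      ∫ t in Set.Ioi (0 : ℝ), 2 * c / (c ^ 2 + (t - b) ^ 2) = Real.pi + 2 * Real.arctan (b / c) := by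
  have hd : ∀ t ∈ Set.Ici (0 : ℝ), HasDerivAt (fun t : ℝ => 2 * Real.arctan ((t - b) / c))
      (2 * c / (c ^ 2 + (t - b) ^ 2)) t := by
    intro t _
    have h1 := ((((hasDerivAt_id t).sub_const b).div_const c).arctan).const_mul 2
    refine h1.congr_deriv ?_
    simp only [id]
    have : 0 < c ^ 2 + (t - b) ^ 2 := by positivity
    field_simp
  have hl : Tendsto (fun t : ℝ => 2 * Real.arctan ((t - b) / c)) atTop (𝓝 (2 * (Real.pi / 2))) := by
    have h1 : Tendsto (fun t : ℝ => (t - b) / c) atTop atTop :=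
      (tendsto_atTop_add_const_right _ _ tendsto_id).atTop_div_const hc
    exact ((Real.tendsto_arctan_atTop.mono_right nhdsWithin_le_nhds).comp h1).const_mul 2
  have hp : ∀ t ∈ Set.Ioi (0 : ℝ), 0 ≤ 2 * c / (c ^ 2 + (t - b) ^ 2) := fun t _ => by positivity
  refine ⟨integrableOn_Ioi_deriv_of_nonneg' hd hp hl, ?_⟩
  rw [integral_Ioi_of_hasDerivAt_of_nonneg' hd hp hl]
  rw [zero_sub, neg_div, Real.arctan_neg]; ring

/-- The sum of the four pole contributions on the sides of `D`. -/
def sidePoles (τ : ℂ) (t : ℝ) : ℂ :=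
  (1 / (-1 + t * I - τ) + 1 / (-1 + t * I - -1 / τ)) - (1 / (1 + t * I - τ) + 1 / (1 + t * I - -1 / τ))

theorem inv_add_inv_conj {c : ℝ} (hc : 0 < c) (s : ℝ) :
    1 / (-(c : ℂ) + s * I) - 1 / (c + s * I) = -((2 * c / (c ^ 2 + s ^ 2) : ℝ) : ℂ) := by
  have h1 : -(c : ℂ) + s * I ≠ 0 := fun h => by
    have := congrArg Complex.re h
    simp at this; exact hc.ne' this
  have h2 : (c : ℂ) + s * I ≠ 0 := fun h => by
    have := congrArg Complex.re h
    simp at this; exact hc.ne' this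
  have h3 : ((c : ℂ) ^ 2 + (s : ℂ) ^ 2) ≠ 0 := by
    have : (c ^ 2 + s ^ 2 : ℝ) ≠ 0 := by positivity
    exact_mod_cast this
  push_cast
  rw [div_sub_div _ _ h1 h2, ← neg_div, div_eq_div_iff (mul_ne_zero h1 h2) h3]
  linear_combination (2 * (c : ℂ) * s ^ 2) * I_sq

theorem neg_one_div_eq_of_norm_eq_one {τ : ℂ} (h : ‖τ‖ = 1) : -1 / τ = -(starRingEnd ℂ) τ := by
  have h0 : τ ≠ 0 := norm_ne_zero_iff.1 (by rw [h]; exact one_ne_zero)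
  rw [div_eq_iff h0, neg_mul, mul_comm, Complex.mul_conj, Complex.normSq_eq_norm_sq, h]
  simp

theorem abs_re_lt_one {τ : ℂ} (h : ‖τ‖ = 1) (hτ : 0 < τ.im) : |τ.re| < 1 := by
  rw [abs_lt]
  have : τ.re * τ.re + τ.im * τ.im = 1 := by
    rw [← Complex.normSq_apply, Complex.normSq_eq_norm_sq, h]; norm_num
  constructor <;> nlinarith

theorem integral_sidePoles {τ : ℂ} (h : ‖τ‖ = 1) (hτ : 0 < τ.im) :
    IntegrableOn (sidePoles τ) (Set.Ioi 0) ∧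
      ∫ t in Set.Ioi (0 : ℝ), sidePoles τ t = -(3 * Real.pi) := by
  obtain ⟨ha1, ha2⟩ := abs_lt.1 (abs_re_lt_one h hτ)
  have hsq : τ.re * τ.re + τ.im * τ.im = 1 := by
    rw [← Complex.normSq_apply, Complex.normSq_eq_norm_sq, h]; norm_num
  have hs : ∀ t : ℝ, sidePoles τ t = ((-(2 * (1 + τ.re) / ((1 + τ.re) ^ 2 + (t - τ.im) ^ 2) +
      2 * (1 - τ.re) / ((1 - τ.re) ^ 2 + (t - τ.im) ^ 2)) : ℝ) : ℂ) := by
    intro t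
    have e1 := inv_add_inv_conj (show 0 < 1 + τ.re by linarith) (t - τ.im)
    have e2 := inv_add_inv_conj (show 0 < 1 - τ.re by linarith) (t - τ.im)
    rw [sidePoles, neg_one_div_eq_of_norm_eq_one h, ofReal_neg, ofReal_add, neg_add, ← e1, ← e2]
    have hc : (starRingEnd ℂ) τ = τ.re - τ.im * I := by
      apply Complex.ext <;> simp
    have hc' : τ = τ.re + τ.im * I := (Complex.re_add_im τ).symm
    have f1 : -1 + t * I - τ = -((1 + τ.re : ℝ) : ℂ) + (t - τ.im : ℝ) * I := by
      conv_lhs => rw [hc']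
      push_cast; ring
    have f2 : -1 + t * I - -(starRingEnd ℂ) τ = -((1 - τ.re : ℝ) : ℂ) + (t - τ.im : ℝ) * I := by
      rw [hc]; push_cast; ring
    have f3 : 1 + t * I - τ = ((1 - τ.re : ℝ) : ℂ) + (t - τ.im : ℝ) * I := by
      conv_lhs => rw [hc']
      push_cast; ring
    have f4 : 1 + t * I - -(starRingEnd ℂ) τ = ((1 + τ.re : ℝ) : ℂ) + (t - τ.im : ℝ) * I := by
      rw [hc]; push_cast; ring
    rw [f1, f2, f3, f4]; ring
  obtain ⟨i1, v1⟩ := integral_shifted_poisson (show 0 < 1 + τ.re by linarith) τ.im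
  obtain ⟨i2, v2⟩ := integral_shifted_poisson (show 0 < 1 - τ.re by linarith) τ.im
  have hfun : sidePoles τ = fun t => ((-(2 * (1 + τ.re) / ((1 + τ.re) ^ 2 + (t - τ.im) ^ 2) +
      2 * (1 - τ.re) / ((1 - τ.re) ^ 2 + (t - τ.im) ^ 2)) : ℝ) : ℂ) := funext hs
  rw [hfun]
  refine ⟨(i1.add i2).neg.ofReal, ?_⟩
  rw [integral_complex_ofReal, integral_neg, integral_add i1 i2, v1, v2]
  have hinv : τ.im / (1 - τ.re) = (τ.im / (1 + τ.re))⁻¹ := by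
    rw [inv_div, div_eq_div_iff (by linarith) hτ.ne']; nlinarith
  rw [hinv, Real.arctan_inv_of_pos (div_pos hτ (by linarith))]
  push_cast; ring

theorem deriv_lam_neg_one_div {τ : ℂ} (hτ : 0 < τ.im) :
    deriv lam (-1 / τ) = -τ ^ 2 * deriv lam τ := by
  have h0 := ne_zero_of_im_pos hτ
  have h1 : HasDerivAt (fun z : ℂ => -1 / z) (1 / τ ^ 2) τ := by
    have := ((hasDerivAt_inv h0).const_mul (-1))
    simpa [div_eq_mul_inv] using! this
  have h2 := HasDerivAt.comp (h₂ := lam) τ (differentiableAt_lam (im_neg_one_div hτ)).hasDerivAt h1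
  have h3 : HasDerivAt (lam ∘ fun z : ℂ => -1 / z) (-deriv lam τ) τ := by
    refine ((differentiableAt_lam hτ).hasDerivAt.const_sub 1).congr_of_eventuallyEq ?_
    filter_upwards [isOpen_uhp.mem_nhds (show τ ∈ uhp from hτ)] with z hz
    exact lam_S hz
  have h4 := h2.unique h3
  generalize deriv lam (-1 / τ) = D at h4 ⊢
  field_simp at h4
  linear_combination h4

theorem slashS_locB (ψ : ℂ → ℂ) {τ : ℂ} (hτ : 0 < τ.im) :
    slashS (locB ψ) τ = -(deriv lam τ / (2 * Real.pi) * sideIntegral ψ (1 - lam τ)) := by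
  have h0 := ne_zero_of_im_pos hτ
  rw [slashS, locB, deriv_lam_neg_one_div hτ, lam_S hτ]
  field_simp

theorem side_diff_eq (φ : ℂ → ℂ) (τ : ℂ) (t : ℝ) :
    (φ (-1 + t * I) * deriv lam τ / (lam (-1 + t * I) - lam τ)) -
      (φ (1 + t * I) * deriv lam τ / (lam (1 + t * I) - lam τ)) =
      deriv lam τ * (sideDiff φ t / (lam (1 + t * I) - 1 + (1 - lam τ))) := by
  rw [lam_neg_one_add, sideDiff]; ring

/-- The key identity at points of the lower arc where `λ` is injective. -/
theorem locB_identity_of_injective {φ : ℂ → ℂ} {C : ℝ} (hφ : IsBloch φ C) {τ : ℂ} (h : ‖τ‖ = 1)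
    (hτ : 0 < τ.im)
    (hinj : ∀ z ∈ fdD, lam z = lam τ → z = τ) (hd : deriv lam τ ≠ 0)
    (hinj' : ∀ z ∈ fdD, lam z = lam (-1 / τ) → z = -1 / τ) :
    locB (slashS φ) τ + slashS (locB φ) τ = φ τ := by
  have hpi := Real.pi_pos
  have h0 := ne_zero_of_im_pos hτ
  have hτ' := im_neg_one_div hτ
  have hd' : deriv lam (-1 / τ) ≠ 0 := by
    rw [deriv_lam_neg_one_div hτ]; exact mul_ne_zero (neg_ne_zero.2 (pow_ne_zero 2 h0)) hd
  obtain ⟨U, R, hU, hDU, hR, hReq⟩ := exists_regular_quotient hφ.diff hτ hinj hd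
  obtain ⟨U', R', hU', hDU', hR', hReq'⟩ := exists_regular_quotient hφ.slashS.diff hτ' hinj' hd'
  obtain ⟨K, hK⟩ := exists_bound_of_regular_quotient hφ hτ hDU hR.continuousOn hReq
  obtain ⟨K', hK'⟩ := exists_bound_of_regular_quotient hφ.slashS hτ' hDU' hR'.continuousOn hReq'
  have habs := abs_re_lt_one h hτ
  have hre' : (-1 / τ).re = -τ.re := by rw [neg_one_div_eq_of_norm_eq_one h]; simp
  have hside : ∀ t : ℝ, 0 < t → (1 + t * I : ℂ) ∈ fdD ∧ (-1 + t * I : ℂ) ∈ fdD := by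
    intro t ht
    have h1 := arc_add_mem_fdD (θ := 0) (t := t) ⟨le_rfl, hpi.le⟩ ht.le (Or.inl ht)
    have h2 := arc_add_mem_fdD (θ := Real.pi) (t := t) ⟨hpi.le, le_rfl⟩ ht.le (Or.inl ht)
    rw [Complex.exp_pi_mul_I] at h2
    simp only [ofReal_zero, zero_mul, Complex.exp_zero] at h1
    exact ⟨h1, h2⟩
  have hne : ∀ t : ℝ, ∀ σ : ℂ, |σ.re| < 1 → (1 + t * I : ℂ) ≠ σ ∧ (-1 + t * I : ℂ) ≠ σ := by
    intro t σ hσ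
    constructor <;> rintro rfl <;> simp at hσ
  set L := deriv lam τ with hL
  set P : ℝ → ℂ := fun t => L * (sideDiff φ t / (lam (1 + t * I) - 1 + (1 - lam τ))) with hP
  set P' : ℝ → ℂ := fun t => L * (sideDiff (slashS φ) t / (lam (1 + t * I) - 1 + lam τ)) with hP'
  have hlamre := lam_re_of_norm_eq_one hτ h
  have iP : IntegrableOn P (Set.Ioi 0) := (integrableOn_sideIntegrand hφ (by simp [hlamre])).const_mul L
  have iP' : IntegrableOn P' (Set.Ioi 0) :=
    (integrableOn_sideIntegrand hφ.slashS (by rw [hlamre]; norm_num)).const_mul L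
  obtain ⟨iS, vS⟩ := integral_sidePoles h hτ
  set Q : ℂ → ℂ := fun z => R z + R' z / τ ^ 2 with hQ
  have hQside : ∀ t ∈ Set.Ioi (0 : ℝ), Q (-1 + t * I) - Q (1 + t * I) =
      P t - P' t - φ τ * sidePoles τ t := by
    intro t ht
    obtain ⟨m1, m2⟩ := hside t ht
    obtain ⟨n1, n2⟩ := hne t τ habs
    obtain ⟨n1', n2'⟩ := hne t (-1 / τ) (by rw [hre', abs_neg]; exact habs)
    have e1 := side_diff_eq φ τ t
    have e2 := side_diff_eq (slashS φ) (-1 / τ) t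
    rw [deriv_lam_neg_one_div hτ, lam_S hτ, sub_sub_cancel] at e2
    have e3 : slashS φ (-1 / τ) = τ ^ 2 * φ τ := by
      rw [slashS, neg_one_div_neg_one_div h0]; field_simp
    simp only [hQ]
    rw [hReq _ m2 n2, hReq _ m1 n1, hReq' _ m2 n2', hReq' _ m1 n1', e3, deriv_lam_neg_one_div hτ,
      lam_S hτ, sidePoles]
    simp only [hP, hP']
    rw [← e1]
    have e4 : L * (sideDiff (slashS φ) t / (lam (1 + t * I) - 1 + lam τ)) =
      -(τ ^ 2)⁻¹ * (-τ ^ 2 * L * (sideDiff (slashS φ) t / (lam (1 + t * I) - 1 + lam τ))) := by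
      field_simp
    rw [e4, ← e2]
    have h02 : τ ^ 2 ≠ 0 := pow_ne_zero 2 h0
    have e5 : τ ^ 2 * φ τ / (-1 + t * I - -1 / τ) = τ ^ 2 * (φ τ / (-1 + t * I - -1 / τ)) := by ring
    have e6 : τ ^ 2 * φ τ / (1 + t * I - -1 / τ) = τ ^ 2 * (φ τ / (1 + t * I - -1 / τ)) := by ring
    rw [e5, e6]
    simp only [div_eq_mul_inv, mul_assoc]
    linear_combination (-φ τ * ((-1 + t * I - -1 / τ)⁻¹ - (1 + t * I - -1 / τ)⁻¹)) *
      (mul_inv_cancel₀ h02)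
  have hintg : IntegrableOn (fun t : ℝ => Q (-1 + t * I) - Q (1 + t * I)) (Set.Ioi 0) :=
    ((iP.sub iP').sub (iS.const_mul (φ τ))).congr_fun (fun t ht => (hQside t ht).symm)
      measurableSet_Ioi
  have hval : ∫ t in Set.Ioi (0 : ℝ), (Q (-1 + t * I) - Q (1 + t * I)) =
      L * sideIntegral φ (1 - lam τ) - L * sideIntegral (slashS φ) (lam τ) +
        φ τ * (3 * Real.pi) := by
    rw [setIntegral_congr_fun measurableSet_Ioi hQside,
      integral_sub (f := fun t => P t - P' t) (iP.sub iP') (iS.const_mul _), integral_sub iP iP', integral_const_mul,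
      integral_const_mul, integral_const_mul, vS, sideIntegral, sideIntegral]
    ring
  have hQd : DifferentiableOn ℂ Q (U ∩ U') := fun z hz =>
    ((hR z hz.1).mono Set.inter_subset_left).add
      (((hR' z hz.2).mono Set.inter_subset_right).div_const _)
  have hτn : ‖τ ^ 2‖ = 1 := by rw [norm_pow, h, one_pow]
  have hQb : ∀ z ∈ fdD, ‖Q z‖ ≤ (K + K') / (1 + z.im) := by
    intro z hz
    refine (norm_add_le _ _).trans ?_
    rw [norm_div, hτn, div_one, add_div]
    exact add_le_add (hK z hz) (hK' z hz)
  have key := arc_integral_eq (hU.inter hU') (fun z hz => ⟨hDU hz, hDU' hz⟩) hQd hQb hintg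
  have hII : ∀ (V : Set ℂ) (R : ℂ → ℂ) (K : ℝ), IsOpen V → fdD ⊆ V → DifferentiableOn ℂ R V →
      (∀ z ∈ fdD, ‖R z‖ ≤ K / (1 + z.im)) → IntervalIntegrable
      (fun θ : ℝ => R (exp (θ * I)) * (I * exp (θ * I))) volume 0 Real.pi := by
    intro V R K hV hDV hRV hRb
    have hm : ∀ θ ∈ Set.Ioo 0 Real.pi, exp (θ * I) ∈ fdD := fun θ hθ => by
      simpa using arc_add_mem_fdD (t := 0) ⟨hθ.1.le, hθ.2.le⟩ le_rfl (Or.inr hθ)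
    have hc : ContinuousOn (fun θ : ℝ => R (exp (θ * I)) * (I * exp (θ * I))) (Set.Ioo 0 Real.pi) := by
      intro θ hθ
      refine ContinuousAt.continuousWithinAt (ContinuousAt.mul ?_ (by fun_prop))
      exact ContinuousAt.comp (g := R) (hRV.differentiableAt
        (hV.mem_nhds (hDV (hm θ hθ)))).continuousAt (by fun_prop)
    rw [intervalIntegrable_iff_integrableOn_Ioo_of_le hpi.le]
    refine Integrable.mono' (g := fun _ => |K|) (integrable_const _)
      (hc.aestronglyMeasurable measurableSet_Ioo) ?_
    refine (ae_restrict_iff' measurableSet_Ioo).2 (Eventually.of_forall fun θ hθ => ?_)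
    rw [norm_mul, norm_mul, norm_I, norm_exp_ofReal_mul_I, mul_one, mul_one]
    have h1 := (hm θ hθ).1
    refine (hRb _ (hm θ hθ)).trans ((div_le_div_of_nonneg_right (le_abs_self K) (by linarith)).trans ?_)
    exact div_le_self (abs_nonneg _) (by linarith)
  have i1 := hII U R K hU hDU hR hK
  have i2 := hII U' R' K' hU' hDU' hR' hK'
  have hsplit : ∫ θ in (0 : ℝ)..Real.pi, Q (exp (θ * I)) * (I * exp (θ * I)) =
      ∫ θ in (0 : ℝ)..Real.pi, (-I * φ τ) := by
    have i3 := (i2.comp_sub_left Real.pi).symm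
    simp only [sub_zero, sub_self] at i3
    have hrefl : ∫ θ in (0 : ℝ)..Real.pi, R' (exp (θ * I)) * (I * exp (θ * I)) =
        ∫ θ in (0 : ℝ)..Real.pi, R' (exp ((Real.pi - θ : ℝ) * I)) * (I * exp ((Real.pi - θ : ℝ) * I)) := by
      rw [intervalIntegral.integral_comp_sub_left
        (fun θ : ℝ => R' (exp (θ * I)) * (I * exp (θ * I))) Real.pi]
      simp
    have s1 : ∫ θ in (0 : ℝ)..Real.pi, Q (exp (θ * I)) * (I * exp (θ * I)) =
        (∫ θ in (0 : ℝ)..Real.pi, R (exp (θ * I)) * (I * exp (θ * I))) +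
        (τ ^ 2)⁻¹ * ∫ θ in (0 : ℝ)..Real.pi, R' (exp (θ * I)) * (I * exp (θ * I)) := by
      rw [← intervalIntegral.integral_const_mul, ← intervalIntegral.integral_add i1 (i2.const_mul _)]
      congr 1; ext θ; simp only [hQ]; ring
    rw [s1, hrefl, ← intervalIntegral.integral_const_mul,
      ← intervalIntegral.integral_add i1 (i3.const_mul _)]
    have hexc : ∀ᵐ θ : ℝ, θ ∉ ({Real.pi, Real.arccos τ.re} : Set ℝ) :=
      (Set.toFinite _).countable.ae_notMem _
    refine intervalIntegral.integral_congr_ae ?_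
    filter_upwards [hexc] with θ hθ hθ2
    rw [Set.uIoc_of_le hpi.le] at hθ2
    simp only [Set.mem_insert_iff, Set.mem_singleton_iff, not_or] at hθ
    have hθ3 : θ ∈ Set.Ioo 0 Real.pi := ⟨hθ2.1, lt_of_le_of_ne hθ2.2 hθ.1⟩
    have hθ4 : Real.pi - θ ∈ Set.Ioo 0 Real.pi := ⟨by linarith [hθ3.2], by linarith [hθ3.1]⟩
    set z := exp (θ * I) with hz
    have hzD : z ∈ fdD := by
      simpa using arc_add_mem_fdD (t := 0) ⟨hθ3.1.le, hθ3.2.le⟩ le_rfl (Or.inr hθ3)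
    have hz0 : z ≠ 0 := Complex.exp_ne_zero _
    have hw : exp ((Real.pi - θ : ℝ) * I) = -1 / z := by
      push_cast
      rw [sub_mul, Complex.exp_sub, Complex.exp_pi_mul_I]
    have hwD : -1 / z ∈ fdD := by
      rw [← hw]
      simpa using arc_add_mem_fdD (t := 0) ⟨hθ4.1.le, hθ4.2.le⟩ le_rfl (Or.inr hθ4)
    have hzτ : z ≠ τ := by
      intro hzτ
      apply hθ.2
      rw [← hzτ, hz, exp_ofReal_mul_I_re, Real.arccos_cos hθ3.1.le hθ3.2.le]
    have hwτ : -1 / z ≠ -1 / τ := by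
      intro hh
      apply hzτ
      rw [← neg_one_div_neg_one_div hz0, hh, neg_one_div_neg_one_div h0]
    have hlam : lam z - lam τ ≠ 0 := sub_ne_zero.2 fun hh => hzτ (hinj z hzD hh)
    rw [hw, hReq _ hzD hzτ, hReq' _ hwD hwτ, deriv_lam_neg_one_div hτ, lam_S hτ, lam_S hzD.1, slashS,
      slashS, neg_one_div_neg_one_div hz0, neg_one_div_neg_one_div h0]
    have e1 : (1 - lam z - (1 - lam τ)) = -(lam z - lam τ) := by ring
    have hzτ' : z - τ ≠ 0 := sub_ne_zero.2 hzτ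
    have e2 : (-1 / z - -1 / τ) = (z - τ) / (z * τ) := by field_simp; ring
    rw [e1, e2]
    generalize hg : lam z - lam τ = g at hlam
    field_simp
    ring
  rw [hsplit, intervalIntegral.integral_const, hval] at key
  have hfin : L * sideIntegral (slashS φ) (lam τ) - L * sideIntegral φ (1 - lam τ) =
      2 * Real.pi * φ τ := by
    have : -I * (L * sideIntegral φ (1 - lam τ) - L * sideIntegral (slashS φ) (lam τ) +
        2 * Real.pi * φ τ) = 0 := by
      have e : (Real.pi - 0 : ℝ) • (-I * φ τ) = Real.pi * (-I * φ τ) := by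
        rw [sub_zero, Complex.real_smul]
      rw [e] at key
      linear_combination -key
    have := (mul_eq_zero.1 this).resolve_left (neg_ne_zero.2 I_ne_zero)
    linear_combination -this
  have hpi0 : (Real.pi : ℂ) ≠ 0 := by exact_mod_cast hpi.ne'
  rw [slashS_locB φ hτ, locB, ← hL]
  field_simp
  linear_combination hfin

theorem neg_conj_mem_fdD {z : ℂ} (hz : z ∈ fdD) : -(starRingEnd ℂ) z ∈ fdD := by
  obtain ⟨h1, h2, h3⟩ := hz
  refine ⟨by simpa using h1, by simpa using h2, by simpa using h3⟩

theorem exp_mul_I_of_norm_eq_one {τ : ℂ} (h : ‖τ‖ = 1) (hτ : 0 < τ.im) :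
    τ = exp (Real.arccos τ.re * I) ∧ Real.arccos τ.re ∈ Set.Ioo 0 Real.pi := by
  obtain ⟨h1, h2⟩ := abs_lt.1 (abs_re_lt_one h hτ)
  have hsq : τ.re * τ.re + τ.im * τ.im = 1 := by
    rw [← Complex.normSq_apply, Complex.normSq_eq_norm_sq, h]; norm_num
  constructor
  · apply Complex.ext
    · rw [exp_ofReal_mul_I_re, Real.cos_arccos h1.le h2.le]
    · rw [exp_ofReal_mul_I_im, Real.sin_arccos, show 1 - τ.re ^ 2 = τ.im ^ 2 by nlinarith,
        Real.sqrt_sq hτ.le]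
  · exact ⟨Real.arccos_pos.2 h2, lt_of_le_of_ne (Real.arccos_le_pi _)
      (fun hh => by rw [Real.arccos_eq_pi] at hh; linarith)⟩

/-- The open upper unit half-circle. -/
def arcC : Set ℂ := {z | ‖z‖ = 1 ∧ 0 < z.im}

theorem arcC_eq : arcC = (fun θ : ℝ => exp (θ * I)) '' Set.Ioo 0 Real.pi := by
  ext z
  constructor
  · rintro ⟨h1, h2⟩
    obtain ⟨h3, h4⟩ := exp_mul_I_of_norm_eq_one h1 h2
    exact ⟨_, h4, h3.symm⟩
  · rintro ⟨θ, hθ, rfl⟩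
    refine ⟨norm_exp_ofReal_mul_I θ, ?_⟩
    change 0 < (exp (θ * I)).im
    rw [exp_ofReal_mul_I_im]
    exact Real.sin_pos_of_mem_Ioo hθ

theorem isPreconnected_arcC : IsPreconnected arcC := by
  rw [arcC_eq]
  exact isPreconnected_Ioo.image _ (by fun_prop)

theorem frequently_arcC {τ : ℂ} (hτ : τ ∈ arcC) {p : ℂ → Prop}
    (h : ∀ᶠ z in 𝓝 τ, z ∈ arcC → p z) : ∃ᶠ z in 𝓝[≠] τ, p z := by
  rw [arcC_eq] at hτ
  obtain ⟨θ, hθ, rfl⟩ := hτ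
  have h1 := hasDerivAt_arc θ 0
  simp only [add_zero] at h1
  have h2 : Tendsto (fun θ : ℝ => exp (θ * I)) (𝓝[≠] θ) (𝓝[≠] (exp (θ * I))) :=
    h1.tendsto_nhdsNE (mul_ne_zero I_ne_zero (Complex.exp_ne_zero _))
  refine h2.frequently (Eventually.frequently ?_)
  have h3 := (h2.mono_right nhdsWithin_le_nhds).eventually h
  filter_upwards [h3, nhdsWithin_le_nhds (isOpen_Ioo.mem_nhds hθ)] with s hs hs2
  exact hs (by rw [arcC_eq]; exact ⟨s, hs2, rfl⟩)

theorem mem_arcC_lam {τ : ℂ} (hτ : τ ∈ arcC) : (lam τ).re = 1 / 2 ∧ (lam (-1 / τ)).re = 1 / 2 := by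
  have h := lam_re_of_norm_eq_one hτ.2 hτ.1
  rw [lam_S hτ.2]
  simp [h]; norm_num

theorem analyticAt_slashS_locB {ψ : ℂ → ℂ} {C : ℝ} (h : IsBloch ψ C) {τ : ℂ} (hτ : τ ∈ arcC) :
    AnalyticAt ℂ (locB ψ) τ ∧ AnalyticAt ℂ (slashS (locB ψ)) τ := by
  have h1 : ContinuousAt lam τ := (differentiableAt_lam hτ.2).continuousAt
  have hL := (mem_arcC_lam hτ).1
  have hre : ContinuousAt (fun z => (lam z).re) τ := Complex.continuous_re.continuousAt.comp h1
  have e1 : ∀ᶠ z in 𝓝 τ, (lam z).re < 1 := hre.eventually_lt continuousAt_const (by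
    simp only [hL]; norm_num)
  have e2 : ∀ᶠ z in 𝓝 τ, 0 < (lam z).re := continuousAt_const.eventually_lt hre (by
    simp only [hL]; norm_num)
  have e3 : ∀ᶠ z in 𝓝 τ, 0 < z.im := isOpen_uhp.mem_nhds hτ.2
  constructor
  · rw [analyticAt_iff_eventually_differentiableAt]
    filter_upwards [e1, e3] with z h1 h3
    exact differentiableAt_locB h h3 h1
  · rw [analyticAt_iff_eventually_differentiableAt]
    filter_upwards [e2, e3] with z h2 h3
    have h0 := ne_zero_of_im_pos h3
    refine DifferentiableAt.div ?_ (by fun_prop) (pow_ne_zero 2 h0)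
    refine DifferentiableAt.comp (g := locB ψ) z (differentiableAt_locB h (im_neg_one_div h3) ?_)
      (differentiableAt_neg_one_div h0)
    rw [lam_S h3]; simpa using h2

/-- The local solutions on both sides of the unit circle match. -/
theorem locB_identity {φ : ℂ → ℂ} {C : ℝ} (hφ : IsBloch φ C) {τ : ℂ} (hτ : τ ∈ arcC) :
    ∀ᶠ z in 𝓝 τ, locB (slashS φ) z + slashS (locB φ) z = φ z := by
  obtain ⟨ε, hε, hinj⟩ := exists_arc_injective
  have hsmall : ∀ τ ∈ arcC, τ.im < ε → 0 < τ.re →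
      locB (slashS φ) τ + slashS (locB φ) τ = φ τ := by
    rintro τ ⟨h1, h2⟩ h3 h4
    obtain ⟨h5, h6⟩ := hinj τ h1 h2 h3 h4
    refine locB_identity_of_injective hφ h1 h2 h5 h6 fun z hz hzl => ?_
    rw [neg_one_div_eq_of_norm_eq_one h1] at hzl ⊢
    rw [lam_neg_conj] at hzl
    have h7 := h5 _ (neg_conj_mem_fdD hz) (by rw [lam_neg_conj, hzl]; simp)
    rw [← h7]; simp
  set E : ℂ → ℂ := fun z => locB (slashS φ) z + slashS (locB φ) z - φ z with hE
  have hEan : AnalyticOnNhd ℂ E arcC := fun z hz =>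
    ((analyticAt_slashS_locB hφ.slashS hz).1.add (analyticAt_slashS_locB hφ hz).2).sub
      (analyticOnNhd_of_differentiableAt hφ.diff z hz.2)
  have hev : ∀ τ ∈ arcC, (∀ᶠ z in 𝓝 τ, z ∈ arcC → E z = 0) → ∀ᶠ z in 𝓝 τ, E z = 0 :=
    fun τ hτ h => ((hEan τ hτ).frequently_zero_iff_eventually_zero).1 (frequently_arcC hτ h)
  obtain ⟨θ, hθ0, hθ1⟩ : ∃ θ : ℝ, 0 < θ ∧ θ < min ε (Real.pi / 2) :=
    exists_between (lt_min hε (by positivity))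
  have hpi := Real.pi_pos
  have hθ2 : θ < Real.pi / 2 := hθ1.trans_le (min_le_right _ _)
  have hm : exp (θ * I) ∈ arcC := by
    rw [arcC_eq]; exact ⟨θ, ⟨hθ0, by linarith⟩, rfl⟩
  have hz0 : ∀ᶠ z in 𝓝 (exp (θ * I)), E z = 0 := by
    apply hev _ hm
    have a1 : ∀ᶠ z : ℂ in 𝓝 (exp (θ * I)), z.im < ε :=
      Complex.continuous_im.continuousAt.eventually_lt continuousAt_const (by
        rw [exp_ofReal_mul_I_im]
        exact (Real.sin_lt hθ0).trans (hθ1.trans_le (min_le_left _ _)))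
    have a2 : ∀ᶠ z : ℂ in 𝓝 (exp (θ * I)), 0 < z.re :=
      continuousAt_const.eventually_lt Complex.continuous_re.continuousAt (by
        rw [exp_ofReal_mul_I_re]
        exact Real.cos_pos_of_mem_Ioo ⟨by linarith, hθ2⟩)
    filter_upwards [a1, a2] with z h1 h2 h3
    rw [hE]; simp only; rw [hsmall z h3 h1 h2, sub_self]
  have hall := hEan.eqOn_zero_of_preconnected_of_eventuallyEq_zero isPreconnected_arcC hm hz0
  filter_upwards [hev τ hτ (Eventually.of_forall fun z hz => hall hz)] with z hz
  exact sub_eq_zero.1 hz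

/-- Translate by an even integer into the strip `|Re z| ≤ 1`. -/
def redStrip (z : ℂ) : ℂ := z - 2 * (round (z.re / 2) : ℤ)

/-- One step of the reduction towards `D`. -/
def redStep (z : ℂ) : ℂ := -1 / redStrip z

theorem redStrip_im (z : ℂ) : (redStrip z).im = z.im := by simp [redStrip]

theorem redStrip_re (z : ℂ) : (redStrip z).re = z.re - 2 * round (z.re / 2) := by simp [redStrip]

theorem abs_redStrip_re_le (z : ℂ) : |(redStrip z).re| ≤ 1 := by
  rw [redStrip_re]
  have := abs_sub_round (z.re / 2)
  rw [abs_le] at this ⊢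
  constructor <;> linarith

theorem redStrip_add_two (z : ℂ) : redStrip (z + 2) = redStrip z := by
  have : round ((z + 2).re / 2) = round (z.re / 2) + 1 := by
    rw [← round_add_one]; congr 1; simp; ring
  rw [redStrip, redStrip, this]; push_cast; ring

theorem redStrip_of_abs_lt {z : ℂ} (h : |z.re| < 1) : redStrip z = z := by
  have : round (z.re / 2) = 0 := by
    rw [round_eq_zero_iff]
    obtain ⟨h1, h2⟩ := abs_lt.1 h
    constructor <;> linarith
  rw [redStrip, this]; simp

theorem redStrip_mem_fdD {z : ℂ} (hz : 0 < z.im) (h : 1 ≤ ‖redStrip z‖) : redStrip z ∈ fdD :=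
  ⟨by rw [redStrip_im]; exact hz, abs_redStrip_re_le z, h⟩

theorem redStep_im_pos {z : ℂ} (hz : 0 < z.im) : 0 < (redStep z).im :=
  im_neg_one_div (by rw [redStrip_im]; exact hz)

theorem abs_re_lt_one_of_norm_lt {z : ℂ} (h : ‖z‖ < 1) : |z.re| < 1 :=
  (Complex.abs_re_le_norm z).trans_lt h

theorem one_lt_norm_neg_one_div {z : ℂ} (h0 : z ≠ 0) (h : ‖z‖ < 1) : 1 < ‖-1 / z‖ := by
  rw [norm_div, norm_neg, norm_one]
  exact (one_lt_div (norm_pos_iff.2 h0)).2 h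

theorem norm_neg_one_div_lt_one {z : ℂ} (h : 1 < ‖z‖) : ‖-1 / z‖ < 1 := by
  rw [norm_div, norm_neg, norm_one, div_lt_one (by linarith)]
  exact h

/-- A point `z` and an integer matrix of determinant one such that the matrix maps `z` to `w`. -/
structure Moved (z w : ℂ) (a b c d : ℤ) : Prop where
  det : a * d - b * c = 1
  eq : w * (c * z + d) = a * z + b
  lt : |c| < |a|

theorem Moved.denom_ne {z w : ℂ} {a b c d : ℤ} (h : Moved z w a b c d) (hz : 0 < z.im) :
    (c * z + d : ℂ) ≠ 0 := by
  intro h0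
  have h1 := h.eq
  rw [h0, mul_zero] at h1
  have h2 := congrArg Complex.im h1
  simp only [zero_im, add_im, mul_im, intCast_re, intCast_im, zero_mul, add_zero] at h2
  have h3 : (a : ℝ) = 0 := by
    rcases mul_eq_zero.1 h2.symm with h | h
    · exact h
    · exact absurd h hz.ne'
  have h4 : a = 0 := by exact_mod_cast h3
  have := h.lt
  rw [h4, abs_zero] at this
  exact absurd this (not_lt.2 (abs_nonneg c))

/-- The point is confined to a short interval as long as the reduction has not terminated. -/
theorem Moved.abs_lt_one {z w : ℂ} {a b c d : ℤ} (h : Moved z w a b c d) (hz : 0 < z.im)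
    (hw : ‖w‖ < 1) : |((a ^ 2 - c ^ 2 : ℤ) : ℝ) * z.re + (a * b - c * d : ℤ)| < 1 ∧
      ((a ^ 2 - c ^ 2 : ℤ) : ℝ) * z.im < 1 := by
  have h1 : ‖(a * z + b : ℂ)‖ ^ 2 < ‖(c * z + d : ℂ)‖ ^ 2 := by
    have h2 : 0 < ‖(c * z + d : ℂ)‖ := norm_pos_iff.2 (h.denom_ne hz)
    rw [← h.eq, norm_mul]
    gcongr
    nlinarith
  rw [← Complex.normSq_eq_norm_sq, ← Complex.normSq_eq_norm_sq, Complex.normSq_apply,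
    Complex.normSq_apply] at h1
  simp only [add_re, mul_re, intCast_re, intCast_im, zero_mul, sub_zero, add_im, mul_im,
    add_zero] at h1
  have hD : 0 < a ^ 2 - c ^ 2 := by
    have := sq_lt_sq.2 h.lt
    linarith
  have hD' : (0 : ℝ) < ((a ^ 2 - c ^ 2 : ℤ) : ℝ) := by exact_mod_cast hD
  have hdet : (a * d - b * c : ℝ) = 1 := by exact_mod_cast h.det
  have key : (((a ^ 2 - c ^ 2 : ℤ) : ℝ) * z.re + (a * b - c * d : ℤ)) ^ 2 +
      (((a ^ 2 - c ^ 2 : ℤ) : ℝ) * z.im) ^ 2 < 1 := by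
    have e : (((a ^ 2 - c ^ 2 : ℤ) : ℝ) * z.re + (a * b - c * d : ℤ)) ^ 2 +
      (((a ^ 2 - c ^ 2 : ℤ) : ℝ) * z.im) ^ 2 = (a * d - b * c : ℝ) ^ 2 + ((a ^ 2 - c ^ 2 : ℤ) : ℝ) *
        (((a * z.re + b) * (a * z.re + b) + a * z.im * (a * z.im)) -
          ((c * z.re + d) * (c * z.re + d) + c * z.im * (c * z.im))) := by
      push_cast; ring
    rw [e, hdet]
    nlinarith
  constructor
  · rw [← sq_lt_one_iff_abs_lt_one]
    nlinarith [sq_nonneg (((a ^ 2 - c ^ 2 : ℤ) : ℝ) * z.im)]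
  · nlinarith [sq_nonneg (((a ^ 2 - c ^ 2 : ℤ) : ℝ) * z.re + (a * b - c * d : ℤ))]

theorem Moved.abs_mul_im_lt {z w : ℂ} {a b c d : ℤ} (h : Moved z w a b c d) (hz : 0 < z.im)
    (hw : ‖w‖ < 1) : (|a| : ℝ) * z.im < 1 := by
  refine lt_of_le_of_lt ?_ (h.abs_lt_one hz hw).2
  gcongr
  have h1 := h.lt
  have : |a| ≤ a ^ 2 - c ^ 2 := by
    rw [← sq_abs a, ← sq_abs c]
    nlinarith [abs_nonneg c]
  exact_mod_cast this

/-- The matrix after one more step of the reduction. -/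
theorem Moved.next {z w : ℂ} {a b c d : ℤ} (h : Moved z w a b c d) (hw : w ≠ 0) {k : ℤ} (hk : k ≠ 0) :
    Moved z (-1 / w - 2 * k) (-(c + 2 * k * a)) (-(d + 2 * k * b)) a b ∧
      |a| < |-(c + 2 * k * a)| := by
  have hlt : |a| < |-(c + 2 * k * a)| := by
    rw [abs_neg]
    have h1 : |2 * k * a| ≤ |c + 2 * k * a| + |c| := by
      have := abs_sub (c + 2 * k * a) c
      simpa using this
    have h2 : 2 * |a| ≤ |2 * k * a| := by
      rw [abs_mul, abs_mul]
      have : 1 ≤ |k| := Int.one_le_abs hk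
      have h3 : |(2 : ℤ)| = 2 := rfl
      rw [h3]
      nlinarith [abs_nonneg a]
    linarith [h.lt]
  refine ⟨⟨by linear_combination h.det, ?_, hlt⟩, hlt⟩
  have h1 := h.eq
  push_cast
  field_simp
  linear_combination (1 + 2 * k * w - 2 * k * w) * h1

theorem Moved.self (z : ℂ) : Moved z z 1 0 0 1 :=
  ⟨by norm_num, by simp, by simp⟩

theorem redStrip_redStep (w : ℂ) : ∃ k : ℤ, redStrip (-1 / w) = -1 / w - 2 * k := ⟨_, rfl⟩

theorem exists_redStep_of_moved {z : ℂ} (hz : 0 < z.im) (m : ℕ) : ∀ (k : ℕ) (w τ : ℂ) (a b c d : ℤ),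
    1 ≤ m * z.im → 0 < τ.im → redStrip τ = w → Moved z w a b c d → (m : ℤ) ≤ |a| + k →
    ∃ n, 1 ≤ ‖redStrip (redStep^[n] τ)‖ := by
  intro k
  induction k with
  | zero =>
    intro w τ a b c d hm hτ hw h hk
    refine ⟨0, ?_⟩
    by_contra! hlt
    simp only [Function.iterate_zero, id, hw] at hlt
    have h1 := h.abs_mul_im_lt hz hlt
    have h2 : (m : ℝ) ≤ (|a| : ℝ) := by
      have : (m : ℤ) ≤ |a| := by simpa using hk
      exact_mod_cast this
    nlinarith
  | succ k ih =>
    intro w τ a b c d hm hτ hw h hk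
    rcases le_or_gt 1 ‖redStrip τ‖ with h1 | h1
    · exact ⟨0, h1⟩
    have hwi : 0 < w.im := by rw [← hw, redStrip_im]; exact hτ
    have hw0 := ne_zero_of_im_pos hwi
    obtain ⟨l, hl⟩ := redStrip_redStep w
    rcases eq_or_ne l 0 with rfl | hl0
    · refine ⟨1, ?_⟩
      simp only [Function.iterate_one, redStep, hw, hl]
      rw [hw] at h1
      simpa using (one_lt_norm_neg_one_div hw0 h1).le
    · obtain ⟨h2, h3⟩ := h.next hw0 hl0
      obtain ⟨n, hn⟩ := ih _ (redStep τ) _ _ _ _ hm (redStep_im_pos hτ)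
        (show redStrip (redStep τ) = _ by rw [redStep, hw, hl]) h2 (by push_cast at hk; omega)
      exact ⟨n + 1, by rw [Function.iterate_succ_apply]; exact hn⟩

theorem exists_redStep {τ : ℂ} (hτ : 0 < τ.im) : ∃ n, 1 ≤ ‖redStrip (redStep^[n] τ)‖ := by
  obtain ⟨m, hm⟩ := exists_nat_ge (1 / τ.im)
  have hm' : 1 ≤ m * τ.im := by rwa [div_le_iff₀ hτ] at hm
  exact exists_redStep_of_moved (z := redStrip τ) (by rwa [redStrip_im]) m m _ τ 1 0 0 1
    (by rwa [redStrip_im]) hτ rfl (Moved.self _) (by simp)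

/-- The values of the global solution, by recursion along the reduction. -/
def globAux (φ : Bool → ℂ → ℂ) : ℕ → Bool → ℂ → ℂ
  | 0, i, τ => locB (φ !i) (redStrip τ)
  | n + 1, i, τ => φ i (redStrip τ) - globAux φ n (!i) (redStep τ) / redStrip τ ^ 2

open Classical in
/-- The global solution `F` of `F i + slashS (F !i) = φ i`. -/
def glob (φ : Bool → ℂ → ℂ) (i : Bool) (τ : ℂ) : ℂ :=
  if h : ∃ n, 1 ≤ ‖redStrip (redStep^[n] τ)‖ then globAux φ (Nat.find h) i τ else 0

theorem glob_of_one_le (φ : Bool → ℂ → ℂ) (i : Bool) {τ : ℂ} (h : 1 ≤ ‖redStrip τ‖) :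
    glob φ i τ = locB (φ !i) (redStrip τ) := by
  classical
  have h1 : ∃ n, 1 ≤ ‖redStrip (redStep^[n] τ)‖ := ⟨0, h⟩
  have h2 : Nat.find h1 = 0 := (Nat.find_eq_zero h1).2 h
  rw [glob, dif_pos h1, h2, globAux]

theorem glob_of_lt_one (φ : Bool → ℂ → ℂ) (i : Bool) {τ : ℂ} (hτ : 0 < τ.im)
    (h : ‖redStrip τ‖ < 1) :
    glob φ i τ = φ i (redStrip τ) - slashS (glob φ !i) (redStrip τ) := by
  classical
  have h1 := exists_redStep hτ
  have h2 := exists_redStep (redStep_im_pos hτ)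
  have h3 : Nat.find h1 = Nat.find h2 + 1 := Nat.find_comp_succ h1 h2 (not_le.2 h)
  rw [slashS, ← redStep, glob, dif_pos h1, glob, dif_pos h2, h3, globAux]

theorem glob_add_two (φ : Bool → ℂ → ℂ) (i : Bool) {τ : ℂ} (hτ : 0 < τ.im) :
    glob φ i (τ + 2) = glob φ i τ := by
  rcases le_or_gt 1 ‖redStrip τ‖ with h | h
  · rw [glob_of_one_le φ i h, glob_of_one_le φ i (by rwa [redStrip_add_two]), redStrip_add_two]
  · rw [glob_of_lt_one φ i hτ h, glob_of_lt_one φ i (by simpa using hτ)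
      (by rwa [redStrip_add_two]), redStrip_add_two]

theorem locB_redStrip (ψ : ℂ → ℂ) (τ : ℂ) : locB ψ (redStrip τ) = locB ψ τ := by
  have h : Function.Periodic (locB ψ) 2 := locB_add_two ψ
  have := h.sub_int_mul_eq (x := τ) (round (τ.re / 2))
  rw [redStrip, mul_comm]; exact this

theorem locB_congr {ψ χ : ℂ → ℂ} (h : ∀ z : ℂ, 0 < z.im → ψ z = χ z) (τ : ℂ) :
    locB ψ τ = locB χ τ := by
  rw [locB, locB, sideIntegral, sideIntegral]
  congr 1
  refine setIntegral_congr_fun measurableSet_Ioi fun t ht => ?_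
  have ht : 0 < t := ht
  simp only [sideDiff]
  rw [h _ (by simpa using ht), h _ (by simpa using ht)]

/-- A pair of functions exchanged by the weight two action of `-1/z`, with the Bloch bound. -/
structure BlochPair (φ : Bool → ℂ → ℂ) (C : ℝ) : Prop where
  bloch : ∀ i, IsBloch (φ i) C
  slash : ∀ i z, 0 < z.im → slashS (φ i) z = φ (!i) z

theorem locB_pair_identity {φ : Bool → ℂ → ℂ} {C : ℝ} (h : BlochPair φ C) (i : Bool) {τ : ℂ}
    (hτ : τ ∈ arcC) : ∀ᶠ z in 𝓝 τ, locB (φ !i) z + slashS (locB (φ i)) z = φ i z := by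
  filter_upwards [locB_identity (h.bloch i) hτ] with z hz
  rw [← hz, locB_congr (h.slash i)]

theorem neg_one_div_mem_arcC {τ : ℂ} (hτ : τ ∈ arcC) : -1 / τ ∈ arcC :=
  ⟨by rw [norm_div, hτ.1]; simp, im_neg_one_div hτ.2⟩

theorem glob_add_slashS {φ : Bool → ℂ → ℂ} {C : ℝ} (h : BlochPair φ C) (i : Bool) {τ : ℂ}
    (hτ : 0 < τ.im) : glob φ i τ + slashS (glob φ !i) τ = φ i τ := by
  have hlt : ∀ (i : Bool) (τ : ℂ), 0 < τ.im → ‖τ‖ < 1 →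
      glob φ i τ + slashS (glob φ !i) τ = φ i τ := by
    intro i τ hτ h1
    have e := redStrip_of_abs_lt (abs_re_lt_one_of_norm_lt h1)
    rw [glob_of_lt_one φ i hτ (by rwa [e]), e]; ring
  have h0 := ne_zero_of_im_pos hτ
  rcases lt_trichotomy ‖τ‖ 1 with h1 | h1 | h1
  · exact hlt i τ hτ h1
  · have hC : τ ∈ arcC := ⟨h1, hτ⟩
    have hC' := neg_one_div_mem_arcC hC
    have e := redStrip_of_abs_lt (abs_re_lt_one h1 hτ)
    have e' := redStrip_of_abs_lt (abs_re_lt_one hC'.1 hC'.2)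
    rw [slashS, glob_of_one_le φ i (by rw [e, h1]), glob_of_one_le φ (!i) (by rw [e', hC'.1]), e, e',
      Bool.not_not]
    exact (locB_pair_identity h i hC).self_of_nhds
  · have h2 := hlt (!i) (-1 / τ) (im_neg_one_div hτ) (norm_neg_one_div_lt_one h1)
    rw [slashS, Bool.not_not, neg_one_div_neg_one_div h0] at h2
    have h3 := h.slash (!i) τ hτ
    rw [Bool.not_not, slashS, ← h2] at h3
    rw [← h3, slashS]
    field_simp
    ring

theorem differentiableAt_glob {φ : Bool → ℂ → ℂ} {C : ℝ} (h : BlochPair φ C) {τ : ℂ}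
    (hτ : 0 < τ.im) (i : Bool) : DifferentiableAt ℂ (glob φ i) τ := by
  have huhp : ∀ τ : ℂ, 0 < τ.im → ∀ᶠ z in 𝓝 τ, 0 < z.im := fun τ hτ => isOpen_uhp.mem_nhds hτ
  have hbase : ∀ w ∈ fdD, ∀ i, DifferentiableAt ℂ (glob φ i) w := by
    intro w hw i
    have hL : (lam w).re < 1 := by linarith [lam_re_le_half hw]
    suffices hev : ∀ᶠ z in 𝓝 w, glob φ i z = locB (φ !i) z from
      (differentiableAt_locB (h.bloch _) hw.1 hL).congr_of_eventuallyEq hev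
    rcases hw.2.2.eq_or_lt with h1 | h1
    · have hC : w ∈ arcC := ⟨h1.symm, hw.1⟩
      have hre := abs_re_lt_one h1.symm hw.1
      have hC' := neg_one_div_mem_arcC hC
      have hre' := abs_re_lt_one hC'.1 hC'.2
      have c1 : ∀ᶠ z : ℂ in 𝓝 w, |z.re| < 1 :=
        (Continuous.continuousAt (by fun_prop)).eventually_lt continuousAt_const hre
      have c2 : ∀ᶠ z : ℂ in 𝓝 w, |(-1 / z).re| < 1 :=
        ContinuousAt.eventually_lt (f := fun z : ℂ => |(-1 / z).re|)
          ((Complex.continuous_re.continuousAt.comp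
          (differentiableAt_neg_one_div (ne_zero_of_im_pos hw.1)).continuousAt).abs)
          continuousAt_const hre'
      filter_upwards [c1, c2, huhp w hw.1, locB_pair_identity h i hC] with z h1 h2 h3 h4
      have e := redStrip_of_abs_lt h1
      rcases le_or_gt 1 ‖z‖ with h5 | h5
      · rw [glob_of_one_le φ i (by rwa [e]), e]
      · have h6 := one_lt_norm_neg_one_div (ne_zero_of_im_pos h3) h5
        have e' := redStrip_of_abs_lt h2
        rw [glob_of_lt_one φ i h3 (by rwa [e]), e, slashS, glob_of_one_le φ (!i) (by rw [e']; exact h6.le),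
          e', Bool.not_not, ← h4, slashS]
        ring
    · have hsq : 1 < w.re * w.re + w.im * w.im := by
        rw [← Complex.normSq_apply, Complex.normSq_eq_norm_sq]
        exact one_lt_pow₀ h1 two_ne_zero
      obtain ⟨h2, h3⟩ := abs_le.1 hw.2.1
      have n1 : 1 < ‖w - 2‖ := by
        rw [← one_lt_sq_iff₀ (norm_nonneg _), ← Complex.normSq_eq_norm_sq, Complex.normSq_apply]
        simp only [sub_re, re_ofNat, sub_im, im_ofNat, sub_zero]
        nlinarith
      have n2 : 1 < ‖w + 2‖ := by
        rw [← one_lt_sq_iff₀ (norm_nonneg _), ← Complex.normSq_eq_norm_sq, Complex.normSq_apply]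
        simp only [add_re, re_ofNat, add_im, im_ofNat, add_zero]
        nlinarith
      have c1 : ∀ᶠ z : ℂ in 𝓝 w, |z.re| < 2 :=
        (Continuous.continuousAt (by fun_prop)).eventually_lt continuousAt_const (by linarith [hw.2.1])
      have c2 : ∀ᶠ z : ℂ in 𝓝 w, 1 < ‖z‖ := continuousAt_const.eventually_lt
        (Continuous.continuousAt (by fun_prop)) h1
      have c3 : ∀ᶠ z : ℂ in 𝓝 w, 1 < ‖z - 2‖ := continuousAt_const.eventually_lt
        (Continuous.continuousAt (by fun_prop)) n1
      have c4 : ∀ᶠ z : ℂ in 𝓝 w, 1 < ‖z + 2‖ := continuousAt_const.eventually_lt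
        (Continuous.continuousAt (by fun_prop)) n2
      filter_upwards [c1, c2, c3, c4] with z h1 h2 h3 h4
      have hnorm : 1 ≤ ‖redStrip z‖ := by
        have h5 := abs_le.1 (abs_sub_round (z.re / 2))
        have h6 := abs_lt.1 h1
        have h7 : round (z.re / 2) < 2 := by
          have : (round (z.re / 2) : ℝ) < 2 := by linarith [h5.1]
          exact_mod_cast this
        have h8 : -2 < round (z.re / 2) := by
          have : (-2 : ℝ) < round (z.re / 2) := by linarith [h5.2]
          exact_mod_cast this
        rw [redStrip]
        obtain h9 | h9 | h9 : round (z.re / 2) = -1 ∨ round (z.re / 2) = 0 ∨ round (z.re / 2) = 1 := by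
          omega
        · rw [h9]; norm_num; exact h4.le
        · rw [h9]; norm_num; exact h2.le
        · rw [h9]; norm_num; exact h3.le
      rw [glob_of_one_le φ i hnorm, locB_redStrip]
  have hinv : ∀ w : ℂ, 0 < w.im → (∀ i, DifferentiableAt ℂ (glob φ i) (-1 / w)) →
      ∀ i, DifferentiableAt ℂ (glob φ i) w := by
    intro w hw hd i
    have h0 := ne_zero_of_im_pos hw
    have h1 : DifferentiableAt ℂ (fun z => φ i z - slashS (glob φ !i) z) w :=
      ((h.bloch i).diff w hw).sub (((hd _).comp w (differentiableAt_neg_one_div h0)).div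
        (by fun_prop) (pow_ne_zero 2 h0))
    refine h1.congr_of_eventuallyEq ?_
    filter_upwards [huhp w hw] with z hz
    rw [← glob_add_slashS h i hz]; ring
  have htrans : ∀ τ : ℂ, 0 < τ.im → (∀ i, DifferentiableAt ℂ (glob φ i) (redStrip τ)) →
      ∀ i, DifferentiableAt ℂ (glob φ i) τ := by
    have key : ∀ (k : ℤ) (τ : ℂ), 0 < τ.im → ∀ i, DifferentiableAt ℂ (glob φ i) (τ - 2 * k) →
        DifferentiableAt ℂ (glob φ i) τ := by
      have hintg : ∀ (k : ℤ) (z : ℂ), 0 < z.im → ∀ i, glob φ i (z - 2 * k) = glob φ i z := by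
        intro k
        induction k using Int.induction_on with
        | zero => intro z _ i; simp
        | succ n ih =>
          intro z hz i
          rw [← ih z hz i, ← glob_add_two φ i (τ := z - 2 * ((n + 1 : ℤ) : ℂ)) (by simpa using hz)]
          congr 1; push_cast; ring
        | pred n ih =>
          intro z hz i
          rw [← ih z hz i, ← glob_add_two φ i (τ := z - 2 * ((-n : ℤ) : ℂ)) (by simpa using hz)]
          congr 1; push_cast; ring
      intro k τ hτ i hd
      have h1 : DifferentiableAt ℂ (fun z => glob φ i (z - 2 * k)) τ :=
        DifferentiableAt.comp (g := glob φ i) τ hd (by fun_prop)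
      refine h1.congr_of_eventuallyEq ?_
      filter_upwards [huhp τ hτ] with z hz
      exact (hintg k z hz i).symm
    exact fun τ hτ hd i => key _ τ hτ i (hd i)
  obtain ⟨n, hn⟩ := exists_redStep hτ
  revert τ
  suffices ∀ n : ℕ, ∀ τ : ℂ, 0 < τ.im → 1 ≤ ‖redStrip (redStep^[n] τ)‖ →
      ∀ i, DifferentiableAt ℂ (glob φ i) τ from fun {τ} hτ hn => this n τ hτ hn i
  intro n
  induction n with
  | zero => exact fun τ hτ hn => htrans τ hτ (hbase _ (redStrip_mem_fdD hτ hn))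
  | succ n ih =>
    intro τ hτ hn
    rw [Function.iterate_succ_apply] at hn
    exact htrans τ hτ (hinv _ (by rwa [redStrip_im]) (ih _ (redStep_im_pos hτ) hn))

/-- The condition that an element of determinant one with given column differences moves the
vertical line over `x` into the unit disc. -/
def NearSide (u v : ℤ) (x : ℝ) : Prop := ∃ a b c d : ℤ, a - c = u ∧ a + c = v ∧
  a * d - b * c = 1 ∧ |((a ^ 2 - c ^ 2 : ℤ) : ℝ) * x + (a * b - c * d : ℤ)| < 1

/-- The total size of horoball heights over `z` with small denominators. -/
def cuspSum (n : ℕ) (z : ℂ) : ℝ :=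
  ∑ q ∈ Finset.Icc (1 : ℤ) n, ∑ p ∈ Finset.Icc (-(2 * q)) (2 * q), z.im / ‖(q * z + p : ℂ)‖ ^ 2

theorem norm_linear_sq (q p : ℤ) (z : ℂ) :
    ‖(q * z + p : ℂ)‖ ^ 2 = (q * z.re + p) ^ 2 + (q * z.im) ^ 2 := by
  rw [← Complex.normSq_eq_norm_sq, Complex.normSq_apply]
  simp only [add_re, mul_re, intCast_re, intCast_im, zero_mul, sub_zero, add_im, mul_im, add_zero]
  ring

theorem cuspSum_nonneg (n : ℕ) {z : ℂ} (hz : 0 < z.im) : 0 ≤ cuspSum n z :=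
  Finset.sum_nonneg fun _ _ => Finset.sum_nonneg fun _ _ => by positivity

theorem height_le {n : ℕ} (hn : 1 ≤ n) {z : ℂ} (hz : z.im = 1 / n) (hre : |z.re| ≤ 1) {q : ℤ}
    (hq : 1 ≤ q) (p : ℤ) :
    z.im / ‖(q * z + p : ℂ)‖ ^ 2 ≤ 1 + cuspSum n z ∧ z.im / ‖(q * z + p : ℂ)‖ ^ 2 ≤ n := by
  have hn' : (1 : ℝ) ≤ n := by exact_mod_cast hn
  have hy : 0 < z.im := by rw [hz]; positivity
  have hny : n * z.im = 1 := by rw [hz]; field_simp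
  have hq' : (1 : ℝ) ≤ q := by exact_mod_cast hq
  have hpos : 0 < ‖(q * z + p : ℂ)‖ ^ 2 := by
    rw [norm_linear_sq]; positivity
  have hlow : q ^ 2 * z.im ^ 2 ≤ ‖(q * z + p : ℂ)‖ ^ 2 := by
    rw [norm_linear_sq]
    nlinarith [sq_nonneg (q * z.re + p : ℝ)]
  have hS := cuspSum_nonneg n hy
  refine ⟨?_, ?_⟩
  · by_cases hqn : q ≤ n
    · by_cases hp : p ∈ Finset.Icc (-(2 * q)) (2 * q)
      · have h1 : z.im / ‖(q * z + p : ℂ)‖ ^ 2 ≤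
            ∑ p ∈ Finset.Icc (-(2 * q)) (2 * q), z.im / ‖(q * z + p : ℂ)‖ ^ 2 :=
          Finset.single_le_sum (f := fun p : ℤ => z.im / ‖(q * z + p : ℂ)‖ ^ 2)
            (fun _ _ => by positivity) hp
        have h2 : (∑ p ∈ Finset.Icc (-(2 * q)) (2 * q), z.im / ‖(q * z + p : ℂ)‖ ^ 2) ≤
            cuspSum n z :=
          Finset.single_le_sum (f := fun q : ℤ => ∑ p ∈ Finset.Icc (-(2 * q)) (2 * q),
            z.im / ‖(q * z + p : ℂ)‖ ^ 2)
            (fun _ _ => Finset.sum_nonneg fun _ _ => by positivity) (Finset.mem_Icc.2 ⟨hq, hqn⟩)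
        linarith
      · have hp2 : (2 * q : ℝ) ≤ |(p : ℝ)| := by
          have : 2 * q ≤ |p| := by
            rw [Finset.mem_Icc, not_and_or, not_le, not_le] at hp
            rcases hp with hp | hp
            · linarith [neg_le_abs p]
            · linarith [le_abs_self p]
          exact_mod_cast this
        have h3 : 1 ≤ |(q * z.re + p : ℝ)| := by
          have h4 : |(q * z.re : ℝ)| ≤ q := by
            rw [abs_mul, abs_of_pos (by linarith)]
            nlinarith
          have h5 : |(p : ℝ)| ≤ |(q * z.re + p : ℝ)| + |(q * z.re : ℝ)| := by
            have := abs_sub (q * z.re + p : ℝ) (q * z.re)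
            simpa using this
          linarith
        have h4 : 1 ≤ ‖(q * z + p : ℂ)‖ ^ 2 := by
          rw [norm_linear_sq, ← sq_abs (q * z.re + p : ℝ)]
          nlinarith [sq_nonneg (q * z.im : ℝ)]
        have : z.im / ‖(q * z + p : ℂ)‖ ^ 2 ≤ 1 := by
          rw [div_le_one hpos]
          nlinarith
        linarith
    · have hqn' : (n : ℝ) ≤ q := by
        have : (n : ℤ) ≤ q := by omega
        exact_mod_cast this
      have : z.im / ‖(q * z + p : ℂ)‖ ^ 2 ≤ 1 := by
        rw [div_le_one hpos]
        refine le_trans ?_ hlow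
        have h1 : 1 ≤ q * z.im := by nlinarith
        nlinarith
      linarith
  · rw [div_le_iff₀ hpos]
    refine le_trans ?_ (mul_le_mul_of_nonneg_left hlow (by linarith))
    have h1 : (1 : ℝ) ≤ q ^ 2 := by nlinarith
    have h2 : n * (q ^ 2 * z.im ^ 2) = q ^ 2 * z.im * (n * z.im) := by ring
    rw [h2, hny]
    nlinarith

theorem height_le_of_ne_zero {n : ℕ} (hn : 1 ≤ n) {z : ℂ} (hz : z.im = 1 / n) (hre : |z.re| ≤ 1)
    {q : ℤ} (hq : q ≠ 0) (p : ℤ) :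
    z.im / ‖(q * z + p : ℂ)‖ ^ 2 ≤ 1 + cuspSum n z ∧ z.im / ‖(q * z + p : ℂ)‖ ^ 2 ≤ n := by
  rcases lt_or_gt_of_ne hq with h | h
  · have := height_le hn hz hre (q := -q) (by omega) (-p)
    have e : ‖((-q : ℤ) * z + (-p : ℤ) : ℂ)‖ = ‖(q * z + p : ℂ)‖ := by
      rw [← norm_neg]; congr 1; push_cast; ring
    rwa [e] at this
  · exact height_le hn hz hre (by omega) p

theorem im_of_moved {z w : ℂ} {a b c d : ℤ} (det : a * d - b * c = 1)
    (eq : w * (c * z + d) = a * z + b) (h0 : (c * z + d : ℂ) ≠ 0) :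
    w.im = z.im / ‖(c * z + d : ℂ)‖ ^ 2 := by
  have hdet : (a * d - b * c : ℝ) = 1 := by exact_mod_cast det
  rw [(eq_div_iff h0).2 eq, Complex.div_im, ← Complex.normSq_eq_norm_sq]
  simp only [add_re, mul_re, intCast_re, intCast_im, zero_mul, sub_zero, add_im, mul_im, add_zero]
  rw [← sub_div]
  congr 1
  linear_combination z.im * hdet

theorem denom_ne_of_det {z : ℂ} {a b c d : ℤ} (hz : 0 < z.im) (det : a * d - b * c = 1) :
    (c * z + d : ℂ) ≠ 0 := by
  intro h0
  have h2 := congrArg Complex.im h0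
  simp only [zero_im, add_im, mul_im, intCast_re, intCast_im, zero_mul, add_zero] at h2
  have h3 : (c : ℝ) = 0 := by
    rcases mul_eq_zero.1 h2 with h | h
    · exact h
    · exact absurd h hz.ne'
  have h4 : c = 0 := by exact_mod_cast h3
  subst h4
  have h5 := congrArg Complex.re h0
  simp at h5
  simp [h5] at det

theorem cuspV_le_of_moved {n : ℕ} (hn : 1 ≤ n) {z w : ℂ} (hz : z.im = 1 / n) (hre : |z.re| ≤ 1)
    {a b c d : ℤ} (det : a * d - b * c = 1) (eq : w * (c * z + d) = a * z + b) (hne : |a| ≠ |c|) :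
    cuspV w ≤ 3 + 2 * cuspSum n z ∧ cuspV w ≤ 1 + 2 * n := by
  have hn' : (1 : ℝ) ≤ n := by exact_mod_cast hn
  have hy : 0 < z.im := by rw [hz]; positivity
  have h0 := denom_ne_of_det hy det
  have hN : ‖(c * z + d : ℂ)‖ ≠ 0 := norm_ne_zero_iff.2 h0
  have h1 : a - c ≠ 0 := fun h => hne (by rw [sub_eq_zero.1 h])
  have h2 : a + c ≠ 0 := fun h => hne (by rw [eq_neg_of_add_eq_zero_left h, abs_neg])
  have e1 : w.im / ‖w - 1‖ ^ 2 = z.im / ‖((a - c : ℤ) * z + (b - d : ℤ) : ℂ)‖ ^ 2 := by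
    have : ((a - c : ℤ) * z + (b - d : ℤ) : ℂ) = (w - 1) * (c * z + d) := by
      push_cast; linear_combination -eq
    rw [this, im_of_moved det eq h0, norm_mul, div_div, mul_pow, mul_comm]
  have e2 : w.im / ‖w + 1‖ ^ 2 = z.im / ‖((a + c : ℤ) * z + (b + d : ℤ) : ℂ)‖ ^ 2 := by
    have : ((a + c : ℤ) * z + (b + d : ℤ) : ℂ) = (w + 1) * (c * z + d) := by
      push_cast; linear_combination -eq
    rw [this, im_of_moved det eq h0, norm_mul, div_div, mul_pow, mul_comm]
  have b1 := height_le_of_ne_zero hn hz hre h1 (b - d)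
  have b2 := height_le_of_ne_zero hn hz hre h2 (b + d)
  rw [cuspV, e1, e2]
  constructor <;> linarith [b1.1, b1.2, b2.1, b2.2]

/-- The contribution of the terminal point of the reduction. -/
def endBound (n : ℕ) (z : ℂ) : ℝ := (3 + 2 * cuspSum n z) * (1 + Real.log (2 + 2 * n))

open Classical in
/-- The number of possible states of the reduction at level at least `m`. -/
def stateCount (n : ℕ) (m : ℤ) (x : ℝ) : ℕ :=
  (((Finset.Icc (1 : ℤ) (2 * n)) ×ˢ (Finset.Icc (1 : ℤ) (2 * n))).filter
    fun p => 2 * m ≤ p.1 + p.2 ∧ NearSide p.1 p.2 x).card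

theorem Moved.stateCount_lt {n : ℕ} {z w : ℂ} {a b c d : ℤ} (h : Moved z w a b c d)
    (hz : 0 < z.im) (hw : ‖w‖ < 1) (hn : |a| ≤ n) {m : ℤ} (hm : |a| < m) :
    stateCount n m z.re + 1 ≤ stateCount n |a| z.re := by
  classical
  have h1 := (h.abs_lt_one hz hw).1
  obtain ⟨a', b', c', d', e1, e2, e3⟩ : ∃ a' b' c' d' : ℤ, a' = |a| ∧ |c'| < a' ∧
      a' * d' - b' * c' = 1 ∧ |((a' ^ 2 - c' ^ 2 : ℤ) : ℝ) * z.re + (a' * b' - c' * d' : ℤ)| < 1 := by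
    have hl := h.lt
    rcases abs_cases a with ⟨h2, h3⟩ | ⟨h2, h3⟩
    · exact ⟨a, b, c, d, h2.symm, by rwa [h2] at hl, h.det, h1⟩
    · refine ⟨-a, -b, -c, -d, h2.symm, by rwa [h2, ← abs_neg c] at hl, by linarith [h.det], ?_⟩
      convert h1 using 2
      push_cast; ring
  rw [← e1] at hn hm ⊢
  obtain ⟨h2, h3⟩ := abs_lt.1 e2
  have hn' : (n : ℤ) = n := rfl
  refine Finset.card_lt_card ((Finset.ssubset_iff_of_subset ?_).2 ⟨(a' - c', a' + c'), ?_, ?_⟩)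
  · intro p hp
    rw [Finset.mem_filter] at hp ⊢
    exact ⟨hp.1, by linarith [hp.2.1], hp.2.2⟩
  · rw [Finset.mem_filter, Finset.mem_product, Finset.mem_Icc, Finset.mem_Icc]
    exact ⟨⟨⟨by simp only; omega, by simp only; omega⟩, ⟨by simp only; omega, by simp only; omega⟩⟩,
      by simp only; omega, a', b', c', d', rfl, rfl, e3⟩
  · rw [Finset.mem_filter]
    rintro ⟨_, h4, _⟩
    simp only at h4
    omega

theorem im_mul_norm_glob_of_one_le {K C : ℝ} (hK : 0 < K) (hC : 0 ≤ C)
    (hB : ∀ ψ C, IsBloch ψ C → ∀ z ∈ fdD,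
      z.im * ‖locB ψ z‖ ≤ K * C * cuspV z * (1 + Real.log (1 + cuspV z)))
    {φ : Bool → ℂ → ℂ} (h : BlochPair φ C) {n : ℕ} (hn : 1 ≤ n) {z : ℂ} (hz : z.im = 1 / n)
    (hre : |z.re| ≤ 1) {τ : ℂ} (hτ : 0 < τ.im) (h1 : 1 ≤ ‖redStrip τ‖)
    {a b c d : ℤ} (det : a * d - b * c = 1) (eq : redStrip τ * (c * z + d) = a * z + b)
    (hne : |a| ≠ |c|) (i : Bool) : τ.im * ‖glob φ i τ‖ ≤ K * C * endBound n z := by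
  have hD := redStrip_mem_fdD hτ h1
  have hV := cuspV_le_of_moved hn hz hre det eq hne
  have hV1 := one_le_cuspV hD.1
  have h2 := hB _ C (h.bloch !i) _ hD
  rw [redStrip_im] at h2
  rw [glob_of_one_le φ i h1]
  refine h2.trans ?_
  rw [endBound, mul_assoc (K * C)]
  have hl : Real.log (1 + cuspV (redStrip τ)) ≤ Real.log (2 + 2 * n) :=
    Real.log_le_log (by linarith) (by linarith [hV.2])
  have hl0 : 0 ≤ Real.log (1 + cuspV (redStrip τ)) := Real.log_nonneg (by linarith)
  exact mul_le_mul_of_nonneg_left (mul_le_mul hV.1 (by linarith) (by linarith)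
    (by linarith [hV.1])) (by positivity)

theorem im_mul_norm_glob_le_of_moved {K C : ℝ} (hK : 0 < K) (hC : 0 ≤ C)
    (hB : ∀ ψ C, IsBloch ψ C → ∀ z ∈ fdD,
      z.im * ‖locB ψ z‖ ≤ K * C * cuspV z * (1 + Real.log (1 + cuspV z)))
    {φ : Bool → ℂ → ℂ} (h : BlochPair φ C) {n : ℕ} (hn : 1 ≤ n) {z : ℂ} (hz : z.im = 1 / n)
    (hre : |z.re| ≤ 1) : ∀ (k : ℕ) (w τ : ℂ) (a b c d : ℤ), 0 < τ.im → redStrip τ = w →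
    Moved z w a b c d → (n : ℤ) ≤ |a| + k → ∀ i,
    τ.im * ‖glob φ i τ‖ ≤ C * stateCount n |a| z.re + K * C * endBound n z := by
  have hn' : (1 : ℝ) ≤ n := by exact_mod_cast hn
  have hy : 0 < z.im := by rw [hz]; positivity
  have hny : n * z.im = 1 := by rw [hz]; field_simp
  have hfin : ∀ (w τ : ℂ) (a b c d : ℤ), 0 < τ.im → redStrip τ = w → 1 ≤ ‖w‖ →
      Moved z w a b c d → ∀ i,
      τ.im * ‖glob φ i τ‖ ≤ C * stateCount n |a| z.re + K * C * endBound n z := by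
    intro w τ a b c d hτ hw h1 hm i
    have := im_mul_norm_glob_of_one_le hK hC hB h hn hz hre hτ (by rwa [hw]) hm.det
      (by rw [hw]; exact hm.eq) hm.lt.ne' i
    have h2 : 0 ≤ C * stateCount n |a| z.re := by positivity
    linarith
  intro k
  induction k with
  | zero =>
    intro w τ a b c d hτ hw hm hk i
    refine hfin w τ a b c d hτ hw ?_ hm i
    by_contra! hlt
    have h1 := hm.abs_mul_im_lt hy hlt
    have h2 : (n : ℝ) ≤ (|a| : ℝ) := by
      have : (n : ℤ) ≤ |a| := by simpa using hk
      exact_mod_cast this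
    nlinarith
  | succ k ih =>
    intro w τ a b c d hτ hw hm hk i
    rcases le_or_gt 1 ‖w‖ with h1 | h1
    · exact hfin w τ a b c d hτ hw h1 hm i
    have hwi : 0 < w.im := by rw [← hw, redStrip_im]; exact hτ
    have hw0 := ne_zero_of_im_pos hwi
    have hτ' := im_neg_one_div hwi
    have han : |a| ≤ n := by
      have h2 := hm.abs_mul_im_lt hy h1
      have h3 : (|a| : ℝ) ≤ n := by nlinarith
      exact_mod_cast h3
    have hstep : τ.im * ‖glob φ i τ‖ ≤ C + (-1 / w).im * ‖glob φ (!i) (-1 / w)‖ := by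
      rw [glob_of_lt_one φ i hτ (by rwa [hw]), hw, slashS, im_neg_one_div_eq,
        Complex.normSq_eq_norm_sq]
      have e : τ.im = w.im := by rw [← hw, redStrip_im]
      rw [e]
      have h2 := (h.bloch i).bound w hwi
      rw [le_div_iff₀ hwi] at h2
      calc w.im * ‖φ i w - glob φ (!i) (-1 / w) / w ^ 2‖
          ≤ w.im * (‖φ i w‖ + ‖glob φ (!i) (-1 / w) / w ^ 2‖) :=
            mul_le_mul_of_nonneg_left (norm_sub_le _ _) hwi.le
        _ = ‖φ i w‖ * w.im + w.im / ‖w‖ ^ 2 * ‖glob φ (!i) (-1 / w)‖ := by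
            rw [norm_div, norm_pow]; ring
        _ ≤ _ := by linarith
    obtain ⟨l, hl⟩ := redStrip_redStep w
    rcases eq_or_ne l 0 with rfl | hl0
    · have hrs : redStrip (-1 / w) = -1 / w := by simpa using hl
      have h3 := im_mul_norm_glob_of_one_le hK hC hB h hn hz hre hτ'
        (by rw [hrs]; exact (one_lt_norm_neg_one_div hw0 h1).le)
        (a := -c) (b := -d) (c := a) (d := b) (by linear_combination hm.det)
        (by
          rw [hrs, div_mul_eq_mul_div, div_eq_iff hw0]
          push_cast
          linear_combination hm.eq) (by rw [abs_neg]; exact hm.lt.ne) (!i)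
      have h4 := hm.stateCount_lt hy h1 han (lt_add_one _)
      have h5 : (1 : ℝ) ≤ stateCount n |a| z.re := by
        exact_mod_cast (Nat.le_add_left 1 _).trans h4
      nlinarith
    · obtain ⟨h2, h3⟩ := hm.next hw0 hl0
      have h4 := ih _ (-1 / w) _ _ _ _ hτ' hl h2 (by push_cast at hk; omega) (!i)
      have h5 := hm.stateCount_lt hy h1 han h3
      have h6 : (stateCount n |-(c + 2 * l * a)| z.re : ℝ) + 1 ≤ stateCount n |a| z.re := by
        exact_mod_cast h5
      nlinarith

theorem exists_norm_glob_le : ∃ K : ℝ, 0 < K ∧ ∀ (φ : Bool → ℂ → ℂ) (C : ℝ), BlochPair φ C →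
    ∀ n : ℕ, 1 ≤ n → ∀ z : ℂ, z.im = 1 / n → |z.re| < 1 → ∀ i,
    z.im * ‖glob φ i z‖ ≤ C * stateCount n 1 z.re + K * C * endBound n z := by
  obtain ⟨K, hK, hB⟩ := exists_norm_locB_le
  refine ⟨K, hK, fun φ C h n hn z hz hre i => ?_⟩
  have hn' : (1 : ℝ) ≤ n := by exact_mod_cast hn
  have hy : 0 < z.im := by rw [hz]; positivity
  have := im_mul_norm_glob_le_of_moved hK (h.bloch i).nonneg hB h hn hz hre.le n z z 1 0 0 1 hy
    (redStrip_of_abs_lt hre) (Moved.self z) (by simp) i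
  simpa using this

theorem exists_nearSide_cover {u v : ℤ} (hu : 1 ≤ u) (hv : 1 ≤ v) : ∃ S : Finset ℝ, S.card ≤ 4 ∧
    ∀ x : ℝ, |x| ≤ 1 → NearSide u v x → ∃ s ∈ S, |x - s| < 1 / (u * v) := by
  classical
  by_cases hex : ∃ a b c d : ℤ, a - c = u ∧ a + c = v ∧ a * d - b * c = 1
  swap
  · exact ⟨∅, by simp, fun x _ ⟨a, b, c, d, h1, h2, h3, _⟩ => absurd ⟨a, b, c, d, h1, h2, h3⟩ hex⟩
  obtain ⟨a, b, c, d, h1, h2, h3⟩ := hex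
  have hu' : (1 : ℝ) ≤ u := by exact_mod_cast hu
  have hv' : (1 : ℝ) ≤ v := by exact_mod_cast hv
  have hD : (1 : ℝ) ≤ u * v := by nlinarith
  have hD0 : (0 : ℝ) < u * v := by linarith
  set r : ℝ := -((a * b - c * d : ℤ) : ℝ) / (u * v) with hr
  refine ⟨(Finset.Icc (⌊r⌋ - 1) (⌊r⌋ + 2)).image fun k : ℤ => r - k, ?_, ?_⟩
  · refine Finset.card_image_le.trans ?_
    rw [Int.card_Icc]; omega
  rintro x hx ⟨a', b', c', d', e1, e2, e3, e4⟩
  obtain rfl : a' = a := by omega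
  obtain rfl : c' = c := by omega
  set k := b' * d - d' * b with hk
  have hm : a' * b' - c' * d' = (a' * b - c' * d) + k * (u * v) := by
    have hb : b' = b + a' * k := by
      rw [hk]; linear_combination b * e3 - b' * h3
    have hd : d' = d + c' * k := by
      rw [hk]; linear_combination d * e3 - d' * h3
    rw [hb, hd, ← h1, ← h2]; ring
  have hDe : ((a' ^ 2 - c' ^ 2 : ℤ) : ℝ) = u * v := by
    rw [← h1, ← h2]; push_cast; ring
  have e5 : |x - (r - k)| < 1 / (u * v) := by
    rw [lt_div_iff₀ hD0, ← abs_of_pos hD0, ← abs_mul]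
    rw [hDe, hm] at e4
    refine lt_of_eq_of_lt (congrArg _ ?_) e4
    rw [hr]
    push_cast
    field_simp
    ring
  refine ⟨r - k, Finset.mem_image.2 ⟨k, ?_, rfl⟩, e5⟩
  have e6 : |x - (r - k)| < 1 := e5.trans_le ((div_le_one hD0).2 hD)
  obtain ⟨e7, e8⟩ := abs_lt.1 e6
  obtain ⟨e9, e10⟩ := abs_le.1 hx
  have f1 := Int.floor_le r
  have f2 := Int.lt_floor_add_one r
  have g1 : (⌊r⌋ : ℝ) - 2 < k := by linarith
  have g2 : (k : ℝ) < ⌊r⌋ + 3 := by linarith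
  have g3 : ⌊r⌋ - 2 < k := by exact_mod_cast g1
  have g4 : k < ⌊r⌋ + 3 := by exact_mod_cast g2
  rw [Finset.mem_Icc]
  omega

/-- Lebesgue measure on `(-1, 1)`. -/
def unitMeas : Measure ℝ := volume.restrict (Set.Ioo (-1) 1)

instance : IsFiniteMeasure unitMeas := by
  rw [unitMeas]; infer_instance

theorem exists_stateCount_majorant (n : ℕ) : ∃ H : ℝ → ℝ, Integrable H unitMeas ∧
    (∀ x, |x| ≤ 1 → (stateCount n 1 x : ℝ) ≤ H x) ∧
    ∫ x, H x ∂unitMeas ≤ 8 * (∑ u ∈ Finset.Icc (1 : ℤ) (2 * n), (1 / u : ℝ)) ^ 2 := by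
  classical
  have hS : ∀ p : ℤ × ℤ, ∃ S : Finset ℝ, S.card ≤ 4 ∧ (1 ≤ p.1 → 1 ≤ p.2 → 
    ∀ x : ℝ, |x| ≤ 1 → NearSide p.1 p.2 x → ∃ s ∈ S, |x - s| < 1 / (p.1 * p.2)) := by
    intro p
    by_cases hp : 1 ≤ p.1 ∧ 1 ≤ p.2
    · obtain ⟨S, h1, h2⟩ := exists_nearSide_cover hp.1 hp.2
      exact ⟨S, h1, fun _ _ => h2⟩
    · exact ⟨∅, by simp, fun h1 h2 => absurd ⟨h1, h2⟩ hp⟩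
  choose S hS4 hS using hS
  set B : ℤ × ℤ → ℝ → Set ℝ := fun p s => Set.Ioo (s - 1 / (p.1 * p.2)) (s + 1 / (p.1 * p.2)) with hB
  set P := (Finset.Icc (1 : ℤ) (2 * n)) ×ˢ (Finset.Icc (1 : ℤ) (2 * n)) with hP
  have hmem : ∀ p ∈ P, 1 ≤ p.1 ∧ 1 ≤ p.2 := fun p hp => by
    rw [hP, Finset.mem_product, Finset.mem_Icc, Finset.mem_Icc] at hp
    exact ⟨hp.1.1, hp.2.1⟩
  have hintg : ∀ p s, Integrable ((B p s).indicator (1 : ℝ → ℝ)) unitMeas := fun p s =>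
    (integrable_const (1 : ℝ)).indicator measurableSet_Ioo
  refine ⟨fun x => ∑ p ∈ P, ∑ s ∈ S p, (B p s).indicator 1 x, ?_, ?_, ?_⟩
  · exact integrable_finsetSum _ fun p _ => integrable_finsetSum _ fun s _ => hintg p s
  · intro x hx
    rw [stateCount, Finset.card_filter, Nat.cast_sum]
    refine Finset.sum_le_sum fun p hp => ?_
    have h0 : ∀ s, 0 ≤ (B p s).indicator (1 : ℝ → ℝ) x := fun s =>
      Set.indicator_nonneg (fun _ _ => zero_le_one) x
    split_ifs with h
    · obtain ⟨s, hs, h1⟩ := hS p (hmem p hp).1 (hmem p hp).2 x hx h.2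
      have h2 : x ∈ B p s := by
        obtain ⟨h3, h4⟩ := abs_lt.1 h1
        exact ⟨by linarith, by linarith⟩
      have h3 := Finset.single_le_sum (f := fun s => (B p s).indicator (1 : ℝ → ℝ) x)
        (fun s _ => h0 s) hs
      simp only [Set.indicator_of_mem h2] at h3
      simpa using h3
    · simpa using Finset.sum_nonneg fun s _ => h0 s
  · rw [integral_finsetSum _ fun p _ => integrable_finsetSum _ fun s _ => hintg p s]
    have h1 : ∀ p ∈ P, ∫ x, ∑ s ∈ S p, (B p s).indicator (1 : ℝ → ℝ) x ∂unitMeas ≤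
        8 * (1 / p.1 * (1 / p.2)) := by
      intro p hp
      have hp1 : (1 : ℝ) ≤ p.1 := by exact_mod_cast (hmem p hp).1
      have hp2 : (1 : ℝ) ≤ p.2 := by exact_mod_cast (hmem p hp).2
      have hpos : 0 < (1 / (p.1 * p.2) : ℝ) := by positivity
      rw [integral_finsetSum _ fun s _ => hintg p s]
      have h2 : ∀ s ∈ S p, ∫ x, (B p s).indicator (1 : ℝ → ℝ) x ∂unitMeas ≤
          2 * (1 / (p.1 * p.2)) := by
        intro s _
        rw [integral_indicator_one measurableSet_Ioo, unitMeas,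
          measureReal_restrict_apply measurableSet_Ioo]
        refine (measureReal_mono Set.inter_subset_left measure_Ioo_lt_top.ne).trans ?_
        rw [Real.volume_real_Ioo_of_le (by linarith)]
        linarith
      refine (Finset.sum_le_card_nsmul _ _ _ h2).trans ?_
      rw [nsmul_eq_mul]
      have h4 : ((S p).card : ℝ) ≤ 4 := by exact_mod_cast hS4 p
      have e : (1 / p.1 * (1 / p.2) : ℝ) = 1 / (p.1 * p.2) := by field_simp
      rw [e]
      nlinarith
    refine (Finset.sum_le_sum h1).trans_eq ?_
    rw [← Finset.mul_sum, hP, Finset.sum_product, sq, Finset.sum_mul_sum]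

theorem integral_height_le {y : ℝ} (hy : 0 < y) {q : ℤ} (hq : 1 ≤ q) (p : ℤ) :
    Integrable (fun x : ℝ => y / ‖(q * (x + y * I) + p : ℂ)‖ ^ 2) unitMeas ∧
    ∫ x : ℝ, y / ‖(q * (x + y * I) + p : ℂ)‖ ^ 2 ∂unitMeas ≤ Real.pi / q ^ 2 := by
  have hq' : (1 : ℝ) ≤ q := by exact_mod_cast hq
  have e : (fun x : ℝ => y / ‖(q * (x + y * I) + p : ℂ)‖ ^ 2) =
      fun x : ℝ => 1 / (q ^ 2 * y) * (1 + ((x + p / q) / y) ^ 2)⁻¹ := by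
    funext x
    rw [norm_linear_sq]
    simp only [add_re, ofReal_re, mul_re, I_re, mul_zero, ofReal_im, I_im, mul_one, sub_self,
      add_zero, add_im, mul_im, zero_add]
    have h1 : (q * x + p : ℝ) ^ 2 + (q * y) ^ 2 ≠ 0 := by positivity
    have h2 : 1 + ((x + p / q) / y) ^ 2 ≠ 0 := by positivity
    have h3 : (q * x + p : ℝ) ^ 2 + (q * y) ^ 2 = (q * y) ^ 2 * (1 + ((x + p / q) / y) ^ 2) := by
      field_simp; ring
    rw [h3]
    field_simp
  have hi : Integrable (fun x : ℝ => 1 / (q ^ 2 * y) * (1 + ((x + p / q) / y) ^ 2)⁻¹) :=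
    ((integrable_inv_one_add_sq.comp_div hy.ne').comp_add_right _).const_mul _
  rw [e, unitMeas]
  refine ⟨hi.integrableOn, (setIntegral_le_integral hi (Eventually.of_forall fun x => ?_)).trans ?_⟩
  · simp only [Pi.zero_apply]; positivity
  · rw [integral_const_mul]
    rw [integral_add_right_eq_self (μ := volume) (fun x : ℝ => (1 + (x / y) ^ 2)⁻¹)]
    rw [Measure.integral_comp_div (fun x : ℝ => (1 + x ^ 2)⁻¹), integral_univ_inv_one_add_sq, abs_of_pos hy,
      smul_eq_mul]
    apply le_of_eq
    field_simp

theorem sum_inv_Icc_le (n : ℕ) :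
    ∑ u ∈ Finset.Icc (1 : ℤ) n, (1 / u : ℝ) ≤ 1 + Real.log n := by
  refine le_trans (le_of_eq ?_) (harmonic_le_one_add_log n)
  rw [harmonic_eq_sum_Icc]
  push_cast
  refine Finset.sum_nbij' (fun u => u.toNat) (fun k => (k : ℤ)) ?_ ?_ ?_ ?_ ?_
  · intro a ha; rw [Finset.mem_Icc] at ha ⊢; omega
  · intro a ha; rw [Finset.mem_Icc] at ha ⊢; omega
  · intro a ha; rw [Finset.mem_Icc] at ha; omega
  · intro a ha; simp
  · intro a ha
    rw [Finset.mem_Icc] at ha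
    have : ((a.toNat : ℤ) : ℝ) = a := by rw [Int.toNat_of_nonneg (by omega)]
    rw [one_div, ← this, Int.cast_natCast]

theorem integral_cuspSum_le (n : ℕ) {y : ℝ} (hy : 0 < y) :
    Integrable (fun x : ℝ => cuspSum n (x + y * I)) unitMeas ∧
    ∫ x : ℝ, cuspSum n (x + y * I) ∂unitMeas ≤ 5 * Real.pi * (1 + Real.log n) := by
  have him : ∀ x : ℝ, ((x : ℂ) + y * I).im = y := fun x => by simp
  simp only [cuspSum, him]
  have hI : ∀ q ∈ Finset.Icc (1 : ℤ) n, Integrable (fun x : ℝ =>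
      ∑ p ∈ Finset.Icc (-(2 * q)) (2 * q), y / ‖(q * (x + y * I) + p : ℂ)‖ ^ 2) unitMeas :=
    fun q hq => integrable_finsetSum _ fun p _ =>
      (integral_height_le hy (Finset.mem_Icc.1 hq).1 p).1
  refine ⟨integrable_finsetSum _ hI, ?_⟩
  rw [integral_finsetSum _ hI]
  refine le_trans ?_ (mul_le_mul_of_nonneg_left (sum_inv_Icc_le n) (by positivity))
  rw [Finset.mul_sum]
  refine Finset.sum_le_sum fun q hq => ?_
  have hq1 := (Finset.mem_Icc.1 hq).1
  have hq' : (1 : ℝ) ≤ q := by exact_mod_cast hq1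
  rw [integral_finsetSum _ fun p _ => (integral_height_le hy hq1 p).1]
  refine (Finset.sum_le_card_nsmul _ _ _ fun p _ => (integral_height_le hy hq1 p).2).trans ?_
  rw [nsmul_eq_mul, Int.card_Icc]
  have h1 : (((2 * q + 1 - -(2 * q)).toNat : ℕ) : ℝ) = 4 * q + 1 := by
    have : (((2 * q + 1 - -(2 * q)).toNat : ℤ) : ℝ) = 4 * q + 1 := by
      rw [Int.toNat_of_nonneg (by omega)]; push_cast; ring
    exact_mod_cast this
  rw [h1]
  have h2 : 5 * Real.pi * (1 / q) = 5 * q * (Real.pi / q ^ 2) := by field_simp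
  rw [h2]
  exact mul_le_mul_of_nonneg_right (by linarith) (by positivity)

theorem log_estimates {n : ℕ} (hn : 1 ≤ n) : 1 ≤ Real.log (2 + n) ∧
    1 + Real.log n ≤ 2 * Real.log (2 + n) ∧ 1 + Real.log (2 * n) ≤ 3 * Real.log (2 + n) ∧
    1 + Real.log (2 + 2 * n) ≤ 3 * Real.log (2 + n) := by
  have hn' : (1 : ℝ) ≤ n := by exact_mod_cast hn
  have h1 : 1 ≤ Real.log (2 + n) := by
    rw [Real.le_log_iff_exp_le (by linarith)]
    linarith [Real.exp_one_lt_d9]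
  have h2 : Real.log 2 ≤ 1 := by linarith [Real.log_two_lt_d9]
  have h3 : Real.log n ≤ Real.log (2 + n) := Real.log_le_log (by linarith) (by linarith)
  have h4 : Real.log (2 * n) = Real.log 2 + Real.log n := Real.log_mul two_ne_zero (by positivity)
  have h5 : Real.log (2 + 2 * n) = Real.log 2 + Real.log (1 + n) := by
    rw [← Real.log_mul two_ne_zero (by positivity)]; congr 1; ring
  have h6 : Real.log (1 + n) ≤ Real.log (2 + n) := Real.log_le_log (by linarith) (by linarith)
  refine ⟨h1, ?_, ?_, ?_⟩ <;> linarith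

theorem exists_integral_glob_le : ∃ K : ℝ, 0 < K ∧ ∀ (φ : Bool → ℂ → ℂ) (C : ℝ), BlochPair φ C →
    ∀ n : ℕ, 1 ≤ n → ∀ i, ∫ x : ℝ, ‖glob φ i (x + ((1 / n : ℝ) : ℂ) * I)‖ ∂unitMeas ≤
      K * C * n * Real.log (2 + n) ^ 3 := by
  obtain ⟨K, hK, hB⟩ := exists_norm_glob_le
  refine ⟨8 * 9 + K * ((3 * 2 + 2 * (10 * Real.pi)) * 3), by positivity, fun φ C h n hn i => ?_⟩
  have hC : 0 ≤ C := (h.bloch i).nonneg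
  have hn' : (1 : ℝ) ≤ n := by exact_mod_cast hn
  have hy : 0 < (1 / n : ℝ) := by positivity
  obtain ⟨H, hHi, hH, hHint⟩ := exists_stateCount_majorant n
  obtain ⟨hci, hc⟩ := integral_cuspSum_le n hy
  obtain ⟨l1, l2, l3, l4⟩ := log_estimates hn
  set L := Real.log (2 + n) with hL
  set E := 1 + Real.log (2 + 2 * n) with hE
  have hE0 : 0 ≤ E := by
    have : 0 ≤ Real.log (2 + 2 * n) := Real.log_nonneg (by linarith)
    linarith
  set g : ℝ → ℝ := fun x => n * (C * H x + K * C * E * (3 + 2 * cuspSum n (x + ((1 / n : ℝ) : ℂ) * I)))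
    with hg
  have hi2 : Integrable (fun x : ℝ => 3 + 2 * cuspSum n (x + ((1 / n : ℝ) : ℂ) * I)) unitMeas :=
    (integrable_const _).add (hci.const_mul 2)
  have hgi : Integrable g unitMeas :=
    ((hHi.const_mul C).add (hi2.const_mul _)).const_mul _
  have h1 : ∫ x : ℝ, ‖glob φ i (x + ((1 / n : ℝ) : ℂ) * I)‖ ∂unitMeas ≤ ∫ x, g x ∂unitMeas := by
    refine integral_mono_of_nonneg (Eventually.of_forall fun _ => norm_nonneg _) hgi ?_
    rw [unitMeas]
    filter_upwards [ae_restrict_mem measurableSet_Ioo] with x hx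
    have hre : ((x : ℂ) + ((1 / n : ℝ) : ℂ) * I).re = x := by simp
    have him : ((x : ℂ) + ((1 / n : ℝ) : ℂ) * I).im = 1 / n := by simp
    have hx1 : |x| < 1 := abs_lt.2 hx
    have h2 := hB φ C h n hn _ him (by rw [hre]; exact hx1) i
    rw [hre, him, endBound, div_mul_eq_mul_div, one_mul, div_le_iff₀ (by linarith)] at h2
    have h3 := mul_le_mul_of_nonneg_left (hH x hx1.le) hC
    refine h2.trans ?_
    simp only [hg]
    rw [mul_comm (n : ℝ)]
    refine mul_le_mul_of_nonneg_right ?_ (by linarith)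
    rw [← hE]
    linarith
  refine h1.trans ?_
  have hH2 : ∫ x, H x ∂unitMeas ≤ 8 * (9 * L ^ 2) := by
    refine hHint.trans ?_
    have h2 := sum_inv_Icc_le (2 * n)
    push_cast at h2
    have h3 : 0 ≤ ∑ u ∈ Finset.Icc (1 : ℤ) (2 * n), (1 / u : ℝ) :=
      Finset.sum_nonneg fun u hu => by
        have : (0 : ℝ) ≤ u := by exact_mod_cast (zero_le_one.trans (Finset.mem_Icc.1 hu).1)
        positivity
    have h4 := pow_le_pow_left₀ h3 (h2.trans l3) 2
    rw [mul_pow] at h4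
    linarith
  have hvol : unitMeas.real Set.univ = 2 := by
    rw [unitMeas, measureReal_restrict_apply MeasurableSet.univ, Set.univ_inter,
      Real.volume_real_Ioo_of_le (by norm_num)]
    norm_num
  have hintg : ∫ x, g x ∂unitMeas = n * (C * ∫ x, H x ∂unitMeas + K * C * E * (3 * 2 +
      2 * ∫ x : ℝ, cuspSum n (x + ((1 / n : ℝ) : ℂ) * I) ∂unitMeas)) := by
    rw [hg, integral_const_mul, integral_add (hHi.const_mul C)
      (hi2.const_mul _), integral_const_mul,
      integral_const_mul, integral_add (integrable_const _) (hci.const_mul 2), integral_const,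
      integral_const_mul, hvol, smul_eq_mul]
    ring
  rw [hintg]
  have hπ := Real.pi_pos
  have hc2 : 3 * 2 + 2 * ∫ x : ℝ, cuspSum n (x + ((1 / n : ℝ) : ℂ) * I) ∂unitMeas ≤
      (3 * 2 + 2 * (10 * Real.pi)) * L := by
    have : 5 * Real.pi * (1 + Real.log n) ≤ 5 * Real.pi * (2 * L) :=
      mul_le_mul_of_nonneg_left l2 (by positivity)
    linarith
  have hL2 : L ^ 2 ≤ L ^ 3 := pow_le_pow_right₀ l1 (by norm_num)
  calc n * (C * ∫ x, H x ∂unitMeas + K * C * E * (3 * 2 +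
      2 * ∫ x : ℝ, cuspSum n (x + ((1 / n : ℝ) : ℂ) * I) ∂unitMeas))
      ≤ n * (C * (8 * (9 * L ^ 2)) + K * C * (3 * L) * ((3 * 2 + 2 * (10 * Real.pi)) * L)) := by
        refine mul_le_mul_of_nonneg_left (add_le_add (mul_le_mul_of_nonneg_left hH2 hC) ?_)
          (by linarith)
        refine (mul_le_mul_of_nonneg_left hc2 (by positivity)).trans ?_
        exact mul_le_mul_of_nonneg_right (mul_le_mul_of_nonneg_left l4 (by positivity))
          (by positivity)
    _ = (8 * 9 + K * ((3 * 2 + 2 * (10 * Real.pi)) * 3)) * C * n * L ^ 2 := by ring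
    _ ≤ _ := mul_le_mul_of_nonneg_left hL2 (by positivity)

theorem qParam_two_eq (z : ℂ) : Function.Periodic.qParam 2 z = exp (I * Real.pi * z) := by
  rw [Function.Periodic.qParam]; congr 1; push_cast; ring

theorem qParam_two_pow (z : ℂ) (n : ℕ) :
    Function.Periodic.qParam 2 z ^ n = exp (I * Real.pi * n * z) := by
  rw [qParam_two_eq, ← Complex.exp_nat_mul]; congr 1; ring

theorem integral_norm_circleMap_eq {f : ℂ → ℂ} (hper : ∀ z, f (z + 2) = f z) (y : ℝ) :
    ∫ θ : ℝ in 0..2 * Real.pi, ‖Function.Periodic.cuspFunction 2 f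
      (circleMap 0 (Real.exp (-Real.pi * y)) θ)‖ =
    Real.pi * ∫ x : ℝ, ‖f (x + y * I)‖ ∂unitMeas := by
  have hP : Function.Periodic f ((2 : ℝ) : ℂ) := fun z => by simpa using hper z
  have hπ := Real.pi_pos
  have h1 : ∀ θ : ℝ, Function.Periodic.cuspFunction 2 f (circleMap 0 (Real.exp (-Real.pi * y)) θ) =
      f ((θ / Real.pi : ℝ) + y * I) := by
    intro θ
    rw [← Function.Periodic.eq_cuspFunction two_ne_zero hP, qParam_two_eq]
    congr 1
    rw [circleMap, zero_add, ofReal_exp, ← Complex.exp_add]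
    congr 1
    push_cast
    have : (Real.pi : ℂ) ≠ 0 := by exact_mod_cast hπ.ne'
    field_simp
    linear_combination (-(y : ℂ) * Real.pi) * I_sq
  simp only [h1]
  rw [intervalIntegral.integral_comp_div (fun x : ℝ => ‖f (x + y * I)‖) hπ.ne', zero_div,
    mul_div_cancel_right₀ _ hπ.ne', smul_eq_mul]
  congr 1
  have hp : Function.Periodic (fun x : ℝ => ‖f (x + y * I)‖) 2 := fun x => by
    simp only
    rw [← hper (x + y * I)]; congr 2; push_cast; ring
  have := hp.intervalIntegral_add_eq 0 (-1)
  norm_num at this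
  rw [this, intervalIntegral.integral_of_le (by norm_num), integral_Ioc_eq_integral_Ioo, unitMeas]

/-- The Fourier expansion of a function of period two on the upper half-plane that is bounded
near the cusp. -/
theorem exists_fourier_expansion {f : ℂ → ℂ} (hper : ∀ z, f (z + 2) = f z)
    (hd : ∀ z : ℂ, 0 < z.im → DifferentiableAt ℂ f z) {Y M : ℝ}
    (hb : ∀ z : ℂ, Y ≤ z.im → ‖f z‖ ≤ M) : ∃ c : ℕ → ℂ,
    (∀ z : ℂ, 0 < z.im → HasSum (fun n : ℕ => c n * exp (I * Real.pi * n * z)) (f z)) ∧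
    (∀ n : ℕ, ∀ y : ℝ, 0 < y → ‖c n‖ ≤
      Real.exp (Real.pi * n * y) / 2 * ∫ x : ℝ, ‖f (x + y * I)‖ ∂unitMeas) ∧
    c 0 = Function.Periodic.cuspFunction 2 f 0 := by
  have hP : Function.Periodic f ((2 : ℝ) : ℂ) := fun z => by simpa using hper z
  set g := Function.Periodic.cuspFunction 2 f with hg
  have hgd : DifferentiableOn ℂ g (Metric.ball 0 1) := differentiableOn_cuspFunction_two hper hd hb
  have hser : ∀ r : ℝ, 0 < r → r < 1 →
      HasFPowerSeriesOnBall g (cauchyPowerSeries g 0 r) 0 (ENNReal.ofReal r) := by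
    intro r h0 h1
    lift r to NNReal using h0.le
    rw [ENNReal.ofReal_coe_nnreal]
    exact (hgd.mono (Metric.closedBall_subset_ball h1)).hasFPowerSeriesOnBall (by exact_mod_cast h0)
  set p := cauchyPowerSeries g 0 (1 / 2) with hp
  have hpeq : ∀ r : ℝ, 0 < r → r < 1 → cauchyPowerSeries g 0 r = p := fun r h0 h1 =>
    (hser r h0 h1).hasFPowerSeriesAt.eq_formalMultilinearSeries
      (hser (1 / 2) (by norm_num) (by norm_num)).hasFPowerSeriesAt
  refine ⟨p.coeff, fun z hz => ?_, fun n y hy => ?_, ?_⟩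
  · have hq1 := Function.Periodic.norm_qParam_lt_one (h := 2) two_pos hz
    set q := Function.Periodic.qParam 2 z with hq
    obtain ⟨r, hr1, hr2⟩ := exists_between hq1
    have h0 : 0 < r := (norm_nonneg _).trans_lt hr1
    have h1 := (hser r h0 hr2).hasSum (y := q) (by
      rw [Metric.mem_eball, edist_zero_right, ← ofReal_norm, ENNReal.ofReal_lt_ofReal_iff h0]
      exact hr1)
    rw [hpeq r h0 hr2, zero_add, hg, hq, Function.Periodic.eq_cuspFunction two_ne_zero hP] at h1
    refine h1.congr_fun ?_
    intro n
    rw [FormalMultilinearSeries.apply_eq_pow_smul_coeff, smul_eq_mul, ← qParam_two_pow, mul_comm]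
  · set r := Real.exp (-Real.pi * y) with hr
    have hr0 : 0 < r := Real.exp_pos _
    have hr1 : r < 1 := by
      rw [hr, Real.exp_lt_one_iff]
      nlinarith [Real.pi_pos, mul_pos Real.pi_pos hy]
    rw [← FormalMultilinearSeries.norm_apply_eq_norm_coef, ← hpeq r hr0 hr1]
    refine (norm_cauchyPowerSeries_le _ _ _ _).trans (le_of_eq ?_)
    rw [hr, hg, integral_norm_circleMap_eq hper, abs_of_pos (Real.exp_pos _), ← Real.exp_neg,
      ← Real.exp_nat_mul]
    have hπ := Real.pi_pos.ne'
    have : (n : ℝ) * -(-Real.pi * y) = Real.pi * n * y := by ring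
    rw [this]
    field_simp
  · exact (hser (1 / 2) (by norm_num) (by norm_num)).coeff_zero _

theorem redStrip_redStep_iterate_add_two (z : ℂ) (n : ℕ) :
    redStrip (redStep^[n] (z + 2)) = redStrip (redStep^[n] z) := by
  cases n with
  | zero => exact redStrip_add_two z
  | succ n => rw [Function.iterate_succ_apply, Function.iterate_succ_apply, redStep,
      redStrip_add_two, ← redStep]

theorem globAux_add_two (φ : Bool → ℂ → ℂ) (n : ℕ) (i : Bool) (z : ℂ) :
    globAux φ n i (z + 2) = globAux φ n i z := by
  cases n with
  | zero => rw [globAux, globAux, redStrip_add_two]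
  | succ n => rw [globAux, globAux, redStrip_add_two, redStep, redStrip_add_two, ← redStep]

theorem glob_periodic (φ : Bool → ℂ → ℂ) (i : Bool) (z : ℂ) : glob φ i (z + 2) = glob φ i z := by
  classical
  by_cases h : ∃ n, 1 ≤ ‖redStrip (redStep^[n] z)‖
  · have h' : ∃ n, 1 ≤ ‖redStrip (redStep^[n] (z + 2))‖ := by
      simpa only [redStrip_redStep_iterate_add_two] using h
    have e : Nat.find h' = Nat.find h :=
      Nat.find_congr' fun {n} => by rw [redStrip_redStep_iterate_add_two]
    rw [glob, glob, dif_pos h, dif_pos h', e, globAux_add_two]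
  · have h' : ¬ ∃ n, 1 ≤ ‖redStrip (redStep^[n] (z + 2))‖ := by
      simpa only [redStrip_redStep_iterate_add_two] using h
    rw [glob, glob, dif_neg h, dif_neg h']

theorem exists_norm_glob_le_of_one_le_im : ∃ K : ℝ, 0 < K ∧ ∀ (φ : Bool → ℂ → ℂ) (C : ℝ),
    BlochPair φ C → ∀ i, ∀ z : ℂ, 1 ≤ z.im → z.im * ‖glob φ i z‖ ≤ K * C := by
  obtain ⟨K, hK, hB⟩ := exists_norm_locB_le
  refine ⟨K * (3 * (1 + Real.log 4)), by have := Real.log_pos (show (1 : ℝ) < 4 by norm_num); positivity,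
    fun φ C h i z hz => ?_⟩
  have hy : 0 < z.im := by linarith
  have h1 : 1 ≤ ‖redStrip z‖ := by
    refine le_trans ?_ (Complex.abs_im_le_norm _)
    rwa [redStrip_im, abs_of_pos hy]
  have hD := redStrip_mem_fdD hy h1
  have h2 := hB _ C (h.bloch !i) _ hD
  have hV1 := one_le_cuspV hD.1
  have key : ∀ w : ℂ, w.im = z.im → z.im / ‖w‖ ^ 2 ≤ 1 := by
    intro w hw
    have h3 : z.im ≤ ‖w‖ := by
      rw [← hw]; exact (le_abs_self _).trans (Complex.abs_im_le_norm _)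
    rw [div_le_one (pow_pos (by linarith) 2)]
    nlinarith
  have hV : cuspV (redStrip z) ≤ 3 := by
    have k1 := key (redStrip z - 1) (by simp [redStrip_im])
    have k2 := key (redStrip z + 1) (by simp [redStrip_im])
    rw [cuspV, redStrip_im]
    linarith
  have hC : 0 ≤ C := (h.bloch i).nonneg
  rw [redStrip_im] at h2
  rw [glob_of_one_le φ i h1]
  refine h2.trans ?_
  have hl : Real.log (1 + cuspV (redStrip z)) ≤ Real.log 4 :=
    Real.log_le_log (by linarith) (by linarith)
  have hl0 : 0 ≤ Real.log (1 + cuspV (redStrip z)) := Real.log_nonneg (by linarith)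
  calc K * C * cuspV (redStrip z) * (1 + Real.log (1 + cuspV (redStrip z)))
      ≤ K * C * 3 * (1 + Real.log 4) := by gcongr
    _ = _ := by ring

theorem exists_glob_expansion : ∃ K : ℝ, 0 < K ∧ ∀ (φ : Bool → ℂ → ℂ) (C : ℝ), BlochPair φ C →
    ∀ i, ∃ c : ℕ → ℂ,
    (∀ z : ℂ, 0 < z.im → HasSum (fun n : ℕ => c n * exp (I * Real.pi * n * z)) (glob φ i z)) ∧
    (∀ n : ℕ, ‖c n‖ ≤ K * C * n * Real.log (2 + n) ^ 3) := by
  obtain ⟨K, hK, hintg⟩ := exists_integral_glob_le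
  obtain ⟨K', hK', hinf⟩ := exists_norm_glob_le_of_one_le_im
  refine ⟨Real.exp Real.pi / 2 * K, by positivity, fun φ C h i => ?_⟩
  have hb : ∀ z : ℂ, 1 ≤ z.im → ‖glob φ i z‖ ≤ K' * C / z.im := fun z hz => by
    rw [le_div_iff₀ (by linarith), mul_comm]; exact hinf φ C h i z hz
  have hC : 0 ≤ C := (h.bloch i).nonneg
  obtain ⟨c, h1, h2, h3⟩ := exists_fourier_expansion (glob_periodic φ i)
    (fun z hz => differentiableAt_glob h hz i) (Y := 1) (M := K' * C)
    (fun z hz => (hb z hz).trans (div_le_self (by positivity) hz))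
  refine ⟨c, h1, fun n => ?_⟩
  rcases Nat.eq_zero_or_pos n with rfl | hn
  · rw [h3, Function.Periodic.cuspFunction_zero_of_zero_at_inf two_pos]
    · simp
    · refine squeeze_zero_norm' (a := fun z : ℂ => K' * C / z.im) ?_ ?_
      · filter_upwards [preimage_mem_comap (Ici_mem_atTop 1)] with z hz using hb z hz
      · exact (tendsto_const_nhds.div_atTop tendsto_id).comp tendsto_comap
  · have h4 := h2 n (1 / n) (by positivity)
    refine h4.trans ?_
    have h5 : Real.pi * n * (1 / n) = Real.pi := by field_simp
    rw [h5]
    calc _ ≤ Real.exp Real.pi / 2 * (K * C * n * Real.log (2 + n) ^ 3) :=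
          mul_le_mul_of_nonneg_left (hintg φ C h n hn i) (by positivity)
      _ = _ := by ring

theorem summable_add_two_pow_mul_geometric (k : ℕ) {r : ℝ} (h0 : 0 < r) (h1 : r < 1) :
    Summable fun n : ℕ => (2 + n : ℝ) ^ k * r ^ n := by
  have h2 := (summable_nat_add_iff 2).2
    (summable_pow_mul_geometric_of_norm_lt_one k (r := r) (by rwa [Real.norm_of_nonneg h0.le]))
  refine (h2.mul_left (r ^ 2)⁻¹).congr fun n => ?_
  push_cast
  rw [pow_add]
  field_simp
  ring

theorem norm_exp_fourier (n : ℕ) (z : ℂ) :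
    ‖exp (I * Real.pi * n * z)‖ = Real.exp (-Real.pi * z.im) ^ n := by
  rw [← qParam_two_pow, norm_pow, norm_qParam_two]

theorem norm_exp_fourier_le {ε : ℝ} {z : ℂ} (hz : ε ≤ z.im) (n : ℕ) :
    ‖exp (I * Real.pi * n * z)‖ ≤ Real.exp (-Real.pi * ε) ^ n := by
  rw [norm_exp_fourier]
  have := Real.pi_pos
  exact pow_le_pow_left₀ (Real.exp_pos _).le (Real.exp_le_exp.2 (by nlinarith)) n

theorem exp_neg_pi_mul_lt_one {ε : ℝ} (hε : 0 < ε) : Real.exp (-Real.pi * ε) < 1 := by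
  rw [Real.exp_lt_one_iff]
  nlinarith [mul_pos Real.pi_pos hε]

/-- Coefficients of cubic growth. -/
def CubicGrowth (a : ℕ → ℂ) (M : ℝ) : Prop := ∀ n : ℕ, ‖a n‖ ≤ M * (2 + n) ^ 3

theorem CubicGrowth.nonneg {a : ℕ → ℂ} {M : ℝ} (h : CubicGrowth a M) : 0 ≤ M := by
  have := (norm_nonneg _).trans (h 0)
  norm_num at this
  linarith

theorem CubicGrowth.norm_term_le {a : ℕ → ℂ} {M : ℝ} (h : CubicGrowth a M) {ε : ℝ} {z : ℂ}
    (hz : ε ≤ z.im) (n : ℕ) :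
    ‖a n * exp (I * Real.pi * n * z)‖ ≤ M * ((2 + n) ^ 3 * Real.exp (-Real.pi * ε) ^ n) := by
  rw [norm_mul, ← mul_assoc]
  have := h.nonneg
  exact mul_le_mul (h n) (norm_exp_fourier_le hz n) (norm_nonneg _) (by positivity)

theorem CubicGrowth.summable {a : ℕ → ℂ} {M : ℝ} (h : CubicGrowth a M) {z : ℂ} (hz : 0 < z.im) :
    Summable fun n : ℕ => a n * exp (I * Real.pi * n * z) :=
  Summable.of_norm_bounded ((summable_add_two_pow_mul_geometric 3 (Real.exp_pos _)
    (exp_neg_pi_mul_lt_one hz)).mul_left M) fun n => h.norm_term_le le_rfl n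

/-- The sum of a Fourier series of period two. -/
def fser (a : ℕ → ℂ) (z : ℂ) : ℂ := ∑' n : ℕ, a n * exp (I * Real.pi * n * z)

theorem CubicGrowth.hasSum {a : ℕ → ℂ} {M : ℝ} (h : CubicGrowth a M) {z : ℂ} (hz : 0 < z.im) :
    HasSum (fun n : ℕ => a n * exp (I * Real.pi * n * z)) (fser a z) := (h.summable hz).hasSum

theorem CubicGrowth.hasDerivAt_fser {a : ℕ → ℂ} {M : ℝ} (h : CubicGrowth a M) {z : ℂ}
    (hz : 0 < z.im) : HasDerivAt (fser a)
      (∑' n : ℕ, I * Real.pi * n * a n * exp (I * Real.pi * n * z)) z := by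
  have hM := h.nonneg
  have hε : 0 < z.im / 2 := by positivity
  have hconv : Convex ℝ {w : ℂ | z.im / 2 < w.im} := convex_halfSpace_im_gt _
  have hu : Summable fun n : ℕ =>
      Real.pi * M * ((2 + n : ℝ) ^ 4 * Real.exp (-Real.pi * (z.im / 2)) ^ n) :=
    (summable_add_two_pow_mul_geometric 4 (Real.exp_pos _) (exp_neg_pi_mul_lt_one hε)).mul_left _
  have hmem : z ∈ {w : ℂ | z.im / 2 < w.im} := by
    rw [Set.mem_ofPred_eq]
    linarith
  have hopen : IsOpen {w : ℂ | z.im / 2 < w.im} := isOpen_lt continuous_const Complex.continuous_im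
  have h1 : ∀ (n : ℕ), ∀ y ∈ {w : ℂ | z.im / 2 < w.im},
      HasDerivAt (fun z : ℂ => a n * exp (I * Real.pi * n * z))
        (I * Real.pi * n * a n * exp (I * Real.pi * n * y)) y := by
    intro n y _
    have h1 : HasDerivAt (fun z : ℂ => I * Real.pi * n * z) (I * Real.pi * n) y := by
      simpa using! (hasDerivAt_id y).const_mul (I * Real.pi * n)
    exact (h1.cexp.const_mul (a n)).congr_deriv (by ring)
  have h2 : ∀ (n : ℕ), ∀ y ∈ {w : ℂ | z.im / 2 < w.im},
      ‖I * Real.pi * n * a n * exp (I * Real.pi * n * y)‖ ≤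
        Real.pi * M * ((2 + n : ℝ) ^ 4 * Real.exp (-Real.pi * (z.im / 2)) ^ n) := by
    intro n y hy
    have h1 := h.norm_term_le (le_of_lt hy) n
    have e : I * Real.pi * n * a n * exp (I * Real.pi * n * y) =
        (I * Real.pi * n) * (a n * exp (I * Real.pi * n * y)) := by ring
    have e2 : ‖(I * Real.pi * n : ℂ)‖ = Real.pi * n := by
      simp [abs_of_pos Real.pi_pos]
    have hπ := Real.pi_pos
    rw [e, norm_mul, e2]
    calc Real.pi * n * ‖a n * exp (I * Real.pi * n * y)‖
        ≤ Real.pi * (2 + n) * (M * ((2 + n) ^ 3 * Real.exp (-Real.pi * (z.im / 2)) ^ n)) := by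
          refine mul_le_mul (mul_le_mul_of_nonneg_left (by linarith) hπ.le) h1 (norm_nonneg _)
            (by positivity)
      _ = _ := by ring
  exact hasDerivAt_tsum_of_isPreconnected hu hopen hconv.isPreconnected h1 h2 hmem
    (h.summable hz) hmem

/-- The pair consisting of a function and its image under the weight two action. -/
def slashPair (g : ℂ → ℂ) : Bool → ℂ → ℂ
  | false => g
  | true => slashS g

theorem blochPair_slashPair {g : ℂ → ℂ} {C : ℝ} (h : IsBloch g C) : BlochPair (slashPair g) C where
  bloch i := by cases i <;> [exact h; exact h.slashS]
  slash i z hz := by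
    cases i
    · rfl
    · exact slashS_slashS g (ne_zero_of_im_pos hz)

theorem hasDerivAt_neg_one_div {z : ℂ} (hz : z ≠ 0) :
    HasDerivAt (fun z : ℂ => -1 / z) (1 / z ^ 2) z := by
  refine ((hasDerivAt_const z (-1 : ℂ)).div (hasDerivAt_id z) hz).congr_deriv ?_
  simp

theorem exists_hyperbolic_primitive : ∃ K : ℝ, 0 < K ∧ ∀ (g : ℂ → ℂ) (C : ℝ), IsBloch g C →
    ∃ a b : ℕ → ℂ, a 0 = 0 ∧ b 0 = 0 ∧
    (∀ n : ℕ, ‖a n‖ ≤ K * C * Real.log (2 + n) ^ 3) ∧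
    (∀ n : ℕ, ‖b n‖ ≤ K * C * Real.log (2 + n) ^ 3) ∧
    CubicGrowth a (K * C) ∧ CubicGrowth b (K * C) ∧
    ∀ z : ℂ, 0 < z.im → HasDerivAt (fun z => fser a z + fser b (-1 / z)) (g z) z := by
  obtain ⟨K, hK, hexp⟩ := exists_glob_expansion
  have hπ := Real.pi_pos
  have hlog : ∀ n : ℕ, 0 ≤ Real.log (2 + n) := fun n => Real.log_nonneg (by
    have : (0 : ℝ) ≤ n := n.cast_nonneg
    linarith)
  refine ⟨K, hK, fun g C h => ?_⟩
  have hC := h.nonneg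
  have hP := blochPair_slashPair h
  have key : ∀ i, ∃ a : ℕ → ℂ, a 0 = 0 ∧ (∀ n : ℕ, ‖a n‖ ≤ K * C * Real.log (2 + n) ^ 3) ∧
      CubicGrowth a (K * C) ∧
      ∀ z : ℂ, 0 < z.im → HasDerivAt (fser a) (glob (slashPair g) i z) z := by
    intro i
    obtain ⟨c, hc, hcb⟩ := hexp _ C hP i
    have hb : ∀ n : ℕ, ‖c n / (I * Real.pi * n)‖ ≤ K * C * Real.log (2 + n) ^ 3 := by
      intro n
      rcases Nat.eq_zero_or_pos n with rfl | hn
      · simp; have := hlog 0; simp at this; positivity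
      · have hn' : (1 : ℝ) ≤ n := by exact_mod_cast hn
        have e2 : ‖(I * Real.pi * n : ℂ)‖ = Real.pi * n := by
          simp [abs_of_pos Real.pi_pos]
        rw [norm_div, e2, div_le_iff₀ (by positivity)]
        refine (hcb n).trans ?_
        have := hlog n
        have h3 : 1 ≤ Real.pi := by linarith [Real.pi_gt_three]
        have h4 : 0 ≤ K * C * Real.log (2 + n) ^ 3 * n := by positivity
        nlinarith
    have hG : CubicGrowth (fun n => c n / (I * Real.pi * n)) (K * C) := by
      intro n
      refine (hb n).trans (mul_le_mul_of_nonneg_left (pow_le_pow_left₀ (hlog n) ?_ 3) (by positivity))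
      have : (0 : ℝ) ≤ n := n.cast_nonneg
      exact (Real.log_le_sub_one_of_pos (by linarith)).trans (by linarith)
    refine ⟨_, by simp, hb, hG, fun z hz => (hG.hasDerivAt_fser hz).congr_deriv ?_⟩
    rw [← (hc z hz).tsum_eq]
    refine tsum_congr fun n => ?_
    rcases Nat.eq_zero_or_pos n with rfl | hn
    · have : c 0 = 0 := by simpa using hcb 0
      simp [this]
    · have h1 : (n : ℂ) ≠ 0 := by exact_mod_cast hn.ne'
      have h2 : (Real.pi : ℂ) ≠ 0 := by exact_mod_cast hπ.ne'
      have h3 : I * Real.pi * n ≠ 0 := mul_ne_zero (mul_ne_zero I_ne_zero h2) h1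
      rw [mul_div_cancel₀ _ h3]
  obtain ⟨a, a0, a1, a2, a3⟩ := key false
  obtain ⟨b, b0, b1, b2, b3⟩ := key true
  refine ⟨a, b, a0, b0, a1, b1, a2, b2, fun z hz => ?_⟩
  have h0 := ne_zero_of_im_pos hz
  have h1 : HasDerivAt (fun z => fser b (-1 / z)) (glob (slashPair g) true (-1 / z) * (1 / z ^ 2)) z :=
    HasDerivAt.comp (h₂ := fser b) z (b3 _ (im_neg_one_div hz)) (hasDerivAt_neg_one_div h0)
  refine ((a3 z hz).add h1).congr_deriv ?_
  have h2 := glob_add_slashS hP false hz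
  rw [slashS, Bool.not_false] at h2
  rw [mul_one_div, h2]
  rfl

end

section

open Complex InnerProductSpace
open scoped Topology

theorem deriv_deriv_comp_path {f : ℂ → ℂ} {γ : ℝ → ℂ} {v : ℂ} {t : ℝ}
    (hγ : ∀ s, HasDerivAt γ v s) (hf : ContDiffAt ℝ 2 f (γ t)) :
    deriv (fun s => deriv (fun r => f (γ r)) s) t = fderiv ℝ (fderiv ℝ f) (γ t) v v := by
  have h1 : ∀ᶠ s in 𝓝 t, deriv (fun r => f (γ r)) s = fderiv ℝ f (γ s) v := by
    filter_upwards [(hγ t).continuousAt.eventually (hf.eventually (by simp))] with s hs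
    exact ((hs.differentiableAt (by simp)).hasFDerivAt.comp_hasDerivAt s (hγ s)).deriv
  rw [Filter.EventuallyEq.deriv_eq h1]
  have h2 : DifferentiableAt ℝ (fderiv ℝ f) (γ t) :=
    (hf.fderiv_right (m := 1) (by norm_num)).differentiableAt (by simp)
  have h3 := (h2.hasFDerivAt.comp_hasDerivAt t (hγ t)).clm_apply (hasDerivAt_const t v)
  simpa using! h3.deriv

theorem HarmonicOnH.harmonicOnNhd {f : ℂ → ℂ} (h : HarmonicOnH f) : HarmonicOnNhd f uhp := by
  have hc : ∀ z ∈ uhp, ContDiffAt ℝ 2 f z := by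
    intro z hz
    have ho : IsOpen {p : ℝ × ℝ | 0 < p.2} := isOpen_lt continuous_const continuous_snd
    have h1 := h.1.contDiffAt (ho.mem_nhds (x := (z.re, z.im)) hz)
    have h2 := ContDiffAt.comp z (f := equivRealProdCLM) h1 equivRealProdCLM.contDiff.contDiffAt
    refine h2.congr_of_eventuallyEq (Eventually.of_forall fun w => ?_)
    simp [re_add_im]
  intro z hz
  refine ⟨hc z hz, ?_⟩
  filter_upwards [isOpen_uhp.mem_nhds hz] with w hw
  have h1 := h.2 w hw
  have hx : ∀ s : ℝ, HasDerivAt (fun x : ℝ => (x : ℂ) + (w.im : ℂ) * I) 1 s := fun s =>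
    ofRealCLM.hasDerivAt.add_const _
  have hy : ∀ s : ℝ, HasDerivAt (fun y : ℝ => (w.re : ℂ) + (y : ℂ) * I) I s := fun s => by
    simpa using! ((ofRealCLM.hasDerivAt (x := s)).mul_const I).const_add (w.re : ℂ)
  have e : (w.re : ℂ) + (w.im : ℂ) * I = w := re_add_im w
  rw [deriv_deriv_comp_path hx (by rw [e]; exact hc w hw),
    deriv_deriv_comp_path hy (by rw [e]; exact hc w hw), e] at h1
  rw [laplacian_eq_iteratedFDeriv_complexPlane]
  simpa [iteratedFDeriv_two_apply] using h1

/-- The holomorphic derivative of a real harmonic function. -/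
def holDeriv (u : ℂ → ℝ) (z : ℂ) : ℂ := fderiv ℝ u z 1 - I * fderiv ℝ u z I

theorem fderiv_eq_re_holDeriv (u : ℂ → ℝ) (z v : ℂ) : fderiv ℝ u z v = (holDeriv u z * v).re := by
  have hv : v = v.re • (1 : ℂ) + v.im • I := by simp [re_add_im]
  conv_lhs => rw [hv, map_add, map_smul, map_smul]
  simp [holDeriv]
  ring

theorem HasDerivAt.hasFDerivAt_re {F : ℂ → ℂ} {F' z : ℂ} (h : HasDerivAt F F' z) :
    HasFDerivAt (fun w => (F w).re)
      (reCLM.comp ((ContinuousLinearMap.toSpanSingleton ℂ F').restrictScalars ℝ)) z :=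
  reCLM.hasFDerivAt.comp z (h.hasFDerivAt.restrictScalars ℝ)

theorem holDeriv_eq_deriv {u : ℂ → ℝ} {F : ℂ → ℂ} {z : ℂ} (hF : DifferentiableAt ℂ F z)
    (h : ∀ᶠ w in 𝓝 z, (F w).re = u w) : holDeriv u z = deriv F z := by
  have h1 := (hF.hasDerivAt.hasFDerivAt_re.congr_of_eventuallyEq
    (h.mono fun _ hw => hw.symm)).fderiv
  rw [holDeriv, h1]
  apply Complex.ext <;> simp

theorem isBloch_holDeriv {u : ℂ → ℝ} (hu : HarmonicOnNhd u uhp) {C : ℝ}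
    (hC : ∀ z, 0 < z.im → |u z| ≤ C) : IsBloch (holDeriv u) (2 * Real.exp (2 * C)) where
  diff z hz := HarmonicAt.differentiableAt_complex_partial (hu z hz)
  bound z hz := by
    have hsub : Metric.ball z z.im ⊆ uhp := by
      intro w hw
      rw [Metric.mem_ball, dist_eq] at hw
      have := (abs_im_le_norm (w - z)).trans_lt hw
      rw [sub_im, abs_lt] at this
      rw [mem_uhp]
      linarith
    obtain ⟨F, hF, hFu⟩ := (hu.mono hsub).exists_analyticOnNhd_ball_re_eq
    have hz' : z ∈ Metric.ball z z.im := Metric.mem_ball_self hz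
    have hd := holDeriv_eq_deriv (hF z hz').differentiableAt
      (Filter.eventually_of_mem (Metric.ball_mem_nhds z hz) fun w hw => hFu hw)
    have hE : ∀ w ∈ Metric.ball z z.im, DifferentiableAt ℂ (fun w => exp (F w)) w :=
      fun w hw => (hF w hw).differentiableAt.cexp
    have hn : ∀ w ∈ Metric.ball z z.im, ‖exp (F w)‖ = Real.exp (u w) := by
      intro w hw
      rw [norm_exp, show (F w).re = u w from hFu hw]
    have hr : 0 < z.im / 2 := by linarith
    have hcl : Metric.closedBall z (z.im / 2) ⊆ Metric.ball z z.im :=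
      Metric.closedBall_subset_ball (by linarith)
    have h1 : ‖deriv (fun w => exp (F w)) z‖ ≤ Real.exp C / (z.im / 2) := by
      refine norm_deriv_le_of_forall_mem_sphere_norm_le hr ?_ ?_
      · refine DifferentiableOn.diffContOnCl fun w hw => ?_
        rw [closure_ball _ hr.ne'] at hw
        exact (hE w (hcl hw)).differentiableWithinAt
      · intro w hw
        have hw' := hcl (Metric.sphere_subset_closedBall hw)
        rw [hn w hw']
        exact Real.exp_le_exp.2 ((le_abs_self _).trans (hC w (hsub hw')))
    have h2 : deriv (fun w => exp (F w)) z = exp (F z) * deriv F z :=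
      ((hF z hz').differentiableAt.hasDerivAt.cexp).deriv
    rw [h2, norm_mul, hn z hz', ← hd] at h1
    have h3 : Real.exp (-C) ≤ Real.exp (u z) := 
      Real.exp_le_exp.2 (by linarith [neg_abs_le (u z), hC z hz])
    have h4 := (mul_le_mul_of_nonneg_right h3 (norm_nonneg (holDeriv u z))).trans h1
    have h5 := mul_le_mul_of_nonneg_left h4 (Real.exp_pos C).le
    rw [← mul_assoc, ← Real.exp_add, add_neg_cancel, Real.exp_zero, one_mul] at h5
    refine h5.trans_eq ?_
    rw [two_mul C, Real.exp_add]
    field_simp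

theorem exists_fser_re_of_harmonic {u : ℂ → ℝ} (hu : HarmonicOnNhd u uhp) {C : ℝ}
    (hC : ∀ z, 0 < z.im → |u z| ≤ C) : ∃ (a b : ℕ → ℂ) (M k : ℝ), a 0 = 0 ∧ b 0 = 0 ∧
    (∀ n : ℕ, ‖a n‖ ≤ M * Real.log (2 + n) ^ 3) ∧ (∀ n : ℕ, ‖b n‖ ≤ M * Real.log (2 + n) ^ 3) ∧
    CubicGrowth a M ∧ CubicGrowth b M ∧
    ∀ z : ℂ, 0 < z.im → u z = k + (fser a z + fser b (-1 / z)).re := by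
  obtain ⟨K, hK, h⟩ := exists_hyperbolic_primitive
  obtain ⟨a, b, a0, b0, a1, b1, a2, b2, hH⟩ := h _ _ (isBloch_holDeriv hu hC)
  have hd : ∀ z, 0 < z.im → HasFDerivAt (fun z => u z - (fser a z + fser b (-1 / z)).re)
      (0 : ℂ →L[ℝ] ℝ) z := by
    intro z hz
    have h1 := (((hu z hz).1.differentiableAt (by simp)).hasFDerivAt).sub (hH z hz).hasFDerivAt_re
    refine h1.congr_fderiv ?_
    ext v
    simp [fderiv_eq_re_holDeriv, mul_comm]
  refine ⟨a, b, _, u I - (fser a I + fser b (-1 / I)).re, a0, b0, a1, b1, a2, b2, fun z hz => ?_⟩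
  have := isOpen_uhp.is_const_of_fderiv_eq_zero (𝕜 := ℝ) isPreconnected_uhp
    (fun z hz => (hd z hz).differentiableAt.differentiableWithinAt)
    (fun z hz => (hd z hz).fderiv) (x := z) (y := I) hz (by simp [mem_uhp])
  linarith

end

section

open Complex
open scoped Topology

theorem CubicGrowth.fser_linear {a b : ℕ → ℂ} {M N : ℝ} (ha : CubicGrowth a M)
    (hb : CubicGrowth b N) (c d : ℂ) {z : ℂ} (hz : 0 < z.im) :
    fser (fun n => c * a n + d * b n) z = c * fser a z + d * fser b z := by
  refine HasSum.tsum_eq ?_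
  refine (((ha.hasSum hz).mul_left c).add ((hb.hasSum hz).mul_left d)).congr_fun fun n => ?_
  ring

/-- The nonconstant holomorphic part of a two-sided coefficient sequence. -/
def posCoeff (a : ℤ → ℂ) (n : ℕ) : ℂ := if n = 0 then 0 else a n

/-- The conjugated antiholomorphic part of a two-sided coefficient sequence. -/
def negCoeff (a : ℤ → ℂ) (n : ℕ) : ℂ := if n = 0 then 0 else starRingEnd ℂ (a (-n))

/-- Two-sided coefficients of cubic growth. -/
def IntCubicGrowth (a : ℤ → ℂ) (M : ℝ) : Prop := ∀ n : ℤ, ‖a n‖ ≤ M * (2 + n.natAbs) ^ 3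

theorem IntCubicGrowth.nonneg {a : ℤ → ℂ} {M : ℝ} (h : IntCubicGrowth a M) : 0 ≤ M := by
  have := (norm_nonneg _).trans (h 0)
  norm_num at this
  linarith

theorem IntCubicGrowth.posCoeff {a : ℤ → ℂ} {M : ℝ} (h : IntCubicGrowth a M) :
    CubicGrowth (posCoeff a) M := by
  intro n
  have := h.nonneg
  unfold _root_.posCoeff
  split_ifs
  · rw [norm_zero]; positivity
  · simpa using h n

theorem IntCubicGrowth.negCoeff {a : ℤ → ℂ} {M : ℝ} (h : IntCubicGrowth a M) :
    CubicGrowth (negCoeff a) M := by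
  intro n
  have := h.nonneg
  unfold _root_.negCoeff
  split_ifs
  · rw [norm_zero]; positivity
  · simpa using h (-n)

theorem hfsTerm_zero (a b : ℤ → ℂ) (τ : ℂ) : hfsTerm a b τ 0 = a 0 := by simp [hfsTerm]

theorem hfsTerm_natCast (a b : ℤ → ℂ) (τ : ℂ) (n : ℕ) :
    hfsTerm a b τ n = (if n = 0 then a 0 else 0) +
      (posCoeff a n * exp (I * Real.pi * n * τ) +
        posCoeff b n * exp (I * Real.pi * n * (-1 / τ))) := by
  rcases Nat.eq_zero_or_pos n with rfl | hn
  · simp [posCoeff, hfsTerm]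
  · have h1 : (0 : ℤ) < n := by exact_mod_cast hn
    have e : I * Real.pi * n * (-1 / τ) = -(I * Real.pi * n) / τ := by ring
    simp only [hfsTerm, if_pos h1, posCoeff, if_neg hn.ne', zero_add, e, Int.cast_natCast]

theorem hfsTerm_neg_natCast (a b : ℤ → ℂ) (τ : ℂ) (n : ℕ) :
    hfsTerm a b τ (-n) = (if n = 0 then a 0 else 0) +
      starRingEnd ℂ (negCoeff a n * exp (I * Real.pi * n * τ) +
        negCoeff b n * exp (I * Real.pi * n * (-1 / τ))) := by
  rcases Nat.eq_zero_or_pos n with rfl | hn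
  · simp [negCoeff, hfsTerm]
  · have h1 : (0 : ℤ) < n := by exact_mod_cast hn
    have h2 : ¬ (0 : ℤ) < -n := by omega
    have h3 : -(n : ℤ) < 0 := by omega
    simp only [hfsTerm, if_neg h2, if_pos h3, negCoeff, if_neg hn.ne', zero_add, map_add, map_mul,
      ← exp_conj, conj_I, conj_ofReal, map_natCast, map_div₀, map_neg, map_one, conj_conj,
      Int.cast_neg, Int.cast_natCast]
    congr 3 <;> ring_nf

theorem norm_hfsTerm_le {a b : ℤ → ℂ} {M ε : ℝ} (ha : IntCubicGrowth a M)
    (hb : IntCubicGrowth b M) {τ : ℂ} (h1 : ε ≤ τ.im) (h2 : ε ≤ (-1 / τ).im) (n : ℤ) :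
    ‖hfsTerm a b τ n‖ ≤ M * ((if n = 0 then 8 else 0) +
      2 * ((2 + n.natAbs) ^ 3 * Real.exp (-Real.pi * ε) ^ n.natAbs)) := by
  have h0 : ∀ m : ℕ, ‖(if m = 0 then a 0 else 0 : ℂ)‖ ≤ M * (if m = 0 then 8 else 0) := by
    intro m
    split_ifs
    · exact (ha 0).trans_eq (by norm_num)
    · simp
  obtain ⟨m, rfl | rfl⟩ := n.eq_nat_or_neg
  · rw [hfsTerm_natCast]
    refine (norm_add_le_of_le (h0 m) (norm_add_le_of_le (ha.posCoeff.norm_term_le h1 m)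
      (hb.posCoeff.norm_term_le h2 m))).trans_eq ?_
    simp
    split_ifs <;> ring
  · rw [hfsTerm_neg_natCast]
    refine (norm_add_le_of_le (h0 m) ((RCLike.norm_conj _).trans_le
      (norm_add_le_of_le (ha.negCoeff.norm_term_le h1 m)
      (hb.negCoeff.norm_term_le h2 m)))).trans_eq ?_
    simp
    split_ifs <;> ring

theorem summable_hfs_majorant {ε : ℝ} (hε : 0 < ε) (M : ℝ) : Summable fun n : ℤ =>
    M * ((if n = 0 then 8 else 0) +
      2 * ((2 + n.natAbs : ℝ) ^ 3 * Real.exp (-Real.pi * ε) ^ n.natAbs)) := by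
  have h := (summable_add_two_pow_mul_geometric 3 (Real.exp_pos _)
    (exp_neg_pi_mul_lt_one hε)).mul_left 2
  refine (Summable.add ?_ (Summable.of_nat_of_neg ?_ ?_)).mul_left M
  · exact (hasSum_ite_eq (0 : ℤ) (8 : ℝ)).summable
  · simpa using h
  · simpa using h

theorem hasSum_hfsTerm {a b : ℤ → ℂ} {M : ℝ} (ha : IntCubicGrowth a M)
    (hb : IntCubicGrowth b M) {τ : ℂ} (hτ : 0 < τ.im) :
    HasSum (fun n : ℤ => hfsTerm a b τ n)
      (a 0 + (fser (posCoeff a) τ + fser (posCoeff b) (-1 / τ)) +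
        starRingEnd ℂ (fser (negCoeff a) τ + fser (negCoeff b) (-1 / τ))) := by
  have hs := im_neg_one_div hτ
  have h0 := hasSum_ite_eq (0 : ℕ) (a 0)
  have h1 := h0.add ((ha.posCoeff.hasSum hτ).add (hb.posCoeff.hasSum hs))
  have h2 := h0.add (((ha.negCoeff.hasSum hτ).add (hb.negCoeff.hasSum hs)).map
    (starRingEnd ℂ) continuous_conj)
  have h3 := HasSum.of_nat_of_neg (f := fun n : ℤ => hfsTerm a b τ n)
    (h1.congr_fun fun n => hfsTerm_natCast a b τ n)
    (h2.congr_fun fun n => hfsTerm_neg_natCast a b τ n)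
  rw [hfsTerm_zero, show ∀ x y z : ℂ, x + y + (x + z) - x = x + y + z by intros; ring] at h3
  exact h3

theorem hhfsExpansion_of_eq {a b : ℤ → ℂ} {M : ℝ} (ha : IntCubicGrowth a M)
    (hb : IntCubicGrowth b M) {f : ℂ → ℂ} (hf : ∀ τ : ℂ, 0 < τ.im → f τ =
      a 0 + (fser (posCoeff a) τ + fser (posCoeff b) (-1 / τ)) +
        starRingEnd ℂ (fser (negCoeff a) τ + fser (negCoeff b) (-1 / τ))) :
    HHFSExpansion a b f := by
  have hsum : ∀ τ : ℂ, 0 < τ.im → HasSum (fun n : ℤ => hfsTerm a b τ n) (f τ) := by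
    intro τ hτ
    rw [hf τ hτ]
    exact hasSum_hfsTerm ha hb hτ
  refine ⟨hsum, fun τ hτ => ?_, fun K hK hKc => ?_⟩
  · have hε : 0 < min τ.im (-1 / τ).im := lt_min hτ (im_neg_one_div hτ)
    exact Summable.of_nonneg_of_le (fun _ => norm_nonneg _)
      (norm_hfsTerm_le ha hb (min_le_left _ _) (min_le_right _ _)) (summable_hfs_majorant hε M)
  · have hcont : ContinuousOn (fun τ : ℂ => min τ.im (-1 / τ).im) K := by
      refine ContinuousOn.inf continuous_im.continuousOn ?_
      exact continuous_im.comp_continuousOn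
        (continuousOn_const.div continuousOn_id fun τ hτ => ne_zero_of_im_pos (hK hτ))
    obtain ⟨ε, hε, hεK⟩ := hKc.exists_forall_le' hcont (a := 0)
      fun τ hτ => lt_min (hK hτ) (im_neg_one_div (hK hτ))
    refine (tendstoUniformlyOn_tsum (summable_hfs_majorant hε M) fun n τ hτ =>
      norm_hfsTerm_le ha hb ((hεK τ hτ).trans (min_le_left _ _))
        ((hεK τ hτ).trans (min_le_right _ _)) n).congr_right fun τ hτ => (hsum τ (hK hτ)).tsum_eq

/-- The two-sided sequence with given holomorphic and conjugated antiholomorphic parts. -/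
def intCoeff (c : ℂ) (p q : ℕ → ℂ) (n : ℤ) : ℂ :=
  if 0 < n then p n.natAbs else if n < 0 then starRingEnd ℂ (q n.natAbs) else c

theorem posCoeff_intCoeff (c : ℂ) {p : ℕ → ℂ} (q : ℕ → ℂ) (hp : p 0 = 0) :
    posCoeff (intCoeff c p q) = p := by
  ext n
  rcases Nat.eq_zero_or_pos n with rfl | hn
  · simp [posCoeff, hp]
  · simp [posCoeff, intCoeff, hn, hn.ne']

theorem negCoeff_intCoeff (c : ℂ) (p : ℕ → ℂ) {q : ℕ → ℂ} (hq : q 0 = 0) :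
    negCoeff (intCoeff c p q) = q := by
  ext n
  rcases Nat.eq_zero_or_pos n with rfl | hn
  · simp [negCoeff, hq]
  · have h : ¬ (n : ℤ) < 0 := by omega
    simp [negCoeff, intCoeff, hn, hn.ne', h]

theorem norm_intCoeff_le {c : ℂ} {p q : ℕ → ℂ} {φ : ℕ → ℝ} (hp : ∀ n, ‖p n‖ ≤ φ n)
    (hq : ∀ n, ‖q n‖ ≤ φ n) {n : ℤ} (hn : n ≠ 0) : ‖intCoeff c p q n‖ ≤ φ n.natAbs := by
  unfold intCoeff
  split_ifs with h1 h2
  · exact hp _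
  · exact (RCLike.norm_conj _).trans_le (hq _)
  · omega

theorem intCubicGrowth_intCoeff {c : ℂ} {p q : ℕ → ℂ} {M : ℝ} (hp : CubicGrowth p M)
    (hq : CubicGrowth q M) : IntCubicGrowth (intCoeff c p q) (M + ‖c‖) := by
  intro n
  have hM := hp.nonneg
  have h1 : (1 : ℝ) ≤ (2 + n.natAbs) ^ 3 := one_le_pow₀ (by
    have : (0 : ℝ) ≤ n.natAbs := Nat.cast_nonneg _
    linarith)
  rcases eq_or_ne n 0 with rfl | hn
  · simp [intCoeff]
    nlinarith [norm_nonneg c]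
  · refine (norm_intCoeff_le (φ := fun n => M * (2 + n) ^ 3) hp hq hn).trans ?_
    have := norm_nonneg c
    exact mul_le_mul_of_nonneg_right (by linarith) (by positivity)

theorem norm_half_add_mul_I_le {x y : ℂ} {r s : ℝ} (hx : ‖x‖ ≤ r) (hy : ‖y‖ ≤ s) {c d : ℂ}
    (hc : ‖c‖ ≤ 1) (hd : ‖d‖ ≤ 1) : ‖c * x + d * y‖ ≤ r + s := by
  refine norm_add_le_of_le ?_ ?_
  · rw [norm_mul]; exact (mul_le_of_le_one_left (norm_nonneg _) hc).trans hx
  · rw [norm_mul]; exact (mul_le_of_le_one_left (norm_nonneg _) hd).trans hy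

theorem exists_hhfsExpansion {f : ℂ → ℂ} (hharm : HarmonicOnH f)
    (hbdd : ∃ C : ℝ, ∀ τ : ℂ, 0 < τ.im → ‖f τ‖ ≤ C) :
    ∃ a b : ℤ → ℂ, CubeLogGrowth a b ∧ HHFSExpansion a b f := by
  obtain ⟨C, hC⟩ := hbdd
  have hu := hharm.harmonicOnNhd.comp_CLM reCLM
  have hv := hharm.harmonicOnNhd.comp_CLM imCLM
  obtain ⟨a, b, M, k, a0, b0, a1, b1, a2, b2, h1⟩ := exists_fser_re_of_harmonic hu (C := C)
    fun z hz => (abs_re_le_norm _).trans (hC z hz)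
  obtain ⟨a', b', M', k', a0', b0', a1', b1', a2', b2', h2⟩ := exists_fser_re_of_harmonic hv (C := C)
    fun z hz => (abs_im_le_norm _).trans (hC z hz)
  have n1 : ‖(1 / 2 : ℂ)‖ ≤ 1 := by norm_num
  have n2 : ‖(I / 2 : ℂ)‖ ≤ 1 := by norm_num
  have n3 : ‖(-I / 2 : ℂ)‖ ≤ 1 := by norm_num
  have hlog : ∀ {x y : ℕ → ℂ} {c d : ℂ}, (∀ n : ℕ, ‖x n‖ ≤ M * Real.log (2 + n) ^ 3) →
      (∀ n : ℕ, ‖y n‖ ≤ M' * Real.log (2 + n) ^ 3) → ‖c‖ ≤ 1 → ‖d‖ ≤ 1 →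
      ∀ n : ℕ, ‖c * x n + d * y n‖ ≤ (M + M') * Real.log (2 + n) ^ 3 := fun hx hy hc hd n =>
    (norm_half_add_mul_I_le (hx n) (hy n) hc hd).trans_eq (by ring)
  have hcub : ∀ {x y : ℕ → ℂ} {c d : ℂ}, CubicGrowth x M →
      CubicGrowth y M' → ‖c‖ ≤ 1 → ‖d‖ ≤ 1 →
      CubicGrowth (fun n : ℕ => c * x n + d * y n) (M + M') := fun hx hy hc hd n =>
    (norm_half_add_mul_I_le (hx n) (hy n) hc hd).trans_eq (by ring)
  set p : ℕ → ℂ := fun n => 1 / 2 * a n + I / 2 * a' n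
  set q : ℕ → ℂ := fun n => 1 / 2 * a n + -I / 2 * a' n
  set r : ℕ → ℂ := fun n => 1 / 2 * b n + I / 2 * b' n
  set s : ℕ → ℂ := fun n => 1 / 2 * b n + -I / 2 * b' n
  refine ⟨intCoeff (k + k' * I) p q, intCoeff (k + k' * I) r s, ⟨M + M', 1, fun n hn => ?_⟩,
    hhfsExpansion_of_eq
      (intCubicGrowth_intCoeff (hcub a2 a2' n1 n2) (hcub a2 a2' n1 n3))
      (intCubicGrowth_intCoeff (hcub b2 b2' n1 n2) (hcub b2 b2' n1 n3)) fun τ hτ => ?_⟩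
  · have hn0 : n ≠ 0 := by rintro rfl; norm_num at hn
    have e : |(n : ℝ)| = n.natAbs := by rw [Nat.cast_natAbs, Int.cast_abs]
    rw [e]
    exact ⟨norm_intCoeff_le (φ := fun n => (M + M') * Real.log (2 + n) ^ 3)
        (hlog a1 a1' n1 n2) (hlog a1 a1' n1 n3) hn0,
      norm_intCoeff_le (φ := fun n => (M + M') * Real.log (2 + n) ^ 3)
        (hlog b1 b1' n1 n2) (hlog b1 b1' n1 n3) hn0⟩
  · have hs := im_neg_one_div hτ
    rw [posCoeff_intCoeff _ _ (by simp [a0, a0']), posCoeff_intCoeff _ _ (by simp [b0, b0']),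
      negCoeff_intCoeff _ _ (by simp [a0, a0']), negCoeff_intCoeff _ _ (by simp [b0, b0']),
      a2.fser_linear a2' _ _ hτ, a2.fser_linear a2' _ _ hτ, b2.fser_linear b2' _ _ hs,
      b2.fser_linear b2' _ _ hs]
    have e1 : (f τ).re = _ := h1 τ hτ
    have e2 : (f τ).im = _ := h2 τ hτ
    have e3 : starRingEnd ℂ 2 = 2 := map_ofNat _ 2
    apply Complex.ext
    · rw [e1]; simp [intCoeff, e3]; ring
    · rw [e2]; simp [intCoeff, e3]; ring

theorem CubicGrowth.tendsto_fser {a : ℕ → ℂ} {M : ℝ} (h : CubicGrowth a M) (h0 : a 0 = 0) :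
    Tendsto (fser a) (comap im atTop) (𝓝 0) := by
  have h1 := tendsto_tsum_of_dominated_convergence (𝓕 := comap im atTop)
    (f := fun (z : ℂ) (n : ℕ) => a n * exp (I * Real.pi * n * z)) (g := fun _ => (0 : ℂ))
    ((summable_add_two_pow_mul_geometric 3 (Real.exp_pos _)
      (exp_neg_pi_mul_lt_one one_pos)).mul_left M) (fun n => ?_) ?_
  · rw [tsum_zero] at h1
    exact h1
  · rcases Nat.eq_zero_or_pos n with rfl | hn
    · simpa [h0] using tendsto_const_nhds
    · have h2 := ((Function.Periodic.qParam_tendsto (h := 2) two_pos).mono_right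
        nhdsWithin_le_nhds).pow n
      rw [zero_pow hn.ne'] at h2
      simp only [qParam_two_pow] at h2
      simpa using h2.const_mul (a n)
  · filter_upwards [preimage_mem_comap (Ici_mem_atTop (1 : ℝ))] with z hz n
    exact h.norm_term_le hz n

theorem fser_add_two (a : ℕ → ℂ) (z : ℂ) : fser a (z + 2) = fser a z := by
  have : Function.Periodic.qParam 2 (z + 2) = Function.Periodic.qParam 2 z := by
    rw [qParam_two_eq, qParam_two_eq, show I * Real.pi * (z + 2) = I * Real.pi * z + 2 * Real.pi * I
      by ring, exp_periodic]
  simp only [fser, ← qParam_two_pow, this]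

theorem two_add_pow_three_le_choose (n : ℕ) : (2 + n : ℝ) ^ 3 ≤ 12 * ((n + 3).choose 3 : ℕ) := by
  have h : 6 * (n + 3).choose 3 = (n + 3) * (n + 2) * (n + 1) := by
    have := Nat.descFactorial_eq_factorial_mul_choose (n + 3) 3
    simp [Nat.descFactorial, Nat.factorial] at this
    rw [← this]
    ring
  have h' : (6 : ℝ) * ((n + 3).choose 3 : ℕ) = (n + 3) * (n + 2) * (n + 1) := by exact_mod_cast h
  have h0 : (0 : ℝ) ≤ n := n.cast_nonneg
  nlinarith [mul_nonneg h0 h0, mul_nonneg (mul_nonneg h0 h0) h0]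

theorem CubicGrowth.norm_fser_le {a : ℕ → ℂ} {M : ℝ} (h : CubicGrowth a M) {z : ℂ}
    (hz : 0 < z.im) : ‖fser a z‖ ≤ 12 * M * (1 + 1 / z.im) ^ 4 := by
  set r := Real.exp (-Real.pi * z.im) with hr
  have hr1 : r < 1 := exp_neg_pi_mul_lt_one hz
  have hr0 : 0 < r := Real.exp_pos _
  have hM := h.nonneg
  have hs := hasSum_choose_mul_geometric_of_norm_lt_one 3 (r := r)
    (by rwa [Real.norm_of_nonneg hr0.le])
  have h1 : ‖fser a z‖ ≤ 12 * M * (1 / (1 - r) ^ 4) := by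
    refine tsum_of_norm_bounded (hs.mul_left (12 * M)) fun n => (h.norm_term_le le_rfl n).trans ?_
    have := mul_le_mul_of_nonneg_right (two_add_pow_three_le_choose n) (pow_nonneg hr0.le n)
    calc M * ((2 + n : ℝ) ^ 3 * r ^ n) ≤ M * (12 * ((n + 3).choose 3 : ℕ) * r ^ n) :=
          mul_le_mul_of_nonneg_left this hM
      _ = _ := by ring
  refine h1.trans (mul_le_mul_of_nonneg_left ?_ (by positivity))
  rw [← one_div_pow]
  refine pow_le_pow_left₀ (by have : 0 < 1 - r := by linarith
                              positivity) ?_ 4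
  have h2 : r * (1 + z.im) ≤ 1 := by
    have h3 : 1 + z.im ≤ Real.exp (Real.pi * z.im) := by
      have := Real.add_one_le_exp (Real.pi * z.im)
      nlinarith [Real.pi_gt_three]
    have h4 := mul_le_mul_of_nonneg_left h3 hr0.le
    rwa [hr, ← Real.exp_add, neg_mul, neg_add_cancel, Real.exp_zero, ← neg_mul, ← hr] at h4
  have h5 : 1 + 1 / z.im = (1 + z.im) / z.im := by field_simp; ring
  rw [h5, div_le_div_iff₀ (by linarith) hz]
  nlinarith

theorem CubicGrowth.eq_zero_of_fser {a : ℕ → ℂ} {M : ℝ} (h : CubicGrowth a M) (h0 : a 0 = 0)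
    (hz : ∀ z : ℂ, 0 < z.im → fser a z = 0) (n : ℕ) : a n = 0 := by
  have h1 : HasFPowerSeriesAt (fun _ : ℂ => (0 : ℂ)) (FormalMultilinearSeries.ofScalars ℂ a) 0 := by
    rw [hasFPowerSeriesAt_iff]
    filter_upwards [Metric.ball_mem_nhds (0 : ℂ) one_pos] with q hq
    simp only [FormalMultilinearSeries.coeff_ofScalars, smul_eq_mul]
    by_cases hq0 : q = 0
    · subst hq0
      convert hasSum_zero with n
      rcases Nat.eq_zero_or_pos n with rfl | hn
      · simp [h0]
      · simp [hn.ne']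
    · have h2 := Function.Periodic.qParam_right_inv (h := 2) two_ne_zero hq0
      set w := Function.Periodic.invQParam 2 q
      have hw : 0 < w.im := by
        rw [mem_ball_zero_iff, ← h2] at hq
        have := (Function.Periodic.norm_qParam_lt_iff (h := 2) two_pos 0 w).1 (by simpa using hq)
        exact this
      have h3 := h.hasSum hw
      rw [hz w hw] at h3
      refine h3.congr_fun fun n => ?_
      rw [← qParam_two_pow, h2, mul_comm]
  have h2 := h1.eq_zero
  have h3 := congrArg (fun p => FormalMultilinearSeries.coeff p n) h2
  simpa using h3.trans (by simp [FormalMultilinearSeries.coeff])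

theorem exists_tendsto_of_polynomial_bound {h : ℂ → ℂ} (hper : ∀ z, h (z + 2) = h z)
    (hd : ∀ z : ℂ, 0 < z.im → DifferentiableAt ℂ h z) {C : ℝ}
    (hb : ∀ z : ℂ, 1 ≤ z.im → ‖h z‖ ≤ C * z.im ^ 4) :
    ∃ L, Tendsto h (comap im atTop) (𝓝 L) := by
  have hP : Function.Periodic h ((2 : ℝ) : ℂ) := fun z => by simpa using hper z
  have hd' : ∀ᶠ z in comap im atTop, DifferentiableAt ℂ h z := by
    filter_upwards [preimage_mem_comap (Ioi_mem_atTop (0 : ℝ))] with z hz using hd z hz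
  set E : ℂ → ℂ := fun z => Function.Periodic.qParam 2 z * h z with hE
  have hEP : Function.Periodic E ((2 : ℝ) : ℂ) := fun z => by
    have : Function.Periodic.qParam 2 (z + 2) = Function.Periodic.qParam 2 z := by
      rw [qParam_two_eq, qParam_two_eq, show I * Real.pi * (z + 2) =
        I * Real.pi * z + 2 * Real.pi * I by ring, exp_periodic]
    simp [hE, this, hper z]
  have hEd : ∀ᶠ z in comap im atTop, DifferentiableAt ℂ E z := by
    filter_upwards [hd'] with z hz
    exact (Function.Periodic.differentiable_qParam z).mul hz
  have hE0 : Tendsto E (comap im atTop) (𝓝 0) := by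
    have h1 : Tendsto (fun y : ℝ => C * (y ^ 4 * Real.exp (-y))) atTop (𝓝 0) := by
      simpa using (Real.tendsto_pow_mul_exp_neg_atTop_nhds_zero 4).const_mul C
    refine squeeze_zero_norm' ?_ (h1.comp tendsto_comap)
    filter_upwards [preimage_mem_comap (Ici_mem_atTop (1 : ℝ))] with z hz
    have hz1 : 1 ≤ z.im := hz
    have h2 := hb z hz1
    simp only [hE, Function.comp, norm_mul, norm_qParam_two]
    have h3 : Real.exp (-Real.pi * z.im) ≤ Real.exp (-z.im) :=
      Real.exp_le_exp.2 (by nlinarith [Real.pi_gt_three])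
    calc _ ≤ Real.exp (-z.im) * (C * z.im ^ 4) :=
          mul_le_mul h3 h2 (norm_nonneg _) (Real.exp_pos _).le
      _ = _ := by ring
  have h1 := Function.Periodic.exp_decay_of_zero_at_inf (h := 2) two_pos hEP hEd hE0
  have h2 : BoundedAtFilter (comap im atTop) h := by
    obtain ⟨K, hK⟩ := h1.bound
    refine Asymptotics.IsBigO.of_bound K ?_
    filter_upwards [hK] with z hz
    have e : Real.exp (-2 * Real.pi * z.im / 2) = ‖Function.Periodic.qParam 2 z‖ := by
      rw [Function.Periodic.norm_qParam]
    have h3 : 0 < ‖Function.Periodic.qParam 2 z‖ :=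
      norm_pos_iff.2 (Function.Periodic.qParam_ne_zero z)
    rw [e, hE, norm_mul, Real.norm_of_nonneg h3.le] at hz
    simp only [Pi.one_apply, norm_one, mul_one]
    nlinarith
  exact ⟨_, Function.Periodic.tendsto_at_I_inf (h := 2) two_pos hP hd' h2⟩

/-- Two periodic holomorphic functions exchanged by `z ↦ -1/z`. -/
structure InvPair (F G : ℂ → ℂ) : Prop where
  per_left : ∀ z, F (z + 2) = F z
  per_right : ∀ z, G (z + 2) = G z
  diff_left : ∀ z : ℂ, 0 < z.im → DifferentiableAt ℂ F z
  diff_right : ∀ z : ℂ, 0 < z.im → DifferentiableAt ℂ G z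
  inv : ∀ z : ℂ, 0 < z.im → F (-1 / z) = G z

namespace InvPair

variable {F G : ℂ → ℂ}

theorem symm (h : InvPair F G) : InvPair G F where
  per_left := h.per_right
  per_right := h.per_left
  diff_left := h.diff_right
  diff_right := h.diff_left
  inv z hz := by
    rw [← h.inv _ (im_neg_one_div hz), neg_one_div_neg_one_div (ne_zero_of_im_pos hz)]

theorem apply_redStrip (h : InvPair F G) (z : ℂ) : F (redStrip z) = F z := by
  have hP : Function.Periodic F 2 := h.per_left
  have := (hP.int_mul (round (z.re / 2))).sub_eq z
  rw [redStrip, mul_comm, this]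

theorem exists_mem_fdD_of_iterate (n : ℕ) : ∀ {F G : ℂ → ℂ}, InvPair F G → ∀ τ : ℂ, 0 < τ.im →
    1 ≤ ‖redStrip (redStep^[n] τ)‖ → ∃ z ∈ fdD, F τ = F z ∨ F τ = G z := by
  induction n with
  | zero => exact fun h τ hτ hn => ⟨_, redStrip_mem_fdD hτ hn, Or.inl (h.apply_redStrip τ).symm⟩
  | succ n ih =>
    intro F G h τ hτ hn
    obtain ⟨z, hz, e⟩ := ih h.symm (redStep τ) (redStep_im_pos hτ) hn
    have h1 : G (redStep τ) = F τ := by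
      rw [redStep, h.symm.inv _ (by rwa [redStrip_im]), h.apply_redStrip]
    exact ⟨z, hz, by rw [← h1]; exact e.symm⟩

theorem exists_mem_fdD (h : InvPair F G) {τ : ℂ} (hτ : 0 < τ.im) :
    ∃ z ∈ fdD, F τ = F z ∨ F τ = G z := by
  obtain ⟨n, hn⟩ := exists_redStep hτ
  exact exists_mem_fdD_of_iterate n h τ hτ hn

theorem cusp_one_add_two (h : InvPair F G) {w : ℂ} (hw : 0 < w.im) :
    F (1 - 1 / (w + 2)) = F (1 - 1 / w) := by
  have w0 := ne_zero_of_im_pos hw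
  have w1 : w + 1 ≠ 0 := ne_zero_of_im_pos (by simpa using hw)
  have w2 : w + 2 ≠ 0 := ne_zero_of_im_pos (by simpa using hw)
  have e0 : 0 < (1 - 1 / (w + 1)).im := by
    have := im_neg_one_div (τ := w + 1) (by simpa using hw)
    rw [show 1 - 1 / (w + 1) = 1 + -1 / (w + 1) by ring]
    simpa using this
  have e1 : -1 / (1 - 1 / (w + 1)) + 2 = 1 - 1 / w := by
    have : 1 - 1 / (w + 1) = w / (w + 1) := by field_simp; ring
    rw [this]
    field_simp
    ring
  have e2 : 0 < (1 - 1 / (w + 2)).im := by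
    have := im_neg_one_div (τ := w + 2) (by simpa using hw)
    rw [show 1 - 1 / (w + 2) = 1 + -1 / (w + 2) by ring]
    simpa using this
  have e3 : -1 / (1 - 1 / (w + 2)) + 2 = 1 - 1 / (w + 1) := by
    have : 1 - 1 / (w + 2) = (w + 1) / (w + 2) := by field_simp; ring
    rw [this]
    field_simp
    ring
  rw [← e1, h.per_left, h.inv _ e0, ← e3, h.per_right, h.symm.inv _ e2]

theorem exists_tendsto_cusp_one (h : InvPair F G) {C : ℝ}
    (hb : ∀ z : ℂ, 0 < z.im → ‖F z‖ ≤ C * (1 + 1 / z.im) ^ 4) :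
    ∃ L, Tendsto (fun w => F (1 - 1 / w)) (comap im atTop) (𝓝 L) := by
  have him : ∀ w : ℂ, (1 - 1 / w).im = (-1 / w).im := fun w => by
    rw [show 1 - 1 / w = 1 + -1 / w by ring]; simp
  have hC : 0 ≤ C := by
    have := (norm_nonneg _).trans (hb I (by simp))
    norm_num at this
    linarith
  set H : ℂ → ℂ := fun w => if 0 < w.im then F (1 - 1 / w) else 0 with hH
  have hHF : ∀ w : ℂ, 0 < w.im → H w = F (1 - 1 / w) := fun w hw => if_pos hw
  have hper : ∀ w, H (w + 2) = H w := by
    intro w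
    by_cases hw : 0 < w.im
    · rw [hHF w hw, hHF _ (by simpa using hw), h.cusp_one_add_two hw]
    · simp [hH, hw]
  have hbound : ∀ w : ℂ, |w.re| ≤ 1 → 1 ≤ w.im → ‖H w‖ ≤ 81 * C * w.im ^ 4 := by
    intro w hw hw1
    have hw0 : 0 < w.im := by linarith
    rw [hHF w hw0]
    refine (hb _ (by rw [him]; exact im_neg_one_div hw0)).trans ?_
    rw [him, im_neg_one_div_eq, one_div_div, mul_comm 81 C, mul_assoc, show (81 : ℝ) = 3 ^ 4 by norm_num,
      ← mul_pow]
    refine mul_le_mul_of_nonneg_left (pow_le_pow_left₀ ?_ ?_ 4) hC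
    · have := normSq_nonneg w
      positivity
    · rw [← le_sub_iff_add_le', div_le_iff₀ hw0, normSq_apply]
      have := abs_le.1 hw
      nlinarith
  suffices hlim : ∃ L, Tendsto H (comap im atTop) (𝓝 L) by
    obtain ⟨L, hL⟩ := hlim
    refine ⟨L, hL.congr' ?_⟩
    filter_upwards [preimage_mem_comap (Ioi_mem_atTop (0 : ℝ))] with w hw using hHF w hw
  refine exists_tendsto_of_polynomial_bound hper (C := 81 * C) (fun w hw => ?_) fun w hw => ?_
  · have h1 : DifferentiableAt ℂ (fun w : ℂ => F (1 - 1 / w)) w := by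
      have w0 := ne_zero_of_im_pos hw
      have h2 : DifferentiableAt ℂ (fun w : ℂ => 1 - 1 / w) w := by fun_prop (disch := assumption)
      exact DifferentiableAt.comp w (h.diff_left _ (by rw [him]; exact im_neg_one_div hw)) h2
    refine h1.congr_of_eventuallyEq ?_
    filter_upwards [isOpen_uhp.mem_nhds hw] with v hv using hHF v hv
  · have hP : Function.Periodic H 2 := hper
    have e : H (redStrip w) = H w := by
      rw [redStrip, mul_comm, (hP.int_mul (round (w.re / 2))).sub_eq w]
    rw [← e]
    have := hbound _ (abs_redStrip_re_le w) (by rwa [redStrip_im])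
    rwa [redStrip_im] at this

theorem eq_cusp_one_left (h : InvPair F G) {z : ℂ} (hz : z ∈ fdD) (hz1 : z.im ≤ 1) :
    ∃ w w' : ℂ, F z = F (1 - 1 / w) ∧ G z = F (1 - 1 / w') ∧ 1 / (2 * z.im) ≤ w.im ∧
      w'.im = w.im := by
  obtain ⟨h0, hre, hn⟩ := hz
  have z0 := ne_zero_of_im_pos h0
  have zm : z - 1 ≠ 0 := ne_zero_of_im_pos (by simpa using h0)
  have zp : z + 1 ≠ 0 := ne_zero_of_im_pos (by simpa using h0)
  have hsq : 1 ≤ z.re ^ 2 + z.im ^ 2 := by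
    have : 1 ≤ ‖z‖ ^ 2 := one_le_pow₀ hn
    rw [← normSq_eq_norm_sq, normSq_apply] at this
    nlinarith
  obtain ⟨hr1, hr2⟩ := abs_le.1 hre
  have key : ∀ s : ℝ, (s = 1 ∧ 0 ≤ z.re ∨ s = -1 ∧ z.re ≤ 0) →
      1 / (2 * z.im) ≤ (-1 / (z - s)).im := by
    intro s hs
    have hd : normSq (z - s) ≤ 2 * z.im * z.im := by
      rw [normSq_apply]
      simp only [sub_re, ofReal_re, sub_im, ofReal_im, sub_zero]
      have hy : z.im ^ 2 ≤ z.im := by nlinarith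
      rcases hs with ⟨rfl, hs⟩ | ⟨rfl, hs⟩
      · have : 1 - z.re ≤ z.im ^ 2 := by nlinarith
        nlinarith
      · have : 1 + z.re ≤ z.im ^ 2 := by nlinarith
        nlinarith
    have hpos : 0 < normSq (z - s) := normSq_pos.2 (ne_zero_of_im_pos (by simpa using h0))
    rw [im_neg_one_div_eq, div_le_div_iff₀ (by positivity) hpos]
    simp only [sub_im, ofReal_im, sub_zero]
    nlinarith
  have hGz : ∀ w : ℂ, w = -1 / z → G z = F w := fun w hw => by rw [hw, h.inv z h0]
  rcases le_total 0 z.re with hs | hs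
  · refine ⟨-1 / (z - 1), -1 / (z - 1) - 1, ?_, ?_, by simpa using key 1 (Or.inl ⟨rfl, hs⟩), by simp⟩
    · congr 1
      field_simp
      ring
    · rw [hGz _ rfl, ← h.per_left]
      congr 1
      have : -1 / (z - 1) - 1 = -z / (z - 1) := by field_simp; ring
      rw [this]
      field_simp
      ring
  · refine ⟨-1 / (z + 1), -1 / (z + 1) + 1, ?_, ?_, by simpa using key (-1) (Or.inr ⟨rfl, hs⟩), by simp⟩
    · rw [← h.per_left]
      congr 1
      field_simp
      ring
    · rw [hGz _ rfl]
      congr 1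
      have : -1 / (z + 1) + 1 = z / (z + 1) := by field_simp; ring
      rw [this]
      field_simp
      ring

theorem eventually_cusps (h : InvPair F G) {c L : ℂ} {p : ℂ → Prop}
    (h1 : Tendsto F (comap im atTop) (𝓝 0)) (h2 : Tendsto G (comap im atTop) (𝓝 c))
    (h3 : Tendsto (fun w => F (1 - 1 / w)) (comap im atTop) (𝓝 L))
    (p0 : ∀ᶠ t in 𝓝 0, p t) (pc : ∀ᶠ t in 𝓝 c, p t) (pL : ∀ᶠ t in 𝓝 L, p t) :
    ∃ η Y : ℝ, 0 < η ∧ ∀ z ∈ fdD, (z.im < η ∨ Y < z.im) → p (F z) ∧ p (G z) := by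
  have ex : ∀ {q : ℂ → Prop}, (∀ᶠ z in comap im atTop, q z) → ∃ Y : ℝ, ∀ z : ℂ, Y ≤ z.im → q z := by
    intro q hq
    obtain ⟨s, hs, hsq⟩ := mem_comap.1 hq
    obtain ⟨Y, hY⟩ := mem_atTop_sets.1 hs
    exact ⟨Y, fun z hz => hsq (hY _ hz)⟩
  obtain ⟨Y, hY⟩ := ex ((h1.eventually p0).and (h2.eventually pc))
  obtain ⟨V, hV⟩ := ex (h3.eventually pL)
  have hV0 : 0 < max V 1 := lt_max_of_lt_right one_pos
  refine ⟨min 1 (1 / (2 * max V 1)), Y, lt_min one_pos (by positivity), fun z hz hzY => ?_⟩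
  rcases hzY with hzY | hzY
  · obtain ⟨w, w', e1, e2, hw, hw'⟩ := h.eq_cusp_one_left hz (hzY.le.trans (min_le_left _ _))
    have h4 : V ≤ w.im := by
      refine le_trans ?_ hw
      have h5 := hzY.le.trans (min_le_right _ _)
      rw [le_div_iff₀ (by positivity)] at h5
      rw [le_div_iff₀ (by have := hz.1; positivity)]
      have := mul_le_mul_of_nonneg_right (le_max_left V 1) hz.1.le
      linarith
    rw [e1, e2]
    exact ⟨hV w h4, hV w' (by rwa [hw'])⟩
  · exact hY z hzY.le

theorem comp_const_of_tendsto (h : InvPair F G) {c L : ℂ} {P : ℂ → ℂ} (hP : Differentiable ℂ P)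
    (h1 : Tendsto F (comap im atTop) (𝓝 0)) (h2 : Tendsto G (comap im atTop) (𝓝 c))
    (h3 : Tendsto (fun w => F (1 - 1 / w)) (comap im atTop) (𝓝 L))
    (p0 : P 0 = 0) (pc : P c = 0) (pL : P L = 0) {z : ℂ} (hz : 0 < z.im) : P (F z) = 0 := by
  by_contra hne
  have hpos : 0 < ‖P (F z)‖ := norm_pos_iff.2 hne
  have hev : ∀ t : ℂ, P t = 0 → ∀ᶠ s in 𝓝 t, ‖P s‖ < ‖P (F z)‖ := by
    intro t ht
    refine (hP.continuous.norm.tendsto t).eventually_lt_const ?_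
    rwa [ht, norm_zero]
  obtain ⟨η, Y, hη, hcusp⟩ := h.eventually_cusps h1 h2 h3 (hev 0 p0) (hev c pc) (hev L pL)
  set K := fdD ∩ {z : ℂ | η ≤ z.im ∧ z.im ≤ Y}
  have hK : IsCompact K := isCompact_fdD_inter η Y hη
  have hmem : ∀ w : ℂ, 0 < w.im → ‖P (F z)‖ ≤ ‖P (F w)‖ →
      ∃ v ∈ K, F w = F v ∨ F w = G v := by
    intro w hw hle
    obtain ⟨v, hv, e⟩ := h.exists_mem_fdD hw
    refine ⟨v, ⟨hv, ?_⟩, e⟩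
    by_contra hcon
    have : v.im < η ∨ Y < v.im := by
      by_contra! h'
      exact hcon h'
    obtain ⟨q1, q2⟩ := hcusp v hv this
    rcases e with e | e <;> rw [e] at hle <;> linarith
  have hcont : ContinuousOn (fun v => max ‖P (F v)‖ ‖P (G v)‖) K := by
    intro v hv
    have d1 := (hP.continuous.continuousAt.comp (h.diff_left v hv.1.1).continuousAt).norm
    have d2 := (hP.continuous.continuousAt.comp (h.diff_right v hv.1.1).continuousAt).norm
    exact (d1.sup d2).continuousWithinAt
  obtain ⟨v0, hv0, -⟩ := hmem z hz le_rfl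
  obtain ⟨v, hv, hmax⟩ := hK.exists_isMaxOn ⟨v0, hv0⟩ hcont
  have hle : ∀ w : ℂ, 0 < w.im → ‖P (F w)‖ ≤ max ‖P (F v)‖ ‖P (G v)‖ := by
    intro w hw
    rcases le_total ‖P (F z)‖ ‖P (F w)‖ with hzw | hzw
    · obtain ⟨u, hu, e⟩ := hmem w hw hzw
      refine le_trans ?_ (hmax hu)
      rcases e with e | e <;> rw [e]
      · exact le_max_left _ _
      · exact le_max_right _ _
    · obtain ⟨u, hu, e⟩ := hmem z hz le_rfl
      refine (hzw.trans ?_).trans (hmax hu)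
      rcases e with e | e <;> rw [e]
      · exact le_max_left _ _
      · exact le_max_right _ _
  obtain ⟨u, hu, hum⟩ : ∃ u : ℂ, 0 < u.im ∧ ‖P (F u)‖ = max ‖P (F v)‖ ‖P (G v)‖ := by
    rcases le_total ‖P (G v)‖ ‖P (F v)‖ with hc | hc
    · exact ⟨v, hv.1.1, (max_eq_left hc).symm⟩
    · exact ⟨-1 / v, im_neg_one_div hv.1.1, by rw [h.inv v hv.1.1, max_eq_right hc]⟩
  have hd : DifferentiableOn ℂ (fun w => P (F w)) uhp := fun w hw =>
    ((hP _).comp w (h.diff_left w hw)).differentiableWithinAt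
  have heq := Complex.eqOn_of_isPreconnected_of_isMaxOn_norm isPreconnected_uhp isOpen_uhp hd hu
    (fun w hw => by simpa [hum] using hle w hw)
  have hlim : Tendsto (fun w => P (F w)) (comap im atTop) (𝓝 0) := by
    have := (hP.continuous.tendsto 0).comp h1
    rwa [p0] at this
  have hlim2 : Tendsto (fun w => P (F w)) (comap im atTop) (𝓝 (P (F u))) := by
    refine tendsto_const_nhds.congr' ?_
    filter_upwards [preimage_mem_comap (Ioi_mem_atTop (0 : ℝ))] with w hw using (heq hw).symm
  have hne' : (comap im (atTop : Filter ℝ)).NeBot :=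
    atTop_neBot.comap_of_surj fun y => ⟨y * I, by simp⟩
  have h0 := tendsto_nhds_unique hlim2 hlim
  have := hle z hz
  rw [← hum, h0, norm_zero] at this
  linarith

theorem eq_zero (h : InvPair F G) {c : ℂ} {C : ℝ}
    (hb : ∀ z : ℂ, 0 < z.im → ‖F z‖ ≤ C * (1 + 1 / z.im) ^ 4)
    (h1 : Tendsto F (comap im atTop) (𝓝 0)) (h2 : Tendsto G (comap im atTop) (𝓝 c))
    {z : ℂ} (hz : 0 < z.im) : F z = 0 := by
  obtain ⟨L, h3⟩ := h.exists_tendsto_cusp_one hb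
  have hP : Differentiable ℂ fun t : ℂ => t * (t - c) * (t - L) := by fun_prop
  have h4 : ∀ w : ℂ, 0 < w.im → F w ∈ ({0, c, L} : Set ℂ) := by
    intro w hw
    have := h.comp_const_of_tendsto hP h1 h2 h3 (by simp) (by simp) (by simp) hw
    simp only [mul_eq_zero, sub_eq_zero] at this
    simp only [Set.mem_insert_iff, Set.mem_singleton_iff]
    tauto
  have h5 : (F '' uhp).Subsingleton := by
    have hfin : (F '' uhp).Finite := Set.Finite.subset (Set.toFinite ({0, c, L} : Set ℂ)) (by
      rintro _ ⟨w, hw, rfl⟩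
      exact h4 w hw)
    exact hfin.countable.isTotallyDisconnected _ subset_rfl
      (isPreconnected_uhp.image F fun w hw => (h.diff_left w hw).continuousAt.continuousWithinAt)
  have hlim2 : Tendsto F (comap im atTop) (𝓝 (F z)) := by
    refine tendsto_const_nhds.congr' ?_
    filter_upwards [preimage_mem_comap (Ioi_mem_atTop (0 : ℝ))] with w hw
    exact h5 ⟨z, hz, rfl⟩ ⟨w, hw, rfl⟩
  have hne' : (comap im (atTop : Filter ℝ)).NeBot :=
    atTop_neBot.comap_of_surj fun y => ⟨y * I, by simp⟩
  exact tendsto_nhds_unique hlim2 h1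

end InvPair

theorem CubicGrowth.hasDerivAt_fser_inv {a : ℕ → ℂ} {M : ℝ} (h : CubicGrowth a M) {z : ℂ}
    (hz : 0 < z.im) : ∃ d, HasDerivAt (fun w => fser a (-1 / w)) d z :=
  ⟨_, (h.hasDerivAt_fser (im_neg_one_div hz)).comp z
    (hasDerivAt_neg_one_div (ne_zero_of_im_pos hz))⟩

/-- A hyperbolic Fourier series equal to a constant vanishes. -/
theorem CubicGrowth.eq_zero_of_fser_add_fser_inv {a b : ℕ → ℂ} {M N : ℝ} (ha : CubicGrowth a M)
    (hb : CubicGrowth b N) (ha0 : a 0 = 0) (hb0 : b 0 = 0) {c : ℂ}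
    (h : ∀ z : ℂ, 0 < z.im → fser a z + fser b (-1 / z) = c) (n : ℕ) : a n = 0 ∧ b n = 0 := by
  have hinv : InvPair (fser a) fun z => c - fser b z :=
    { per_left := fser_add_two a
      per_right := fun z => by simp only [fser_add_two]
      diff_left := fun z hz => (ha.hasDerivAt_fser hz).differentiableAt
      diff_right := fun z hz =>
        (differentiableAt_const c).sub (hb.hasDerivAt_fser hz).differentiableAt
      inv := fun z hz => by
        have := h _ (im_neg_one_div hz)
        rw [neg_one_div_neg_one_div (ne_zero_of_im_pos hz)] at this
        rw [← this]; ring }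
  have hbl := hb.tendsto_fser hb0
  have haz : ∀ z : ℂ, 0 < z.im → fser a z = 0 := fun z hz =>
    hinv.eq_zero (fun w hw => ha.norm_fser_le hw) (ha.tendsto_fser ha0)
      (tendsto_const_nhds.sub hbl) hz
  have hbc : ∀ z : ℂ, 0 < z.im → fser b z = c := fun z hz => by
    have := h _ (im_neg_one_div hz)
    rwa [neg_one_div_neg_one_div (ne_zero_of_im_pos hz), haz _ (im_neg_one_div hz),
      zero_add] at this
  have hc : c = 0 := by
    have : (comap im (atTop : Filter ℝ)).NeBot :=
      atTop_neBot.comap_of_surj fun y => ⟨y * I, by simp⟩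
    refine tendsto_nhds_unique (tendsto_const_nhds.congr' ?_) hbl
    filter_upwards [preimage_mem_comap (Ioi_mem_atTop (0 : ℝ))] with z hz using (hbc z hz).symm
  exact ⟨ha.eq_zero_of_fser ha0 haz n,
    hb.eq_zero_of_fser hb0 (fun z hz => (hbc z hz).trans hc) n⟩

/-- A holomorphic function on the upper half-plane whose sum with an antiholomorphic function is
constant has zero derivative, and so has the antiholomorphic function. -/
theorem deriv_eq_zero_of_add_conj_const {P Q : ℂ → ℂ} {c P' Q' z : ℂ} (hz : 0 < z.im)
    (hP : HasDerivAt P P' z) (hQ : HasDerivAt Q Q' z)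
    (h : ∀ w : ℂ, 0 < w.im → P w + starRingEnd ℂ (Q w) = c) : P' = 0 ∧ Q' = 0 := by
  have h1 : HasFDerivAt (fun w => P w + conjCLE (Q w)) _ z :=
    (hP.hasFDerivAt.restrictScalars ℝ).add
      ((conjCLE : ℂ →L[ℝ] ℂ).hasFDerivAt.comp z (hQ.hasFDerivAt.restrictScalars ℝ))
  have h2 : HasFDerivAt (fun w => P w + conjCLE (Q w)) (0 : ℂ →L[ℝ] ℂ) z := by
    refine (hasFDerivAt_const c z).congr_of_eventuallyEq ?_
    filter_upwards [isOpen_uhp.mem_nhds hz] with w hw using h w hw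
  have h3 := h1.unique h2
  have e1 := DFunLike.congr_fun h3 1
  have e2 := DFunLike.congr_fun h3 I
  simp at e1 e2
  have e3 : P' = starRingEnd ℂ Q' := by
    linear_combination (exp := 1) -I * e2 + (P' - starRingEnd ℂ Q') * I_mul_I
  have e4 : P' = 0 := by linear_combination (e1 + e3) / 2
  refine ⟨e4, ?_⟩
  rw [e4] at e3
  simpa using e3.symm

theorem eq_const_of_add_conj_const {P Q : ℂ → ℂ} {c : ℂ}
    (hP : ∀ z : ℂ, 0 < z.im → ∃ d, HasDerivAt P d z)
    (hQ : ∀ z : ℂ, 0 < z.im → ∃ d, HasDerivAt Q d z)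
    (h : ∀ w : ℂ, 0 < w.im → P w + starRingEnd ℂ (Q w) = c) {z : ℂ} (hz : 0 < z.im) :
    P z = P I ∧ Q z = Q I := by
  have key : ∀ w ∈ uhp, HasDerivAt P 0 w ∧ HasDerivAt Q 0 w := by
    intro w hw
    obtain ⟨p, hp⟩ := hP w hw
    obtain ⟨q, hq⟩ := hQ w hw
    obtain ⟨rfl, rfl⟩ := deriv_eq_zero_of_add_conj_const hw hp hq h
    exact ⟨hp, hq⟩
  have hI : I ∈ uhp := by simp [mem_uhp]
  constructor
  · exact isOpen_uhp.is_const_of_deriv_eq_zero isPreconnected_uhp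
      (fun w hw => (key w hw).1.differentiableAt.differentiableWithinAt)
      (fun w hw => (key w hw).1.deriv) hz hI
  · exact isOpen_uhp.is_const_of_deriv_eq_zero isPreconnected_uhp
      (fun w hw => (key w hw).2.differentiableAt.differentiableWithinAt)
      (fun w hw => (key w hw).2.deriv) hz hI

theorem IntCubicGrowth.mono {a : ℤ → ℂ} {M N : ℝ} (h : IntCubicGrowth a M) (hMN : M ≤ N) :
    IntCubicGrowth a N :=
  fun n => (h n).trans (mul_le_mul_of_nonneg_right hMN (by positivity))

theorem IntCubicGrowth.sub {a b : ℤ → ℂ} {M N : ℝ} (ha : IntCubicGrowth a M)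
    (hb : IntCubicGrowth b N) : IntCubicGrowth (fun n => a n - b n) (M + N) :=
  fun n => (norm_sub_le_of_le (ha n) (hb n)).trans_eq (by ring)

theorem exists_intCubicGrowth_of_log {a : ℤ → ℂ} {C N : ℝ}
    (h : ∀ n : ℤ, N ≤ |(n : ℝ)| → ‖a n‖ ≤ C * Real.log (2 + |(n : ℝ)|) ^ 3) :
    ∃ M, IntCubicGrowth a M := by
  set S := Finset.Icc (-⌈N⌉) ⌈N⌉
  have hS : 0 ≤ ∑ m ∈ S, ‖a m‖ := Finset.sum_nonneg fun _ _ => norm_nonneg _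
  refine ⟨|C| + ∑ m ∈ S, ‖a m‖, fun n => ?_⟩
  have hn : (n.natAbs : ℝ) = |(n : ℝ)| := by simp
  rw [hn]
  have h2 : 1 ≤ 2 + |(n : ℝ)| := by linarith [abs_nonneg (n : ℝ)]
  rw [add_mul]
  by_cases hnN : N ≤ |(n : ℝ)|
  · have hlog : Real.log (2 + |(n : ℝ)|) ≤ 2 + |(n : ℝ)| := Real.log_le_self (by linarith)
    refine ((h n hnN).trans ?_).trans (le_add_of_nonneg_right (by positivity))
    exact mul_le_mul (le_abs_self C) (pow_le_pow_left₀ (Real.log_nonneg h2) hlog 3)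
      (pow_nonneg (Real.log_nonneg h2) 3) (abs_nonneg C)
  · have hmem : n ∈ S := by
      have h3 := abs_lt.1 ((not_le.1 hnN).trans_le (Int.le_ceil N))
      rw [Finset.mem_Icc]
      constructor
      · exact_mod_cast h3.1.le
      · exact_mod_cast h3.2.le
    refine ((Finset.single_le_sum (f := fun m => ‖a m‖) (fun _ _ => norm_nonneg _) hmem).trans
      (le_mul_of_one_le_right hS (one_le_pow₀ h2))).trans (le_add_of_nonneg_left (by positivity))

theorem CubeLogGrowth.exists_intCubicGrowth {a b : ℤ → ℂ} (h : CubeLogGrowth a b) :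
    ∃ M, IntCubicGrowth a M ∧ IntCubicGrowth b M := by
  obtain ⟨C, N, h⟩ := h
  obtain ⟨A, hA⟩ := exists_intCubicGrowth_of_log fun n hn => (h n hn).1
  obtain ⟨B, hB⟩ := exists_intCubicGrowth_of_log fun n hn => (h n hn).2
  exact ⟨max A B, hA.mono (le_max_left _ _), hB.mono (le_max_right _ _)⟩

theorem hfsTerm_sub (a b a' b' : ℤ → ℂ) (τ : ℂ) (n : ℤ) :
    hfsTerm (fun m => a' m - a m) (fun m => b' m - b m) τ n =
      hfsTerm a' b' τ n - hfsTerm a b τ n := by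
  unfold hfsTerm
  split_ifs <;> ring

theorem IntCubicGrowth.eq_zero_of_hasSum {a b : ℤ → ℂ} {M : ℝ} (ha : IntCubicGrowth a M)
    (hb : IntCubicGrowth b M)
    (h : ∀ τ : ℂ, 0 < τ.im → HasSum (fun n : ℤ => hfsTerm a b τ n) 0) :
    (∀ n, a n = 0) ∧ ∀ n, n ≠ 0 → b n = 0 := by
  set P : ℂ → ℂ := fun z => fser (_root_.posCoeff a) z + fser (_root_.posCoeff b) (-1 / z) with hP
  set Q : ℂ → ℂ := fun z => fser (_root_.negCoeff a) z + fser (_root_.negCoeff b) (-1 / z) with hQ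
  have hsum : ∀ z : ℂ, 0 < z.im → a 0 + P z + starRingEnd ℂ (Q z) = 0 := fun z hz =>
    (hasSum_hfsTerm ha hb hz).unique (h z hz)
  have hPQ : ∀ z : ℂ, 0 < z.im → P z = P I ∧ Q z = Q I := fun z hz => by
    refine eq_const_of_add_conj_const (c := -a 0) (fun w hw => ?_) (fun w hw => ?_)
      (fun w hw => by linear_combination hsum w hw) hz
    · obtain ⟨d, hd⟩ := hb.posCoeff.hasDerivAt_fser_inv hw
      exact ⟨_, (ha.posCoeff.hasDerivAt_fser hw).add hd⟩
    · obtain ⟨d, hd⟩ := hb.negCoeff.hasDerivAt_fser_inv hw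
      exact ⟨_, (ha.negCoeff.hasDerivAt_fser hw).add hd⟩
  have hpos := ha.posCoeff.eq_zero_of_fser_add_fser_inv hb.posCoeff (by simp [_root_.posCoeff])
    (by simp [_root_.posCoeff]) fun z hz => (hPQ z hz).1
  have hneg := ha.negCoeff.eq_zero_of_fser_add_fser_inv hb.negCoeff (by simp [_root_.negCoeff])
    (by simp [_root_.negCoeff]) fun z hz => (hPQ z hz).2
  have hne : ∀ n : ℤ, n ≠ 0 → a n = 0 ∧ b n = 0 := by
    intro n hn
    obtain ⟨m, rfl | rfl⟩ := n.eq_nat_or_neg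
    · have hm : m ≠ 0 := by simpa using hn
      simpa [_root_.posCoeff, hm] using hpos m
    · have hm : m ≠ 0 := by simpa using hn
      simpa [_root_.negCoeff, hm] using hneg m
  have h0 : a 0 = 0 := by
    have h1 := h I (by simp)
    rw [← hfsTerm_zero a b I]
    refine (hasSum_single (0 : ℤ) fun n hn => ?_).unique h1
    simp only [hfsTerm, hne n hn, zero_mul, add_zero]
    split_ifs
    · rfl
    · rfl
    · omega
  refine ⟨fun n => ?_, fun n hn => (hne n hn).2⟩
  rcases eq_or_ne n 0 with rfl | hn
  · exact h0
  · exact (hne n hn).1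

theorem HHFSExpansion.coeff_unique {f : ℂ → ℂ} {a b a' b' : ℤ → ℂ} (hg : CubeLogGrowth a b)
    (hg' : CubeLogGrowth a' b') (h : HHFSExpansion a b f) (h' : HHFSExpansion a' b' f) :
    (∀ n : ℤ, a' n = a n) ∧ ∀ n : ℤ, n ≠ 0 → b' n = b n := by
  obtain ⟨M, ha, hb⟩ := hg.exists_intCubicGrowth
  obtain ⟨M', ha', hb'⟩ := hg'.exists_intCubicGrowth
  obtain ⟨h1, h2⟩ := (ha'.sub ha).eq_zero_of_hasSum (hb'.sub hb) fun τ hτ => by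
    simpa only [hfsTerm_sub, sub_self] using (h'.1 τ hτ).sub (h.1 τ hτ)
  exact ⟨fun n => sub_eq_zero.1 (h1 n), fun n hn => sub_eq_zero.1 (h2 n hn)⟩

end

/-- A bounded harmonic `f : ℍ → ℂ` has a harmonic hyperbolic Fourier
series expansion with coefficients `|aₙ|, |bₙ| = O(log³(2+|n|))`, converging absolutely
and uniformly on compact subsets of `ℍ`; the coefficients are uniquely determined
by `f`. -/
theorem statement13 (f : ℂ → ℂ)
    (hharm : HarmonicOnH f)
    (hbdd : ∃ C : ℝ, ∀ τ : ℂ, 0 < τ.im → ‖f τ‖ ≤ C) :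
    ∃ a b : ℤ → ℂ, CubeLogGrowth a b ∧ HHFSExpansion a b f ∧
      ∀ a' b' : ℤ → ℂ, CubeLogGrowth a' b' → HHFSExpansion a' b' f →
        (∀ n : ℤ, a' n = a n) ∧ (∀ n : ℤ, n ≠ 0 → b' n = b n) := by
  obtain ⟨a, b, hg, he⟩ := exists_hhfsExpansion hharm hbdd
  exact ⟨a, b, hg, he, fun a' b' hg' he' => he.coeff_unique hg hg' he'⟩

end
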